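/- Let q ≥ 3 be a fixed integer and let χ be a fixed nonprincipal Dirichlet character modulo q. Then there exist an absolute constant c > 0 and a sequence of real numbers x_i → ∞ (depending on χ) such that Re(θ(x_i, χ)) ≤ −c · x_i^{1/2} · log log log x_i for every i. The same oscillation result holds with ψ(x,χ) in place of θ(x,χ). -/

import Mathlib

open Filter Real Complex
open scoped Classical

/-- `ψ(x,χ) = ∑_{n ≤ x} χ(n) Λ(n)`. -/
noncomputable def psiChi {q : ℕ} (χ : DirichletCharacter ℂ q) (x : ℝ) : ℂ :=
  ∑ n ∈ Finset.range (Nat.floor x + 1), χ n * (ArithmeticFunction.vonMangoldt n : ℂ)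

/-- `θ(x,χ) = ∑_{p ≤ x} χ(p) log p`. -/
noncomputable def thetaChi {q : ℕ} (χ : DirichletCharacter ℂ q) (x : ℝ) : ℂ :=
  ∑ p ∈ (Finset.range (Nat.floor x + 1)).filter Nat.Prime, χ p * (Real.log p : ℂ)

namespace LittlewoodOscillation

open MeasureTheory Topology

/-- The triangular function of height one supported on `[-T, T]`. -/
noncomputable def tent (T t : ℝ) : ℝ := max 0 (1 - |t| / T)

/-- The Fejér kernel, the Fourier transform of `tent T`. -/
noncomputable def fejer (T v : ℝ) : ℝ := ∫ t, tent T t * Real.cos (t * v)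

lemma tent_nonneg (T t : ℝ) : 0 ≤ tent T t := le_max_left _ _

lemma tent_le_one {T : ℝ} (hT : 0 < T) (t : ℝ) : tent T t ≤ 1 := by
  have : 0 ≤ |t| / T := by positivity
  exact max_le zero_le_one (by linarith)

lemma tent_neg (T t : ℝ) : tent T (-t) = tent T t := by simp [tent]

@[fun_prop]
lemma continuous_tent (T : ℝ) : Continuous (tent T) := by unfold tent; fun_prop

lemma tent_eq_zero {T t : ℝ} (hT : 0 < T) (ht : T ≤ |t|) : tent T t = 0 := by
  have : 1 ≤ |t| / T := by rwa [le_div_iff₀ hT, one_mul]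
  exact max_eq_left (by linarith)

lemma tent_ge_half {T t : ℝ} (hT : 0 < T) (ht : |t| ≤ T / 2) : 1 / 2 ≤ tent T t := by
  have : |t| / T ≤ 1 / 2 := by rw [div_le_iff₀ hT]; linarith
  exact le_max_of_le_right (by linarith)

lemma tent_eq_of_mem {T t : ℝ} (hT : 0 < T) (ht : t ∈ Set.Icc 0 T) : tent T t = 1 - t / T := by
  have : t / T ≤ 1 := by rw [div_le_one hT]; exact ht.2
  rw [tent, abs_of_nonneg ht.1, max_eq_right (by linarith)]

lemma hasCompactSupport_tent {T : ℝ} (hT : 0 < T) : HasCompactSupport (tent T) := by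
  refine HasCompactSupport.of_support_subset_isCompact (isCompact_Icc (a := -T) (b := T)) ?_
  intro t ht
  by_contra h
  refine ht (tent_eq_zero hT ?_)
  rw [Set.mem_Icc, ← abs_le] at h
  exact (not_le.mp h).le

lemma integrable_tent_mul {E : Type*} [NormedAddCommGroup E] [NormedSpace ℝ E] {T : ℝ} (hT : 0 < T)
    {g : ℝ → E} (hg : Continuous g) : Integrable (fun t => tent T t • g t) :=
  ((continuous_tent T).smul hg).integrable_of_hasCompactSupport
    ((hasCompactSupport_tent hT).smul_right)

lemma integral_tent_mul_even {T : ℝ} (hT : 0 < T) {g : ℝ → ℝ}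
    (he : ∀ t, g (-t) = g t) :
    ∫ t, tent T t * g t = 2 * ∫ t in (0 : ℝ)..T, (1 - t / T) * g t := by
  have h := integral_comp_abs (f := fun t => tent T t * g t)
  have h1 : ∀ t, tent T |t| * g |t| = tent T t * g t := fun t => by
    rcases abs_choice t with h | h <;> simp [h, tent_neg, he]
  simp only [h1] at h
  rw [h, intervalIntegral.integral_of_le hT.le]
  congr 1
  rw [setIntegral_eq_of_subset_of_forall_sdiff_eq_zero measurableSet_Ioi
    (show Set.Ioc 0 T ⊆ Set.Ioi 0 from Set.Ioc_subset_Ioi_self)]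
  · exact setIntegral_congr_fun measurableSet_Ioc fun t ht => by
      rw [tent_eq_of_mem hT ⟨ht.1.le, ht.2⟩]
  · intro t ht
    have h0 : 0 < t := ht.1
    have : T ≤ |t| := by
      rw [abs_of_pos h0]; by_contra h; exact ht.2 ⟨h0, (not_le.mp h).le⟩
    rw [tent_eq_zero hT this, zero_mul]

lemma fejer_eq {T v : ℝ} (hT : 0 < T) (hv : v ≠ 0) :
    fejer T v = 2 * (1 - Real.cos (T * v)) / (T * v ^ 2) := by
  rw [fejer, integral_tent_mul_even hT (by simp)]
  have : ∀ t ∈ Set.uIcc 0 T, HasDerivAt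
      (fun t => (1 - t / T) * (Real.sin (t * v) / v) - Real.cos (t * v) / (T * v ^ 2))
      ((1 - t / T) * Real.cos (t * v)) t := by
    intro t _
    have h1 : HasDerivAt (fun t => t * v) v t := by simpa using (hasDerivAt_id t).mul_const v
    have h2 : HasDerivAt (fun t => 1 - t / T) (-(1 / T)) t := by
      simpa using ((hasDerivAt_id t).div_const T).const_sub 1
    have h3 := (h2.mul (h1.sin.div_const v)).sub (h1.cos.div_const (T * v ^ 2))
    refine h3.congr_deriv ?_
    field_simp
    ring
  rw [intervalIntegral.integral_eq_sub_of_hasDerivAt this (by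
    apply Continuous.intervalIntegrable; fun_prop)]
  simp [hT.ne']
  field_simp
  ring

lemma fejer_le_two_mul {T : ℝ} (hT : 0 < T) (v : ℝ) : fejer T v ≤ 2 * T := by
  have h1 : fejer T v ≤ ∫ t, tent T t * 1 := by
    refine integral_mono (integrable_tent_mul (g := fun t => Real.cos (t * v)) hT (by fun_prop))
      (integrable_tent_mul (g := fun _ => (1:ℝ)) hT (by fun_prop)) fun t => ?_
    exact mul_le_mul_of_nonneg_left (Real.cos_le_one _) (tent_nonneg _ _)
  refine h1.trans ?_
  rw [integral_tent_mul_even hT (by simp)]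
  have : ∫ t in (0 : ℝ)..T, (1 - t / T) * 1 ≤ ∫ t in (0 : ℝ)..T, 1 := by
    refine intervalIntegral.integral_mono_on hT.le (by apply Continuous.intervalIntegrable; fun_prop)
      (by simp) fun t ht => ?_
    have : 0 ≤ t / T := div_nonneg ht.1 hT.le
    linarith
  simp at this ⊢
  linarith

lemma fejer_nonneg {T : ℝ} (hT : 0 < T) (v : ℝ) : 0 ≤ fejer T v := by
  by_cases hv : v = 0
  · subst hv
    refine integral_nonneg fun t => ?_
    simp [tent_nonneg]
  · rw [fejer_eq hT hv]
    have := Real.cos_le_one (T * v)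
    apply div_nonneg <;> [linarith; positivity]

lemma fejer_le {T : ℝ} (hT : 0 < T) (v : ℝ) : fejer T v ≤ 8 * (T / (1 + (T * v) ^ 2)) := by
  by_cases h : (T * v) ^ 2 ≤ 1
  · refine (fejer_le_two_mul hT v).trans ?_
    rw [← mul_div_assoc, le_div_iff₀ (by positivity)]
    nlinarith
  · have hv : v ≠ 0 := by rintro rfl; simp at h
    rw [fejer_eq hT hv, ← mul_div_assoc, div_le_div_iff₀ (by positivity) (by positivity)]
    have := Real.neg_one_le_cos (T * v)
    have h3 : 2 * (1 - Real.cos (T * v)) ≤ 4 := by linarith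
    calc _ ≤ 4 * (1 + (T * v) ^ 2) := by gcongr
      _ ≤ 4 * (2 * (T * v) ^ 2) := by gcongr; linarith
      _ = _ := by ring

@[fun_prop]
lemma continuous_fejer {T : ℝ} (hT : 0 < T) : Continuous (fejer T) := by
  refine continuous_of_dominated (bound := tent T) ?_ ?_ ?_ ?_
  · intro v; exact Continuous.aestronglyMeasurable (by fun_prop)
  · intro v
    refine ae_of_all _ fun t => ?_
    rw [norm_mul, Real.norm_of_nonneg (tent_nonneg T t)]
    exact mul_le_of_le_one_right (tent_nonneg _ _) (Real.abs_cos_le_one _)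
  · simpa using integrable_tent_mul (g := fun _ => (1:ℝ)) hT (by fun_prop)
  · exact ae_of_all _ fun t => by fun_prop

lemma integral_tent_mul_cexp {T : ℝ} (hT : 0 < T) (v : ℝ) :
    ∫ t : ℝ, (tent T t : ℂ) * cexp (-(t * v * I)) = fejer T v := by
  have h1 : ∀ t : ℝ, (tent T t : ℂ) * cexp (-(t * v * I)) =
      ((tent T t * Real.cos (t * v) : ℝ) : ℂ) - ((tent T t * Real.sin (t * v) : ℝ) : ℂ) * I := by
    intro t
    rw [show -((t:ℂ) * v * I) = ((-(t * v) : ℝ) : ℂ) * I by push_cast; ring, Complex.exp_mul_I]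
    rw [← Complex.ofReal_cos, ← Complex.ofReal_sin, Real.cos_neg, Real.sin_neg]
    push_cast
    ring
  have h2 : ∫ t, tent T t * Real.sin (t * v) = 0 := by
    have := integral_neg_eq_self (fun t => tent T t * Real.sin (t * v)) volume
    simp only [tent_neg, neg_mul, Real.sin_neg, mul_neg, integral_neg] at this
    linarith
  simp_rw [h1]
  rw [integral_sub, integral_mul_const, integral_complex_ofReal, integral_complex_ofReal, h2, fejer]
  · simp
  · exact (integrable_tent_mul (g := fun t => Real.cos (t * v)) hT (by fun_prop)).ofReal
  · exact (integrable_tent_mul (g := fun t => Real.sin (t * v)) hT (by fun_prop)).ofReal.mul_const _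

lemma integrable_poisson {T : ℝ} (hT : 0 < T) (v : ℝ) :
    Integrable (fun x => T / (1 + (T * (v - x)) ^ 2)) := by
  have h := (integrable_inv_one_add_sq.comp_mul_left' hT.ne').comp_sub_left v
  simpa [div_eq_mul_inv] using h.const_mul T

lemma integral_poisson {T : ℝ} (hT : 0 < T) (v : ℝ) :
    ∫ x, T / (1 + (T * (v - x)) ^ 2) = π := by
  rw [integral_sub_left_eq_self (fun x => T / (1 + (T * x) ^ 2)) volume v]
  have := Measure.integral_comp_mul_left (fun x : ℝ => T * (1 + x ^ 2)⁻¹) T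
  simp only [div_eq_mul_inv]
  rw [this, integral_const_mul, integral_univ_inv_one_add_sq, abs_of_pos (inv_pos.mpr hT), smul_eq_mul]
  field_simp

/-- The Fejér kernel convolved with a one-sided exponential. -/
noncomputable def expFejer (T v : ℝ) : ℝ := ∫ x in Set.Ioi 0, Real.exp (-x / 2) * fejer T (v - x)

lemma expFejer_nonneg {T : ℝ} (hT : 0 < T) (v : ℝ) : 0 ≤ expFejer T v :=
  integral_nonneg fun _ => mul_nonneg (Real.exp_pos _).le (fejer_nonneg hT _)

lemma expFejer_le {T : ℝ} (hT : 1 ≤ T) (v : ℝ) : expFejer T v ≤ 528 * (π + 4) / (1 + v ^ 2) := by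
  have hT0 : 0 < T := by linarith
  have key : ∀ x ∈ Set.Ioi (0:ℝ), (1 + v ^ 2) * (Real.exp (-x / 2) * fejer T (v - x)) ≤
      528 * (T / (1 + (T * (v - x)) ^ 2) + Real.exp (-(1/4) * x)) := by
    intro x hx
    have hx : 0 < x := hx
    set y := v - x with hy
    have p1 : 1 + v ^ 2 ≤ 2 * (1 + x ^ 2) * (1 + y ^ 2) := by
      have : v = x + y := by rw [hy]; ring
      rw [this]; nlinarith [sq_nonneg (x - y), sq_nonneg (x * y)]
    have p2 : (1 + x ^ 2) * Real.exp (-x / 2) ≤ 33 * Real.exp (-(1/4) * x) := by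
      have e1 : Real.exp (-x / 2) = Real.exp (-(1/4) * x) * Real.exp (-(1/4) * x) := by
        rw [← Real.exp_add]; ring_nf
      have e2 : (1 + x ^ 2) * Real.exp (-(1/4) * x) ≤ 33 := by
        have := Real.quadratic_le_exp_of_nonneg (x := (1/4) * x) (by positivity)
        rw [show -(1/4) * x = - ((1/4) * x) by ring, Real.exp_neg, ← div_eq_mul_inv,
          div_le_iff₀ (Real.exp_pos _)]
        nlinarith
      rw [e1]
      have := Real.exp_pos (-(1/4) * x)
      nlinarith
    have p3 : (1 + y ^ 2) * (T / (1 + (T * y) ^ 2)) ≤ T / (1 + (T * y) ^ 2) + 1 := by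
      rw [add_mul, one_mul]
      gcongr
      rw [← mul_div_assoc, div_le_one (by positivity)]
      have : 0 ≤ y ^ 2 := sq_nonneg y
      have h2 : T ≤ T ^ 2 := by nlinarith
      nlinarith
    have p4 := fejer_le hT0 y
    have p5 : Real.exp (-(1/4) * x) ≤ 1 := by rw [Real.exp_le_one_iff]; linarith
    set e := Real.exp (-(1/4) * x) with he
    have e0 : 0 < e := Real.exp_pos _
    set P := T / (1 + (T * y) ^ 2) with hP
    have P0 : 0 < P := by positivity
    calc (1 + v ^ 2) * (Real.exp (-x / 2) * fejer T y)
        ≤ (2 * (1 + x ^ 2) * (1 + y ^ 2)) * (Real.exp (-x / 2) * (8 * P)) := by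
          have := fejer_nonneg hT0 y
          gcongr
      _ = 16 * ((1 + x ^ 2) * Real.exp (-x / 2)) * ((1 + y ^ 2) * P) := by ring
      _ ≤ 16 * (33 * e) * (P + 1) := by gcongr
      _ ≤ _ := by nlinarith
  rw [le_div_iff₀ (by positivity), mul_comm, expFejer, ← integral_const_mul]
  have i1 : IntegrableOn (fun x => T / (1 + (T * (v - x)) ^ 2)) (Set.Ioi 0) :=
    (integrable_poisson hT0 v).integrableOn
  have i2 : IntegrableOn (fun x => Real.exp (-(1/4) * x)) (Set.Ioi 0) :=
    exp_neg_integrableOn_Ioi 0 (by norm_num)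
  calc _ ≤ ∫ x in Set.Ioi 0, 528 * (T / (1 + (T * (v - x)) ^ 2) + Real.exp (-(1/4) * x)) := by
        refine integral_mono_of_nonneg ?_ ((i1.add i2).const_mul 528) ?_
        · exact ae_of_all _ fun x => mul_nonneg (by positivity)
            (mul_nonneg (Real.exp_pos _).le (fejer_nonneg hT0 _))
        · exact (ae_restrict_iff' measurableSet_Ioi).mpr (ae_of_all _ key)
    _ = 528 * ((∫ x in Set.Ioi 0, T / (1 + (T * (v - x)) ^ 2)) + 4) := by
        rw [integral_const_mul, integral_add i1 i2, integral_exp_mul_Ioi (by norm_num)]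
        norm_num
    _ ≤ _ := by
        gcongr
        rw [← integral_poisson hT0 v]
        exact setIntegral_le_integral (integrable_poisson hT0 v)
          (ae_of_all _ fun x => by simp only [Pi.zero_apply]; positivity)

lemma integral_exp_mul_cexp (t : ℝ) :
    ∫ x in Set.Ioi (0:ℝ), cexp (-(1 / 2 - t * I) * x) = 1 / (1 / 2 - t * I) := by
  have := integral_exp_mul_complex_Ioi (a := -(1 / 2 - t * I)) (by simp) 0
  rw [this, neg_div_neg_eq]
  simp

lemma integral_tent_mul_cexp_div {T : ℝ} (hT : 0 < T) (v : ℝ) :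
    ∫ t : ℝ, (tent T t : ℂ) * (cexp (-(t * v * I)) / (1 / 2 - t * I)) = expFejer T v := by
  have h1 : ∀ t : ℝ, (tent T t : ℂ) * (cexp (-(t * v * I)) / (1 / 2 - t * I)) =
      ∫ x in Set.Ioi (0:ℝ), (tent T t : ℂ) * cexp (-(t * v * I)) * cexp (-(1 / 2 - t * I) * x) := by
    intro t
    rw [integral_const_mul, integral_exp_mul_cexp]
    ring
  simp_rw [h1]
  rw [integral_integral_swap]
  · rw [expFejer, ← integral_complex_ofReal]
    refine integral_congr_ae (ae_of_all _ fun x => ?_)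
    simp only
    push_cast
    rw [← integral_tent_mul_cexp hT, ← integral_const_mul]
    refine integral_congr_ae (ae_of_all _ fun t => ?_)
    simp only
    rw [mul_assoc, ← Complex.exp_add, mul_left_comm, ← Complex.exp_add]
    congr 2
    push_cast
    ring
  · have hi : Integrable (fun t => tent T t) := by
      simpa using integrable_tent_mul (g := fun _ => (1:ℝ)) hT (by fun_prop)
    have he : IntegrableOn (fun x => Real.exp (-(1/2) * x)) (Set.Ioi 0) :=
      exp_neg_integrableOn_Ioi 0 (by norm_num)
    refine (hi.mul_prod he).mono' ?_ ?_
    · exact Continuous.aestronglyMeasurable (by unfold Function.uncurry; fun_prop)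
    · refine ae_of_all _ fun z => ?_
      simp only [Function.uncurry, norm_mul, Complex.norm_exp]
      simp [abs_of_nonneg (tent_nonneg _ _)]

lemma integral_tent_mul_cexp_div' {T : ℝ} (hT : 0 < T) (v : ℝ) :
    ∫ t : ℝ, (tent T t : ℂ) * (cexp (-(t * v * I)) / (1 / 2 + t * I)) = expFejer T (-v) := by
  rw [← integral_tent_mul_cexp_div hT, ← integral_neg_eq_self]
  refine integral_congr_ae (ae_of_all _ fun t => ?_)
  simp only [tent_neg]
  push_cast
  congr 2
  · congr 1; ring
  · ring

end LittlewoodOscillation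

namespace LittlewoodOscillation

open MeasureTheory Topology

/-- Dirichlet's simultaneous approximation theorem, in exponential form. -/
lemma exists_natCast_mul_exp_near_one (Z : Finset ℝ) (U : ℝ) {Q : ℕ} (hQ : 0 < Q) :
    ∃ j : ℕ, 1 ≤ j ∧ j ≤ Q ^ Z.card ∧
      ∀ γ ∈ Z, ‖cexp (I * ((γ * (j * U) : ℝ) : ℂ)) - 1‖ ≤ 2 * π / Q := by
  have hQ0 : (0 : ℝ) < Q := by exact_mod_cast hQ
  let x : ℝ → ℝ := fun γ => γ * U / (2 * π)
  have hlt : ∀ (j : ℕ) (γ : ℝ), ⌊Q * Int.fract (j * x γ)⌋₊ < Q := by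
    intro j γ
    rw [Nat.floor_lt (by have := Int.fract_nonneg (j * x γ); positivity)]
    have := Int.fract_lt_one (j * x γ)
    nlinarith
  let F : Fin (Q ^ Z.card + 1) → (Z → Fin Q) := fun j γ => ⟨_, hlt j γ⟩
  obtain ⟨a, b, hab, hF⟩ := Fintype.exists_ne_map_eq_of_card_lt F (by simp)
  wlog h : a < b generalizing a b
  · exact this b a hab.symm hF.symm (lt_of_le_of_ne (not_lt.1 h) hab.symm)
  have hab' : (a : ℕ) < b := h
  refine ⟨b - a, by omega, by omega, fun γ hγ => ?_⟩
  have h1 := congrArg Fin.val (congrFun hF ⟨γ, hγ⟩)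
  simp only [F] at h1
  set u := Int.fract ((a : ℕ) * x γ)
  set v := Int.fract ((b : ℕ) * x γ)
  have hu : 0 ≤ (Q : ℝ) * u := mul_nonneg hQ0.le (Int.fract_nonneg _)
  have hv : 0 ≤ (Q : ℝ) * v := mul_nonneg hQ0.le (Int.fract_nonneg _)
  have hδ : |v - u| ≤ 1 / Q := by
    have a1 := Nat.floor_le hu
    have a2 := Nat.lt_floor_add_one ((Q : ℝ) * u)
    have b1 := Nat.floor_le hv
    have b2 := Nat.lt_floor_add_one ((Q : ℝ) * v)
    rw [h1] at a1 a2
    rw [le_div_iff₀ hQ0, ← abs_of_pos hQ0, ← abs_mul, abs_le]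
    constructor <;> nlinarith
  have e : γ * (((b - a : ℕ) : ℝ) * U) =
      2 * π * (v - u) + ((⌊((b : ℕ) : ℝ) * x γ⌋ - ⌊((a : ℕ) : ℝ) * x γ⌋ : ℤ) : ℝ) * (2 * π) := by
    have e1 : u = (a : ℕ) * x γ - ⌊((a : ℕ) : ℝ) * x γ⌋ := rfl
    have e2 : v = (b : ℕ) * x γ - ⌊((b : ℕ) : ℝ) * x γ⌋ := rfl
    rw [e1, e2, Nat.cast_sub hab'.le]
    simp only [x]
    push_cast
    field_simp
    ring
  have e3 : cexp (I * ((γ * (((b - a : ℕ) : ℝ) * U) : ℝ) : ℂ)) =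
      cexp (I * ((2 * π * (v - u) : ℝ) : ℂ)) := by
    rw [e, Complex.exp_eq_exp_iff_exists_int]
    refine ⟨⌊((b : ℕ) : ℝ) * x γ⌋ - ⌊((a : ℕ) : ℝ) * x γ⌋, ?_⟩
    push_cast
    ring
  rw [e3]
  refine (Real.norm_exp_I_mul_ofReal_sub_one_le).trans ?_
  rw [Real.norm_eq_abs, abs_mul, abs_of_pos (by positivity)]
  calc 2 * π * |v - u| ≤ 2 * π * (1 / Q) := by gcongr
    _ = 2 * π / Q := by ring

end LittlewoodOscillation

namespace LittlewoodOscillation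

open MeasureTheory Topology

/-- The increment `log (j + 2) - log (j + 1)`. -/
noncomputable def logStep (j : ℕ) : ℝ := Real.log (j + 2) - Real.log (j + 1)

lemma logStep_le (j : ℕ) : logStep j ≤ 1 / (j + 1) := by
  have h := Real.log_le_sub_one_of_pos (x := ((j : ℝ) + 2) / (j + 1)) (by positivity)
  rw [Real.log_div (by positivity) (by positivity)] at h
  refine h.trans (le_of_eq ?_)
  field_simp; ring

lemma le_logStep (j : ℕ) : 1 / ((j : ℝ) + 2) ≤ logStep j := by
  have h := Real.one_sub_inv_le_log_of_pos (x := ((j : ℝ) + 2) / (j + 1)) (by positivity)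
  rw [Real.log_div (by positivity) (by positivity)] at h
  refine le_trans (le_of_eq ?_) h
  field_simp; ring

lemma abs_logStep_sub_le (j : ℕ) : |logStep j - 1 / (j + 1)| ≤ 1 / ((j : ℝ) + 1) ^ 2 := by
  have h1 := logStep_le j
  have h2 := le_logStep j
  rw [abs_le]
  constructor
  · have : 1 / ((j : ℝ) + 1) - 1 / (j + 2) ≤ 1 / ((j : ℝ) + 1) ^ 2 := by
      rw [div_sub_div _ _ (by positivity) (by positivity),
        div_le_div_iff₀ (by positivity) (by positivity)]
      have : (0 : ℝ) ≤ j := by positivity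
      nlinarith
    linarith
  · have : 0 ≤ 1 / ((j : ℝ) + 1) ^ 2 := by positivity
    linarith

lemma summable_one_div_add_one_sq : Summable fun j : ℕ => 1 / ((j : ℝ) + 1) ^ 2 := by
  have := (summable_nat_add_iff 1).2 (Real.summable_one_div_nat_pow.2 one_lt_two)
  simpa using this

lemma natCast_add_one_le_norm {z : ℂ} (hz : 0 < z.re) (j : ℕ) :
    (j : ℝ) + 1 ≤ ‖(j : ℂ) + 1 + z‖ := by
  have := Complex.re_le_norm ((j : ℂ) + 1 + z)
  simp at this
  linarith

lemma natCast_add_ne_zero {z : ℂ} (hz : 0 < z.re) (j : ℕ) : (j : ℂ) + 1 + z ≠ 0 := by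
  intro h
  have := natCast_add_one_le_norm hz j
  rw [h, norm_zero] at this
  have : (0 : ℝ) ≤ j := by positivity
  linarith

lemma norm_inv_sub_inv_le {z w : ℂ} (hz : 0 < z.re) (hw : 0 < w.re) (j : ℕ) :
    ‖1 / ((j : ℂ) + 1 + z) - 1 / (j + 1 + w)‖ ≤ ‖z - w‖ * (1 / ((j : ℝ) + 1) ^ 2) := by
  have h1 := natCast_add_one_le_norm hz j
  have h2 := natCast_add_one_le_norm hw j
  have h0 : (0 : ℝ) < j + 1 := by positivity
  rw [div_sub_div _ _ (natCast_add_ne_zero hz j) (natCast_add_ne_zero hw j), norm_div, norm_mul,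
    div_eq_mul_one_div]
  have : ‖1 * ((j : ℂ) + 1 + w) - ((j : ℂ) + 1 + z) * 1‖ = ‖z - w‖ := by
    rw [← norm_neg]; congr 1; ring
  rw [this]
  gcongr
  rw [sq]
  gcongr

/-- Summand of the Weierstrass product for the logarithm of `Γ`. -/
noncomputable def logGammaTerm (j : ℕ) (z : ℂ) : ℂ :=
  z * logStep j - Complex.log (1 + z / (j + 1))

lemma hasDerivAt_logGammaTerm {z : ℂ} (hz : 0 < z.re) (j : ℕ) :
    HasDerivAt (logGammaTerm j) (logStep j - 1 / (j + 1 + z)) z := by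
  have h0 : (j : ℂ) + 1 ≠ 0 := by exact_mod_cast Nat.succ_ne_zero j
  have h1 : (1 + z / ((j : ℂ) + 1)) ∈ slitPlane := by
    left
    have : (z / ((j : ℂ) + 1)).re = z.re / (j + 1) := by
      have := Complex.div_ofReal_re z ((j : ℝ) + 1)
      push_cast at this; exact this
    rw [add_re, this]
    simp only [one_re]
    positivity
  have h2 : HasDerivAt (fun z : ℂ => 1 + z / ((j : ℂ) + 1)) (1 / ((j : ℂ) + 1)) z :=
    ((hasDerivAt_id z).div_const _).const_add 1
  have h3 := ((hasDerivAt_id z).mul_const (logStep j : ℂ)).sub (h2.clog h1)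
  refine h3.congr_deriv ?_
  have := natCast_add_ne_zero hz j
  have h4 : 1 + z / ((j : ℂ) + 1) ≠ 0 := slitPlane_ne_zero h1
  rw [one_mul]
  congr 1
  rw [div_div]
  congr 1
  field_simp

lemma norm_logStep_sub_le {z : ℂ} (hz : 0 < z.re) (j : ℕ) :
    ‖(logStep j : ℂ) - 1 / (j + 1 + z)‖ ≤ (1 + ‖z‖) * (1 / ((j : ℝ) + 1) ^ 2) := by
  have h1 := abs_logStep_sub_le j
  have h0 : (j : ℂ) + 1 ≠ 0 := by exact_mod_cast Nat.succ_ne_zero j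
  have h0' : (0 : ℝ) < j + 1 := by positivity
  have h2 : ‖1 / ((j : ℂ) + 1) - 1 / (j + 1 + z)‖ ≤ ‖z‖ * (1 / ((j : ℝ) + 1) ^ 2) := by
    rw [div_sub_div _ _ h0 (natCast_add_ne_zero hz j), norm_div, norm_mul, div_eq_mul_one_div]
    have e1 : ‖1 * ((j : ℂ) + 1 + z) - ((j : ℂ) + 1) * 1‖ = ‖z‖ := by congr 1; ring
    have e2 : ‖(j : ℂ) + 1‖ = j + 1 := by
      have := Complex.norm_of_nonneg h0'.le
      push_cast at this; exact this
    rw [e1, e2]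
    gcongr
    rw [sq]
    have := natCast_add_one_le_norm hz j
    gcongr
  have h3 : (logStep j : ℂ) - 1 / (j + 1 + z) =
      ((logStep j - 1 / (j + 1) : ℝ) : ℂ) + (1 / ((j : ℂ) + 1) - 1 / (j + 1 + z)) := by
    push_cast; ring
  rw [h3]
  refine (norm_add_le _ _).trans ?_
  rw [Complex.norm_real, Real.norm_eq_abs]
  linarith

lemma exp_sum_logGammaTerm {z : ℂ} (hz : 0 < z.re) (n : ℕ) :
    Complex.exp (∑ j ∈ Finset.range n, logGammaTerm j z) *
      ∏ j ∈ Finset.range n, (z + ((j + 1 : ℕ) : ℂ)) =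
    Complex.exp (Real.log (n + 1) * z) * n.factorial := by
  induction n with
  | zero => simp
  | succ n ih =>
    rw [Finset.sum_range_succ, Finset.prod_range_succ, Complex.exp_add, Nat.factorial_succ]
    have h0 : (n : ℂ) + 1 ≠ 0 := by exact_mod_cast Nat.succ_ne_zero n
    have h1 := natCast_add_ne_zero hz n
    have h4 : 1 + z / ((n : ℂ) + 1) ≠ 0 := by
      intro h; apply h1; field_simp at h; simpa using h
    have h2 : Complex.exp (logGammaTerm n z) * (z + ((n + 1 : ℕ) : ℂ)) =
        Complex.exp (z * logStep n) * (n + 1) := by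
      rw [logGammaTerm, Complex.exp_sub, Complex.exp_log h4]
      push_cast
      rw [div_mul_eq_mul_div, div_eq_iff h4]
      field_simp
      ring
    have h3 : Complex.exp (Real.log ((n + 1 : ℕ) + 1) * z) =
        Complex.exp (Real.log (n + 1) * z) * Complex.exp (z * logStep n) := by
      rw [← Complex.exp_add, logStep]
      congr 1
      push_cast
      rw [show (n : ℝ) + 1 + 1 = n + 2 by ring]
      ring
    rw [h3]
    push_cast at h2 ih ⊢
    linear_combination (Complex.exp (logGammaTerm n z) * (z + (n + 1))) * ih +
      (Complex.exp (Real.log (n + 1) * z) * n.factorial) * h2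

lemma GammaSeq_succ_eq {z : ℂ} (hz : 0 < z.re) (n : ℕ) :
    Complex.exp (∑ j ∈ Finset.range n, logGammaTerm j z) =
      GammaSeq z (n + 1) * (z * (z / ((n : ℂ) + 1) + 1)) := by
  have h := exp_sum_logGammaTerm hz n
  have hz0 : z ≠ 0 := by rintro rfl; simp at hz
  have hP : ∏ j ∈ Finset.range n, (z + ((j + 1 : ℕ) : ℂ)) ≠ 0 := by
    rw [Finset.prod_ne_zero_iff]
    intro j _
    have := natCast_add_ne_zero hz j
    push_cast
    rwa [add_comm]
  have h0 : (n : ℂ) + 1 ≠ 0 := by exact_mod_cast Nat.succ_ne_zero n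
  have h1 := natCast_add_ne_zero hz n
  rw [Complex.GammaSeq, Finset.prod_range_succ', Finset.prod_range_succ, Nat.factorial_succ,
    cpow_def_of_ne_zero (by exact_mod_cast Nat.succ_ne_zero n)]
  rw [eq_comm, div_mul_eq_mul_div, div_eq_iff]
  · have e : Complex.log ((n + 1 : ℕ) : ℂ) = (Real.log (n + 1) : ℝ) := by
      rw [Complex.ofReal_log (by positivity)]; push_cast; rfl
    rw [e]
    push_cast at h ⊢
    have : z * (z / ((n : ℂ) + 1) + 1) * (n + 1) = z * (n + 1 + z) := by field_simp; ring
    linear_combination (-(z * (n + 1 + z))) * h + (Complex.exp (Real.log (n + 1) * z) * n.factorial) * this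
  · refine mul_ne_zero (mul_ne_zero hP ?_) (by simpa using hz0)
    push_cast
    rwa [add_comm]

lemma isPreconnected_halfPlane_inter_ball (R : ℝ) :
    IsPreconnected ({z : ℂ | 0 < z.re} ∩ Metric.ball 0 R) :=
  ((convex_halfSpace_re_gt 0).inter (convex_ball 0 R)).isPreconnected

lemma logGammaTerm_one (j : ℕ) : logGammaTerm j 1 = 0 := by
  have h0 : (0 : ℝ) < j + 1 := by positivity
  have : (1 : ℂ) + 1 / (j + 1) = ((((j : ℝ) + 2) / (j + 1) : ℝ) : ℂ) := by
    push_cast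
    have : (j : ℂ) + 1 ≠ 0 := by exact_mod_cast Nat.succ_ne_zero j
    field_simp; ring
  rw [logGammaTerm, this, ← Complex.ofReal_log (by positivity),
    Real.log_div (by positivity) (by positivity), logStep]
  simp

lemma logGammaTerm_bound {R : ℝ} (j : ℕ) (y : ℂ)
    (hy : y ∈ {z : ℂ | 0 < z.re} ∩ Metric.ball 0 R) :
    ‖(logStep j : ℂ) - 1 / (j + 1 + y)‖ ≤ (1 + R) * (1 / ((j : ℝ) + 1) ^ 2) := by
  have := mem_ball_zero_iff.1 hy.2
  refine (norm_logStep_sub_le hy.1 j).trans ?_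
  gcongr

lemma mem_halfPlane_inter_ball {z : ℂ} (hz : 0 < z.re) :
    z ∈ {z : ℂ | 0 < z.re} ∩ Metric.ball 0 (‖z‖ + 2) ∧
      (1 : ℂ) ∈ {z : ℂ | 0 < z.re} ∩ Metric.ball 0 (‖z‖ + 2) := by
  refine ⟨⟨hz, by simp⟩, by simp, ?_⟩
  have := norm_nonneg z
  rw [mem_ball_zero_iff, norm_one]; linarith

lemma isOpen_halfPlane_inter_ball (R : ℝ) :
    IsOpen ({z : ℂ | 0 < z.re} ∩ Metric.ball 0 R) :=
  (isOpen_lt continuous_const Complex.continuous_re).inter Metric.isOpen_ball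

lemma hasDerivAt_tsum_logGammaTerm {z : ℂ} (hz : 0 < z.re) :
    HasDerivAt (fun z => ∑' j, logGammaTerm j z) (∑' j : ℕ, ((logStep j : ℂ) - 1 / (j + 1 + z))) z :=
  hasDerivAt_tsum_of_isPreconnected
    (summable_one_div_add_one_sq.mul_left (1 + (‖z‖ + 2)))
    (isOpen_halfPlane_inter_ball _) (isPreconnected_halfPlane_inter_ball _)
    (fun j y hy => hasDerivAt_logGammaTerm hy.1 j) logGammaTerm_bound
    (mem_halfPlane_inter_ball hz).2 (by simp [logGammaTerm_one, summable_zero])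
    (mem_halfPlane_inter_ball hz).1

lemma summable_logGammaTerm {z : ℂ} (hz : 0 < z.re) : Summable fun j => logGammaTerm j z :=
  summable_of_summable_hasDerivAt_of_isPreconnected
    (summable_one_div_add_one_sq.mul_left (1 + (‖z‖ + 2)))
    (isOpen_halfPlane_inter_ball _) (isPreconnected_halfPlane_inter_ball _)
    (fun j y hy => hasDerivAt_logGammaTerm hy.1 j) logGammaTerm_bound
    (mem_halfPlane_inter_ball hz).2 (by simp [logGammaTerm_one, summable_zero])
    (mem_halfPlane_inter_ball hz).1

lemma exp_tsum_logGammaTerm {z : ℂ} (hz : 0 < z.re) :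
    Complex.exp (∑' j, logGammaTerm j z) = z * Complex.Gamma z := by
  have h1 := ((Complex.continuous_exp.tendsto _).comp
    (summable_logGammaTerm hz).hasSum.tendsto_sum_nat)
  have h2 : Tendsto (fun n : ℕ => Complex.GammaSeq z (n + 1) * (z * (z / ((n : ℂ) + 1) + 1)))
      atTop (𝓝 (Complex.Gamma z * (z * (0 + 1)))) := by
    refine (((tendsto_add_atTop_iff_nat 1).2 (GammaSeq_tendsto_Gamma z))).mul
      ((Tendsto.add_const _ ?_).const_mul _)
    have h : Tendsto (fun n : ℕ => z * (1 / ((n : ℂ) + 1))) atTop (𝓝 (z * 0)) :=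
      (tendsto_one_div_add_atTop_nhds_zero_nat (𝕜 := ℂ)).const_mul z
    rw [mul_zero] at h
    exact h.congr fun n => by ring
  have := tendsto_nhds_unique h1 (h2.congr fun n => (GammaSeq_succ_eq hz n).symm)
  rw [this]; ring

lemma digamma_eq_tsum {z : ℂ} (hz : 0 < z.re) :
    digamma z = -(1 / z) + ∑' j : ℕ, ((logStep j : ℂ) - 1 / (j + 1 + z)) := by
  have hz0 : z ≠ 0 := by rintro rfl; simp at hz
  have hopen : {z : ℂ | 0 < z.re} ∈ 𝓝 z :=
    (isOpen_lt continuous_const Complex.continuous_re).mem_nhds hz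
  have h1 := (hasDerivAt_tsum_logGammaTerm hz).cexp.div (hasDerivAt_id z) hz0
  have h2 : (fun w => Complex.exp (∑' j, logGammaTerm j w) / id w) =ᶠ[𝓝 z] Complex.Gamma := by
    filter_upwards [hopen] with w hw
    have hw0 : w ≠ 0 := by rintro rfl; simp at hw
    rw [exp_tsum_logGammaTerm hw, id, mul_div_cancel_left₀ _ hw0]
  have h3 := h1.congr_of_eventuallyEq h2.symm
  rw [digamma_def, logDeriv_apply, h3.deriv, exp_tsum_logGammaTerm hz]
  have := Complex.Gamma_ne_zero_of_re_pos hz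
  simp only [id]
  field_simp
  ring

lemma summable_logStep_sub {z : ℂ} (hz : 0 < z.re) :
    Summable fun j : ℕ => (logStep j : ℂ) - 1 / (j + 1 + z) :=
  .of_norm_bounded (summable_one_div_add_one_sq.mul_left (1 + ‖z‖)) (norm_logStep_sub_le hz)

lemma exists_norm_digamma_sub_le {x₀ : ℝ} (hx₀ : 0 < x₀) :
    ∃ K : ℝ, 0 < K ∧ ∀ z w : ℂ, x₀ ≤ z.re → x₀ ≤ w.re →
      ‖digamma z - digamma w‖ ≤ K * ‖z - w‖ := by
  have hS : 0 ≤ ∑' j : ℕ, 1 / ((j : ℝ) + 1) ^ 2 := tsum_nonneg fun j => by positivity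
  refine ⟨1 / x₀ ^ 2 + ∑' j : ℕ, 1 / ((j : ℝ) + 1) ^ 2, by positivity, fun z w hz hw => ?_⟩
  have hz' := hx₀.trans_le hz
  have hw' := hx₀.trans_le hw
  have hz0 : z ≠ 0 := by rintro rfl; simp at hz'
  have hw0 : w ≠ 0 := by rintro rfl; simp at hw'
  have e : digamma z - digamma w = (1 / w - 1 / z) +
      ∑' j : ℕ, (1 / ((j : ℂ) + 1 + w) - 1 / (j + 1 + z)) := by
    rw [digamma_eq_tsum hz', digamma_eq_tsum hw']
    have := (summable_logStep_sub hz').tsum_sub (summable_logStep_sub hw')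
    rw [show ∑' j : ℕ, (1 / ((j : ℂ) + 1 + w) - 1 / (j + 1 + z)) =
      ∑' j : ℕ, (((logStep j : ℂ) - 1 / (j + 1 + z)) - ((logStep j : ℂ) - 1 / (j + 1 + w))) by
        congr 1; ext j; ring, this]
    ring
  rw [e, add_mul]
  refine (norm_add_le _ _).trans (add_le_add ?_ ?_)
  · rw [div_sub_div _ _ hw0 hz0, norm_div, norm_mul, div_eq_mul_one_div, mul_comm (1 / x₀ ^ 2)]
    rw [show (1 * z - w * 1) = z - w by ring]
    gcongr
    rw [sq]
    gcongr
    · exact hw.trans (Complex.re_le_norm w)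
    · exact hz.trans (Complex.re_le_norm z)
  · refine tsum_of_norm_bounded (summable_one_div_add_one_sq.hasSum.mul_right ‖z - w‖) fun j => ?_
    rw [mul_comm, norm_sub_rev]
    exact norm_inv_sub_inv_le hz' hw' j

lemma re_one_div_natCast_add (j : ℕ) (z : ℂ) :
    (1 / ((j : ℂ) + 1 + z)).re = (j + 1 + z.re) / ((j + 1 + z.re) ^ 2 + z.im ^ 2) := by
  rw [one_div, Complex.inv_re, Complex.normSq_apply]
  simp [sq]

lemma log_sub_le_re_digamma {z : ℂ} (h0 : 0 < z.re) (hy : 1 ≤ |z.im|) :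
    Real.log |z.im| - 3 ≤ (digamma z).re := by
  set y := |z.im| with hydef
  have hy0 : 0 < y := by linarith
  rw [digamma_eq_tsum h0, add_re]
  have hA : -1 ≤ (-(1 / z)).re := by
    have h2 : ‖1 / z‖ ≤ 1 := by
      rw [norm_div, norm_one, div_le_one]
      · exact hy.trans (Complex.abs_im_le_norm z)
      · linarith [Complex.abs_im_le_norm z]
    have h3 := Complex.abs_re_le_norm (-(1 / z))
    rw [norm_neg] at h3
    exact (abs_le.1 (h3.trans h2)).1
  have hB : Real.log y - 2 ≤ (∑' j : ℕ, ((logStep j : ℂ) - 1 / (j + 1 + z))).re := by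
    have ht := (Complex.continuous_re.tendsto _).comp
      (summable_logStep_sub h0).hasSum.tendsto_sum_nat
    refine ge_of_tendsto ht ?_
    set m := ⌈y⌉₊ with hm
    have hterm1 : ∀ j : ℕ, (1 / ((j : ℂ) + 1 + z)).re ≤ 1 / (2 * y) := by
      intro j
      have ha : (0 : ℝ) < j + 1 + z.re := by positivity
      rw [re_one_div_natCast_add, ← sq_abs z.im, ← hydef,
        div_le_div_iff₀ (by positivity) (by positivity)]
      nlinarith [sq_nonneg (j + 1 + z.re - y)]
    have hterm2 : ∀ j : ℕ, (1 / ((j : ℂ) + 1 + z)).re ≤ 1 / ((j : ℝ) + 1) := by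
      intro j
      refine (Complex.re_le_norm _).trans ?_
      rw [norm_div, norm_one]
      have := natCast_add_one_le_norm h0 j
      gcongr
    have hfirst : ∀ n : ℕ, Real.log (n + 1) - n / (2 * y) ≤
        (∑ j ∈ Finset.range n, ((logStep j : ℂ) - 1 / (j + 1 + z))).re := by
      intro n
      induction n with
      | zero => simp
      | succ n ih =>
        rw [Finset.sum_range_succ, add_re, sub_re, ofReal_re]
        have := hterm1 n
        have e : logStep n = Real.log ((n + 1 : ℕ) + 1) - Real.log (n + 1) := by
          rw [logStep]; push_cast; congr 2; ring
        rw [e]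
        have e2 : ((n + 1 : ℕ) : ℝ) / (2 * y) = n / (2 * y) + 1 / (2 * y) := by push_cast; ring
        rw [e2]
        linarith
    have hsecond : ∀ n, m ≤ n → Real.log (m + 1) - m / (2 * y) + (1 / ((n : ℝ) + 1) - 1 / (m + 1)) ≤
        (∑ j ∈ Finset.range n, ((logStep j : ℂ) - 1 / (j + 1 + z))).re := by
      intro n hn
      induction n, hn using Nat.le_induction with
      | base => simpa using hfirst m
      | succ n hn ih =>
        rw [Finset.sum_range_succ, add_re, sub_re, ofReal_re]
        have := hterm2 n
        have h2 := le_logStep n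
        have e2 : 1 / (((n + 1 : ℕ) : ℝ) + 1) = 1 / (n + 2) := by push_cast; congr 1; ring
        rw [e2]
        linarith
    filter_upwards [eventually_ge_atTop m] with n hn
    refine le_trans ?_ (hsecond n hn)
    have hm1 : y ≤ m := Nat.le_ceil y
    have hm2 : (m : ℝ) < y + 1 := Nat.ceil_lt_add_one hy0.le
    have e1 : Real.log y ≤ Real.log (m + 1) := Real.log_le_log hy0 (by linarith)
    have e2 : (m : ℝ) / (2 * y) ≤ 1 := by rw [div_le_one (by positivity)]; linarith
    have e3 : 0 ≤ 1 / ((n : ℝ) + 1) := by positivity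
    have e4 : 1 / ((m : ℝ) + 1) ≤ 1 := by rw [div_le_one (by positivity)]; linarith
    linarith
  linarith

end LittlewoodOscillation

namespace LittlewoodOscillation

open MeasureTheory Topology

open ProbabilityTheory

lemma mem_integrableExpSet_of_le {Ω : Type*} [MeasurableSpace Ω] {μ : Measure Ω} {X : Ω → ℝ}
    (hXm : AEMeasurable X μ) (hX : ∀ᵐ ω ∂μ, X ω ≤ 0) {σ τ : ℝ} (hσ : σ ∈ integrableExpSet X μ)
    (h : σ ≤ τ) : τ ∈ integrableExpSet X μ := by
  refine Integrable.mono hσ (by fun_prop) ?_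
  filter_upwards [hX] with ω hω
  rw [Real.norm_eq_abs, Real.norm_eq_abs, abs_of_pos (Real.exp_pos _), abs_of_pos (Real.exp_pos _)]
  exact Real.exp_le_exp.2 (mul_le_mul_of_nonpos_right h hω)

/-- Landau's theorem on the abscissa of convergence of a Laplace transform of a positive measure. -/
lemma landau_mem_integrableExpSet {Ω : Type*} [MeasurableSpace Ω] {μ : Measure Ω} {X : Ω → ℝ}
    (hX : ∀ᵐ ω ∂μ, X ω ≤ 0) {σ₀ r : ℝ} (hr : 0 < r)
    (hS : ∀ σ, σ₀ < σ → σ ∈ integrableExpSet X μ) {R : ℂ → ℂ}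
    (hR : DifferentiableOn ℂ R (Metric.ball (σ₀ : ℂ) r))
    (hag : ∀ z ∈ Metric.ball (σ₀ : ℂ) r, σ₀ < z.re → R z = complexMGF X μ z) :
    σ₀ - r / 4 ∈ integrableExpSet X μ := by
  set c : ℝ := σ₀ + r / 4 with hc
  have h_intg : ∀ σ, σ₀ < σ → σ ∈ interior (integrableExpSet X μ) := by
    intro σ hσ
    rw [mem_interior_iff_mem_nhds]
    filter_upwards [Ioi_mem_nhds hσ] with τ hτ using hS τ hτ
  have hcI : c ∈ interior (integrableExpSet X μ) := h_intg c (by linarith)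
  have hXm : AEMeasurable X μ := aemeasurable_of_mem_interior_integrableExpSet hcI
  have hsub : Metric.ball (c : ℂ) (3 * r / 4) ⊆ Metric.ball (σ₀ : ℂ) r := by
    refine Metric.ball_subset_ball' ?_
    rw [Complex.dist_eq, ← ofReal_sub, Complex.norm_real, Real.norm_eq_abs,
      abs_of_nonneg (by linarith)]
    linarith
  set w : ℝ := σ₀ - r / 4 with hw
  have hwmem : (w : ℂ) ∈ Metric.ball (c : ℂ) (3 * r / 4) := by
    rw [Metric.mem_ball, Complex.dist_eq, ← ofReal_sub, Complex.norm_real, Real.norm_eq_abs,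
      abs_of_neg (by linarith)]
    linarith
  have hsum := Complex.hasSum_taylorSeries_on_ball (hR.mono hsub) hwmem
  have hder : ∀ n, iteratedDeriv n R (c : ℂ) = ((∫ ω, X ω ^ n * Real.exp (c * X ω) ∂μ : ℝ) : ℂ) := by
    intro n
    have hev : R =ᶠ[𝓝 (c : ℂ)] complexMGF X μ := by
      have h1 : Metric.ball (σ₀ : ℂ) r ∈ 𝓝 (c : ℂ) :=
        Metric.isOpen_ball.mem_nhds (hsub (Metric.mem_ball_self (by positivity)))
      have h2 : {z : ℂ | σ₀ < z.re} ∈ 𝓝 (c : ℂ) :=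
        (isOpen_lt continuous_const Complex.continuous_re).mem_nhds (by
          simp only [Set.mem_ofPred_eq, ofReal_re]; linarith)
      filter_upwards [h1, h2] with z hz1 hz2 using hag z hz1 hz2
    rw [hev.iteratedDeriv_eq n, iteratedDeriv_complexMGF (by simpa using hcI),
      ← integral_complex_ofReal]
    congr 1; ext ω; push_cast; rfl
  have hterm : ∀ n : ℕ, ((n.factorial : ℂ)⁻¹ • ((w : ℂ) - c) ^ n • iteratedDeriv n R (c : ℂ)) =
      ((∫ ω, (n.factorial : ℝ)⁻¹ * (r / 2) ^ n * (|X ω| ^ n * Real.exp (c * X ω)) ∂μ : ℝ) : ℂ) := by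
    intro n
    rw [hder, integral_const_mul]
    have h1 : ∫ ω, |X ω| ^ n * Real.exp (c * X ω) ∂μ =
        (-1) ^ n * ∫ ω, X ω ^ n * Real.exp (c * X ω) ∂μ := by
      rw [← integral_const_mul]
      refine integral_congr_ae ?_
      filter_upwards [hX] with ω hω
      rw [abs_of_nonpos hω, neg_pow]; ring
    have h2 : (w : ℂ) - c = -((r / 2 : ℝ) : ℂ) := by
      rw [hw, hc]; push_cast; ring
    rw [h1, h2, neg_pow]
    simp only [smul_eq_mul]
    push_cast
    ring
  simp_rw [hterm] at hsum
  have hsumR : Summable fun n : ℕ => ∫ ω, (n.factorial : ℝ)⁻¹ * (r / 2) ^ n *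
      (|X ω| ^ n * Real.exp (c * X ω)) ∂μ := by
    have h3 := Complex.hasSum_re hsum
    simp only [ofReal_re] at h3
    exact h3.summable
  have hgint : ∀ n : ℕ, Integrable (fun ω => (n.factorial : ℝ)⁻¹ * (r / 2) ^ n *
      (|X ω| ^ n * Real.exp (c * X ω))) μ := fun n =>
    (integrable_pow_abs_mul_exp_of_mem_interior_integrableExpSet hcI n).const_mul _
  have hgnn : ∀ n : ℕ, ∀ ω, 0 ≤ (n.factorial : ℝ)⁻¹ * (r / 2) ^ n *
      (|X ω| ^ n * Real.exp (c * X ω)) := fun n ω => by positivity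
  have hexp : ∀ᵐ ω ∂μ, HasSum (fun n : ℕ => (n.factorial : ℝ)⁻¹ * (r / 2) ^ n *
      (|X ω| ^ n * Real.exp (c * X ω))) (Real.exp (w * X ω)) := by
    filter_upwards [hX] with ω hω
    have h4 := (NormedSpace.expSeries_div_hasSum_exp ((r / 2) * |X ω|)).mul_right (Real.exp (c * X ω))
    rw [← Real.exp_eq_exp_ℝ, ← Real.exp_add] at h4
    rw [show w * X ω = r / 2 * |X ω| + c * X ω by rw [abs_of_nonpos hω, hw, hc]; ring]
    convert! h4 using 2 with n
    rw [mul_pow]; ring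
  refine ⟨by fun_prop, ?_⟩
  rw [hasFiniteIntegral_iff_ofReal (ae_of_all _ fun ω => (Real.exp_pos _).le)]
  have h5 : ∫⁻ ω, ENNReal.ofReal (Real.exp (w * X ω)) ∂μ =
      ∑' n : ℕ, ∫⁻ ω, ENNReal.ofReal ((n.factorial : ℝ)⁻¹ * (r / 2) ^ n *
      (|X ω| ^ n * Real.exp (c * X ω))) ∂μ := by
    rw [← lintegral_tsum fun n => (hgint n).aemeasurable.ennreal_ofReal]
    refine lintegral_congr_ae ?_
    filter_upwards [hexp] with ω hω
    rw [← hω.tsum_eq, ENNReal.ofReal_tsum_of_nonneg (fun n => hgnn n ω) hω.summable]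
  rw [h5]
  simp_rw [← fun n => ofReal_integral_eq_lintegral_ofReal (hgint n) (ae_of_all _ (hgnn n))]
  rw [← ENNReal.ofReal_tsum_of_nonneg (fun n => integral_nonneg (hgnn n)) hsumR]
  exact ENNReal.ofReal_lt_top

end LittlewoodOscillation

namespace LittlewoodOscillation

open MeasureTheory Topology

open ProbabilityTheory

lemma ne_zero_of_deriv_re_le {h : ℝ → ℂ} {a b K : ℝ} (hab : a ≤ b)
    (hc : ContinuousOn h (Set.Icc a b))
    (h' : ∀ x ∈ Set.Ioo a b, ∃ G : ℂ, HasDerivAt h (G * h x) x ∧ G.re ≤ K) (hb : h b ≠ 0) :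
    h a ≠ 0 := by
  have hanti : AntitoneOn (fun x => ‖h x‖ ^ 2 * Real.exp (-(2 * K * x))) (Set.Icc a b) := by
    have key : ∀ x ∈ Set.Ioo a b, ∃ d, HasDerivAt
        (fun x => ‖h x‖ ^ 2 * Real.exp (-(2 * K * x))) d x ∧ d ≤ 0 := by
      intro x hx
      obtain ⟨G, hG, hGK⟩ := h' x hx
      have h1 := hG.norm_sq
      have h2 : HasDerivAt (fun x : ℝ => Real.exp (-(2 * K * x)))
          (Real.exp (-(2 * K * x)) * (-(2 * K * 1))) x :=
        (((hasDerivAt_id x).const_mul (2 * K)).neg).exp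
      refine ⟨_, h1.mul h2, ?_⟩
      have e : inner ℝ (h x) (G * h x) = G.re * ‖h x‖ ^ 2 := by
        rw [Complex.inner, ← Complex.normSq_eq_norm_sq, Complex.normSq_apply]
        simp; ring
      rw [e]
      have : 0 ≤ (K - G.re) * ‖h x‖ ^ 2 * Real.exp (-(2 * K * x)) :=
        mul_nonneg (mul_nonneg (by linarith) (by positivity)) (Real.exp_pos _).le
      linarith
    refine antitoneOn_of_deriv_nonpos (convex_Icc a b) ?_ ?_ ?_
    · exact (hc.norm.pow 2).mul (by fun_prop)
    · rw [interior_Icc]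
      intro x hx
      obtain ⟨d, hd, -⟩ := key x hx
      exact hd.differentiableAt.differentiableWithinAt
    · rw [interior_Icc]
      intro x hx
      obtain ⟨d, hd, hd0⟩ := key x hx
      rwa [hd.deriv]
  intro ha
  have := hanti (Set.left_mem_Icc.2 hab) (Set.right_mem_Icc.2 hab) hab
  simp only [ha, norm_zero] at this
  have h3 : 0 < ‖h b‖ ^ 2 * Real.exp (-(2 * K * b)) := by
    have := norm_pos_iff.2 hb
    positivity
  linarith [show (0:ℝ) ^ 2 * Real.exp (-(2 * K * a)) = 0 by simp]

/-- The measure `p(u) du` on the positive half-line. -/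
noncomputable def densityMeasure (p : ℝ → ℝ) : Measure ℝ :=
  (volume.restrict (Set.Ioi 0)).withDensity fun u => ENNReal.ofReal (p u)

lemma ae_neg_nonpos_densityMeasure (p : ℝ → ℝ) : ∀ᵐ u ∂(densityMeasure p), -u ≤ 0 := by
  refine (withDensity_absolutelyContinuous _ _).ae_le ?_
  filter_upwards [ae_restrict_mem measurableSet_Ioi] with u hu
  have : (0 : ℝ) < u := hu
  linarith

lemma mem_integrableExpSet_densityMeasure {p : ℝ → ℝ} (hp : Measurable p)
    (hp0 : ∀ u, 0 < u → 0 ≤ p u) (σ : ℝ) :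
    σ ∈ integrableExpSet (fun u : ℝ => -u) (densityMeasure p) ↔
      IntegrableOn (fun u => p u * Real.exp (-(σ * u))) (Set.Ioi 0) := by
  rw [integrableExpSet, Set.mem_ofPred_eq, densityMeasure,
    integrable_withDensity_iff_integrable_smul' hp.ennreal_ofReal (by simp)]
  refine integrableOn_congr_fun (fun u hu => ?_) measurableSet_Ioi
  simp only [smul_eq_mul]
  rw [ENNReal.toReal_ofReal (hp0 u hu), mul_neg]

/-- The Laplace transform of a function on the positive half-line. -/
noncomputable def laplace (f : ℝ → ℝ) (s : ℂ) : ℂ :=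
  ∫ u in Set.Ioi (0 : ℝ), (f u : ℂ) * cexp (-(s * u))

lemma complexMGF_densityMeasure {p : ℝ → ℝ} (hp : Measurable p)
    (hp0 : ∀ u, 0 < u → 0 ≤ p u) (s : ℂ) :
    complexMGF (fun u : ℝ => -u) (densityMeasure p) s = laplace p s := by
  rw [complexMGF, densityMeasure, laplace,
    integral_withDensity_eq_integral_toReal_smul hp.ennreal_ofReal (by simp)]
  refine setIntegral_congr_fun measurableSet_Ioi fun u hu => ?_
  rw [ENNReal.toReal_ofReal (hp0 u hu), Complex.real_smul]
  push_cast
  rw [mul_neg]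

lemma integrable_mul_cexp {f : ℝ → ℝ} {s : ℂ} (hf : Measurable f)
    (h : IntegrableOn (fun u => f u * Real.exp (-(s.re * u))) (Set.Ioi 0)) :
    IntegrableOn (fun u : ℝ => (f u : ℂ) * cexp (-(s * u))) (Set.Ioi 0) := by
  refine Integrable.mono h (by fun_prop) (ae_of_all _ fun u => ?_)
  rw [norm_mul, norm_mul, Complex.norm_real, Complex.norm_exp, Real.norm_eq_abs (Real.exp _),
    abs_of_pos (Real.exp_pos _)]
  simp

lemma laplace_add {f g : ℝ → ℝ} {s : ℂ} (hf : Measurable f) (hg : Measurable g)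
    (h : IntegrableOn (fun u => f u * Real.exp (-(s.re * u))) (Set.Ioi 0))
    (h' : IntegrableOn (fun u => g u * Real.exp (-(s.re * u))) (Set.Ioi 0)) :
    laplace (f + g) s = laplace f s + laplace g s := by
  rw [laplace, laplace, laplace, ← integral_add (integrable_mul_cexp hf h) (integrable_mul_cexp hg h')]
  congr 1; ext u; simp; ring

lemma laplace_ofReal (f : ℝ → ℝ) (σ : ℝ) :
    laplace f σ = ((∫ u in Set.Ioi (0 : ℝ), f u * Real.exp (-(σ * u)) : ℝ) : ℂ) := by
  rw [laplace, ← integral_complex_ofReal]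
  congr 1; ext u; push_cast; rfl

lemma differentiableOn_laplace {p : ℝ → ℝ} (hp : Measurable p) (hp0 : ∀ u, 0 < u → 0 ≤ p u)
    {σ₀ : ℝ} (h : ∀ σ, σ₀ < σ → IntegrableOn (fun u => p u * Real.exp (-(σ * u))) (Set.Ioi 0)) :
    DifferentiableOn ℂ (laplace p) {s | σ₀ < s.re} := by
  rw [← funext (complexMGF_densityMeasure hp hp0)]
  refine differentiableOn_complexMGF.mono fun s hs => ?_
  rw [Set.mem_ofPred_eq, mem_interior_iff_mem_nhds]
  filter_upwards [Ioi_mem_nhds hs] with τ hτ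
  exact (mem_integrableExpSet_densityMeasure hp hp0 τ).2 (h τ hτ)

lemma isOpen_re_gt (σ : ℝ) : IsOpen {s : ℂ | σ < s.re} :=
  isOpen_lt continuous_const Complex.continuous_re

/-- Landau's theorem for a logarithmic derivative given by a Laplace transform: if the density is
bounded below by `-m`, then the Laplace representation persists as far as that of `m` does. -/
theorem landau_logDeriv {D : ℂ → ℂ} (hD : Differentiable ℂ D) {f m : ℝ → ℝ} (hf : Measurable f)
    (hm : Measurable m) (hm0 : ∀ u, 0 < u → 0 ≤ m u) (hfm : ∀ u, 0 < u → 0 ≤ f u + m u)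
    (hmI : ∀ σ, 0 < σ → IntegrableOn (fun u => m u * Real.exp (-(σ * u))) (Set.Ioi 0))
    (hfI : ∀ σ, 1 / 2 < σ → IntegrableOn (fun u => f u * Real.exp (-(σ * u))) (Set.Ioi 0))
    (hne : ∀ s : ℂ, 1 / 2 < s.re → D s ≠ 0)
    (heq : ∀ s : ℂ, 1 / 2 < s.re → deriv D s = -2 * (s + 1 / 2) * laplace f s * D s) :
    (∀ σ, 0 < σ → IntegrableOn (fun u => f u * Real.exp (-(σ * u))) (Set.Ioi 0)) ∧
    (∀ s : ℂ, 0 < s.re → D s ≠ 0) ∧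
    (∀ s : ℂ, 0 < s.re → deriv D s = -2 * (s + 1 / 2) * laplace f s * D s) := by
  set p := f + m with hpdef
  have hp : Measurable p := hf.add hm
  have hp0 : ∀ u, 0 < u → 0 ≤ p u := hfm
  let J : (ℝ → ℝ) → ℝ → Prop := fun g σ =>
    IntegrableOn (fun u => g u * Real.exp (-(σ * u))) (Set.Ioi 0)
  have hadd : ∀ σ, J f σ → J m σ → J p σ := fun σ h1 h2 => by
    refine (h1.add h2).congr_fun (fun u _ => ?_) measurableSet_Ioi
    simp [hpdef]; ring
  have hsub : ∀ σ, J p σ → J m σ → J f σ := fun σ h1 h2 => by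
    refine (h1.sub h2).congr_fun (fun u _ => ?_) measurableSet_Ioi
    simp [hpdef]; ring
  have hmono : ∀ σ τ, J p σ → σ ≤ τ → J p τ := fun σ τ h hστ =>
    (mem_integrableExpSet_densityMeasure hp hp0 τ).1 <|
      mem_integrableExpSet_of_le (by fun_prop) (ae_neg_nonpos_densityMeasure p)
        ((mem_integrableExpSet_densityMeasure hp hp0 σ).2 h) hστ
  have hlap : ∀ s : ℂ, 0 < s.re → J p s.re → laplace f s = laplace p s - laplace m s := by
    intro s hs h
    have := laplace_add hf hm (hsub _ h (hmI _ hs)) (hmI _ hs)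
    rw [hpdef, this]; ring
  have hid : ∀ σ₁, 0 ≤ σ₁ → (∀ τ, σ₁ < τ → J p τ) → ∀ s : ℂ, σ₁ < s.re →
      deriv D s = -2 * (s + 1 / 2) * laplace f s * D s := by
    intro σ₁ hσ₁ hI s hs
    have hA : AnalyticOnNhd ℂ (deriv D) {s | σ₁ < s.re} :=
      (hD.deriv.differentiableOn).analyticOnNhd (isOpen_re_gt σ₁)
    have hB : AnalyticOnNhd ℂ (fun s => -2 * (s + 1 / 2) * (laplace p s - laplace m s) * D s)
        {s | σ₁ < s.re} := by
      refine DifferentiableOn.analyticOnNhd ?_ (isOpen_re_gt σ₁)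
      have h1 := differentiableOn_laplace hp hp0 hI
      have h2 := differentiableOn_laplace hm hm0 (σ₀ := σ₁) fun σ hσ => hmI σ (by linarith)
      have h3 := hD.differentiableOn (s := {s : ℂ | σ₁ < s.re})
      fun_prop
    have hpre : IsPreconnected {s : ℂ | σ₁ < s.re} := (convex_halfSpace_re_gt σ₁).isPreconnected
    have h0 : ((max σ₁ (1 / 2) + 1 : ℝ) : ℂ) ∈ {s : ℂ | σ₁ < s.re} := by
      rw [Set.mem_ofPred_eq, ofReal_re]
      linarith [le_max_left σ₁ (1 / 2)]
    have hev : deriv D =ᶠ[𝓝 ((max σ₁ (1 / 2) + 1 : ℝ) : ℂ)]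
        (fun s => -2 * (s + 1 / 2) * (laplace p s - laplace m s) * D s) := by
      have h1 : {s : ℂ | max σ₁ (1 / 2) < s.re} ∈ 𝓝 ((max σ₁ (1 / 2) + 1 : ℝ) : ℂ) :=
        (isOpen_re_gt _).mem_nhds (by rw [Set.mem_ofPred_eq, ofReal_re]; linarith)
      filter_upwards [h1] with z hz
      have hz' : max σ₁ (1 / 2) < z.re := hz
      have hz1 := (le_max_left σ₁ (1 / 2)).trans_lt hz'
      rw [heq z ((le_max_right _ _).trans_lt hz'), hlap z (by linarith) (hI _ hz1)]
    have := hA.eqOn_of_preconnected_of_eventuallyEq hB hpre h0 hev hs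
    rw [this, hlap s (by linarith) (hI _ hs)]
  have hmcont : ContinuousOn (laplace m) {s : ℂ | 0 < s.re} :=
    (differentiableOn_laplace hm hm0 fun σ hσ => hmI σ hσ).continuousOn
  let T : Set ℝ := {σ | 0 ≤ σ ∧ ∀ τ, σ < τ → J p τ}
  have hT : (1 / 2 : ℝ) ∈ T :=
    ⟨by norm_num, fun τ hτ => hadd τ (hfI τ hτ) (hmI τ (by linarith))⟩
  have hTb : BddBelow T := ⟨0, fun σ hσ => hσ.1⟩
  set σ₀ := sInf T with hσ₀
  have hσ₀0 : 0 ≤ σ₀ := le_csInf ⟨_, hT⟩ fun σ hσ => hσ.1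
  have hσ₀I : ∀ τ, σ₀ < τ → J p τ := by
    intro τ hτ
    obtain ⟨σ, hσ, hστ⟩ := exists_lt_of_csInf_lt ⟨_, hT⟩ hτ
    exact hσ.2 τ hστ
  have hσ₀h : σ₀ ≤ 1 / 2 := csInf_le hTb hT
  have hzero : σ₀ = 0 := by
    by_contra hne0
    have hpos : 0 < σ₀ := lt_of_le_of_ne hσ₀0 (Ne.symm hne0)
    have hDσ : D σ₀ ≠ 0 := by
      have hcont : ContinuousOn (fun x : ℝ => 2 * (x + 1 / 2) * (laplace m x).re)
          (Set.Icc σ₀ 1) := by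
        have : ContinuousOn (fun x : ℝ => laplace m x) (Set.Icc σ₀ 1) :=
          hmcont.comp (by fun_prop) fun x hx => by
            simpa using hpos.trans_le hx.1
        have h2 := Complex.continuous_re.comp_continuousOn this
        exact (by fun_prop : ContinuousOn (fun x : ℝ => 2 * (x + 1 / 2)) _).mul h2
      obtain ⟨K, hK⟩ := (isCompact_Icc.image_of_continuousOn hcont).bddAbove
      refine ne_zero_of_deriv_re_le (h := fun x : ℝ => D x) (b := 1) (K := K) (by linarith)
        (hD.continuous.comp Complex.continuous_ofReal).continuousOn ?_
        (hne _ (by rw [ofReal_re]; norm_num))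
      intro x hx
      refine ⟨-2 * ((x : ℂ) + 1 / 2) * laplace f x, ?_, ?_⟩
      · have h1 := (hD (x : ℂ)).hasDerivAt.comp_ofReal
        rw [hid σ₀ hσ₀0 hσ₀I (x : ℂ) (by simpa using hx.1)] at h1
        exact h1
      · have h1 : 2 * (x + 1 / 2) * (laplace m x).re ≤ K :=
          hK (Set.mem_image_of_mem _ (Set.Ioo_subset_Icc_self hx))
        have hx0 : 0 < x := hpos.trans hx.1
        rw [hlap (x : ℂ) (by simpa using hx0) (hσ₀I _ (by simpa using hx.1))]
        have h2 : 0 ≤ (laplace p x).re := by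
          rw [laplace_ofReal, ofReal_re]
          refine setIntegral_nonneg measurableSet_Ioi fun u hu => ?_
          exact mul_nonneg (hp0 u hu) (Real.exp_pos _).le
        have h3 : (-2 * ((x : ℂ) + 1 / 2) * (laplace p x - laplace m x)).re =
            2 * (x + 1 / 2) * (laplace m x).re - 2 * (x + 1 / 2) * (laplace p x).re := by
          rw [show (-2 * ((x : ℂ) + 1 / 2)) = ((-2 * (x + 1 / 2) : ℝ) : ℂ) by push_cast; ring,
            re_ofReal_mul, sub_re]
          ring
        rw [h3]
        have : 0 ≤ 2 * (x + 1 / 2) * (laplace p x).re := by positivity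
        linarith
    have hopen : IsOpen {s : ℂ | 0 < s.re ∧ D s ≠ 0} :=
      (isOpen_re_gt 0).inter (isOpen_ne_fun hD.continuous continuous_const)
    obtain ⟨r, hr, hball⟩ := Metric.isOpen_iff.1 hopen (σ₀ : ℂ) ⟨by simpa using hpos, hDσ⟩
    set r' := min r σ₀ with hr'
    have hr'0 : 0 < r' := lt_min hr hpos
    have hball' : ∀ z ∈ Metric.ball (σ₀ : ℂ) r', 0 < z.re ∧ D z ≠ 0 := fun z hz =>
      hball (Metric.ball_subset_ball (min_le_left _ _) hz)
    have hmem := landau_mem_integrableExpSet (ae_neg_nonpos_densityMeasure p) hr'0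
      (σ₀ := σ₀) (fun σ hσ => (mem_integrableExpSet_densityMeasure hp hp0 σ).2 (hσ₀I σ hσ))
      (R := fun s => -deriv D s / (2 * (s + 1 / 2) * D s) + laplace m s) ?_ ?_
    · have h1 := (mem_integrableExpSet_densityMeasure hp hp0 _).1 hmem
      have h2 : r' ≤ σ₀ := min_le_right _ _
      have h3 : σ₀ - r' / 4 ∈ T := ⟨by linarith, fun τ hτ => hmono _ _ h1 hτ.le⟩
      have := csInf_le hTb h3
      linarith
    · intro z hz
      have hz2 := hball' z hz
      have h1 : DifferentiableAt ℂ (laplace m) z :=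
        (differentiableOn_laplace hm hm0 fun σ hσ => hmI σ hσ).differentiableAt
          ((isOpen_re_gt 0).mem_nhds hz2.1)
      have h2 := hD.deriv z
      have h3 := hD z
      have h4 : 2 * (z + 1 / 2) * D z ≠ 0 := by
        refine mul_ne_zero (mul_ne_zero two_ne_zero fun h => ?_) hz2.2
        have := congrArg Complex.re h
        simp at this
        linarith [hz2.1]
      exact (by fun_prop (disch := assumption) : DifferentiableAt ℂ _ z).differentiableWithinAt
    · intro z hz hzσ
      have hz2 := hball' z hz
      have h4 : z + 1 / 2 ≠ 0 := fun h => by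
        have := congrArg Complex.re h
        simp at this
        linarith [hz2.1]
      have hh := hz2.2
      rw [complexMGF_densityMeasure hp hp0, hid σ₀ hσ₀0 hσ₀I z hzσ,
        hlap z hz2.1 (hσ₀I _ hzσ)]
      have h5 : ∀ w : ℂ, -(-2 * (z + 1 / 2) * w * D z) / (2 * (z + 1 / 2) * D z) = w := by
        intro w
        rw [div_eq_iff (mul_ne_zero (mul_ne_zero two_ne_zero h4) hh)]
        ring
      rw [h5]
      ring
  rw [hzero] at hσ₀I
  have hfI' : ∀ σ, 0 < σ → J f σ := fun σ hσ => hsub σ (hσ₀I σ hσ) (hmI σ hσ)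
  have hid0 := hid 0 le_rfl hσ₀I
  refine ⟨hfI', fun s hs => ?_, hid0⟩
  by_cases hs2 : 1 / 2 < s.re
  · exact hne s hs2
  push Not at hs2
  have hfc : ContinuousOn (laplace f) {s : ℂ | 0 < s.re} := by
    have h1 := (differentiableOn_laplace hp hp0 hσ₀I).continuousOn
    exact (h1.sub hmcont).congr fun s hs => hlap s hs (hσ₀I _ hs)
  let L : ℝ → ℂ := fun x => (x : ℂ) + s.im * I
  have hLre : ∀ x, (L x).re = x := fun x => by simp [L]
  have hL : Continuous L := by fun_prop
  have hLs : L s.re = s := by simp [L]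
  have hcont : ContinuousOn (fun x : ℝ => (-2 * (L x + 1 / 2) * laplace f (L x)).re)
      (Set.Icc s.re 1) := by
    have h1 : ContinuousOn (fun x : ℝ => laplace f (L x)) (Set.Icc s.re 1) :=
      hfc.comp hL.continuousOn fun x hx => by
        rw [Set.mem_ofPred_eq, hLre]; exact hs.trans_le hx.1
    exact Complex.continuous_re.comp_continuousOn
      ((by fun_prop : ContinuousOn (fun x : ℝ => -2 * (L x + 1 / 2)) _).mul h1)
  obtain ⟨K, hK⟩ := (isCompact_Icc.image_of_continuousOn hcont).bddAbove
  have := ne_zero_of_deriv_re_le (h := fun x : ℝ => D (L x)) (a := s.re) (b := 1) (K := K)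
    (by linarith) (hD.continuous.comp hL).continuousOn ?_
    (hne _ (by rw [hLre]; norm_num))
  · rwa [hLs] at this
  intro x hx
  refine ⟨_, ?_, hK (Set.mem_image_of_mem _ (Set.Ioo_subset_Icc_self hx))⟩
  have h1 : HasDerivAt L 1 x := (hasDerivAt_id (x : ℂ)).comp_ofReal.add_const _
  have h2 := (hD (L x)).hasDerivAt.comp x h1
  rw [hid0 (L x) (by rw [hLre]; exact hs.trans hx.1), mul_one] at h2
  exact h2

end LittlewoodOscillation

namespace LittlewoodOscillation

open MeasureTheory Topology

lemma exists_eq_sub_pow_mul {f : ℂ → ℂ} (hf : Differentiable ℂ f) (hf0 : ∃ z, f z ≠ 0) (a : ℂ) :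
    ∃ (n : ℕ) (g : ℂ → ℂ), Differentiable ℂ g ∧ g a ≠ 0 ∧ ∀ z, f z = (z - a) ^ n * g z := by
  have hne : ¬ ∀ᶠ z in 𝓝 a, f z = 0 := by
    intro h
    obtain ⟨z, hz⟩ := hf0
    have hA : AnalyticOnNhd ℂ f Set.univ := hf.differentiableOn.analyticOnNhd isOpen_univ
    exact hz (hA.eqOn_zero_of_preconnected_of_eventuallyEq_zero isPreconnected_univ
      (Set.mem_univ a) h (Set.mem_univ z))
  obtain ⟨n, g₀, hg₀, hg₀a, heq⟩ := (hf.analyticAt a).exists_eventuallyEq_pow_smul_nonzero_iff.2 hne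
  refine ⟨n, Function.update (fun z => f z / (z - a) ^ n) a (g₀ a), ?_, by simpa using hg₀a, ?_⟩
  · intro z
    by_cases hz : z = a
    · subst hz
      refine hg₀.differentiableAt.congr_of_eventuallyEq ?_
      filter_upwards [heq] with w hw
      by_cases hwz : w = z
      · subst hwz; simp
      · rw [Function.update_of_ne hwz, hw, smul_eq_mul, mul_div_cancel_left₀]
        exact pow_ne_zero _ (sub_ne_zero.2 hwz)
    · have h1 : DifferentiableAt ℂ (fun z => f z / (z - a) ^ n) z :=
        (hf z).div (by fun_prop) (pow_ne_zero _ (sub_ne_zero.2 hz))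
      refine h1.congr_of_eventuallyEq ?_
      filter_upwards [isOpen_ne.mem_nhds hz] with w hw
      rw [Function.update_of_ne hw]
  · intro z
    by_cases hz : z = a
    · subst hz
      simpa using heq.self_of_nhds
    · rw [Function.update_of_ne hz, mul_div_cancel₀]
      exact pow_ne_zero _ (sub_ne_zero.2 hz)

lemma exists_eq_prod_mul {f : ℂ → ℂ} (hf : Differentiable ℂ f) (hf0 : ∃ z, f z ≠ 0)
    (S : Finset ℂ) :
    ∃ (n : ℂ → ℕ) (g : ℂ → ℂ), Differentiable ℂ g ∧ (∀ a ∈ S, g a ≠ 0) ∧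
      ∀ z, f z = (∏ a ∈ S, (z - a) ^ n a) * g z := by
  induction S using Finset.induction_on with
  | empty => exact ⟨0, f, hf, by simp, by simp⟩
  | insert a S ha ih =>
    obtain ⟨n, g, hg, hg0, hfg⟩ := ih
    have hg1 : ∃ z, g z ≠ 0 := by
      obtain ⟨z, hz⟩ := hf0
      exact ⟨z, fun h => hz (by rw [hfg, h, mul_zero])⟩
    obtain ⟨k, g', hg', hg'a, hgg'⟩ := exists_eq_sub_pow_mul hg hg1 a
    refine ⟨Function.update n a k, g', hg', ?_, fun z => ?_⟩
    · intro b hb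
      rcases Finset.mem_insert.1 hb with rfl | hb
      · exact hg'a
      · exact fun h => hg0 b hb (by rw [hgg', h, mul_zero])
    · rw [Finset.prod_insert ha, Function.update_self, hfg, hgg']
      have : ∏ b ∈ S, (z - b) ^ Function.update n a k b = ∏ b ∈ S, (z - b) ^ n b := by
        refine Finset.prod_congr rfl fun b hb => ?_
        rw [Function.update_of_ne (by rintro rfl; exact ha hb)]
      rw [this]; ring

lemma finite_zeros_of_isCompact {f : ℂ → ℂ} (hf : Differentiable ℂ f) (hf0 : ∃ z, f z ≠ 0)
    {K : Set ℂ} (hK : IsCompact K) : {z | z ∈ K ∧ f z = 0}.Finite := by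
  by_contra hinf
  obtain ⟨a, -, ha⟩ := Set.Infinite.exists_accPt_of_subset_isCompact hinf hK fun z hz => hz.1
  obtain ⟨z, hz⟩ := hf0
  have hA : AnalyticOnNhd ℂ f Set.univ := hf.differentiableOn.analyticOnNhd isOpen_univ
  refine hz (hA.eqOn_zero_of_preconnected_of_frequently_eq_zero isPreconnected_univ
      (Set.mem_univ a) ?_ (Set.mem_univ z))
  rw [accPt_iff_frequently_nhdsNE] at ha
  exact ha.mono fun y hy => hy.2

/-- Factorization of an entire function with purely imaginary zeros on a disc. -/
lemma exists_factorization {Ξ : ℂ → ℂ} (hΞ : Differentiable ℂ Ξ)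
    (hz : ∀ s, Ξ s = 0 → s.re = 0) (R : ℝ) :
    ∃ (Z : Finset ℝ) (m : ℝ → ℕ) (g : ℂ → ℂ), Differentiable ℂ g ∧ (∀ γ ∈ Z, 1 ≤ m γ) ∧
      (∀ z ∈ Metric.closedBall (0 : ℂ) R, g z ≠ 0) ∧
      ∀ z, Ξ z = (∏ γ ∈ Z, (z - γ * I) ^ m γ) * g z := by
  have hΞ0 : ∃ z, Ξ z ≠ 0 := ⟨1, fun h => by simpa using hz 1 h⟩
  set S := (finite_zeros_of_isCompact hΞ hΞ0 (isCompact_closedBall (0 : ℂ) R)).toFinset with hS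
  have hmem : ∀ a, a ∈ S ↔ a ∈ Metric.closedBall (0 : ℂ) R ∧ Ξ a = 0 := by
    intro a; rw [hS, Set.Finite.mem_toFinset]; rfl
  obtain ⟨n, g, hg, hg0, hfac⟩ := exists_eq_prod_mul hΞ hΞ0 S
  have him : ∀ a ∈ S, a = (a.im : ℂ) * I := by
    intro a ha
    have := hz a ((hmem a).1 ha).2
    apply Complex.ext <;> simp [this]
  refine ⟨S.image Complex.im, fun γ => n (γ * I), g, hg, ?_, ?_, ?_⟩
  · intro γ hγ
    obtain ⟨a, ha, rfl⟩ := Finset.mem_image.1 hγ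
    simp only [← him a ha]
    by_contra hlt
    have h0 : n a = 0 := by omega
    have h1 := ((hmem a).1 ha).2
    rw [hfac] at h1
    rcases mul_eq_zero.1 h1 with h1 | h1
    · obtain ⟨b, hb, hb0⟩ := Finset.prod_eq_zero_iff.1 h1
      have hab : a = b := sub_eq_zero.1 (eq_zero_of_pow_eq_zero hb0)
      subst hab
      simp [h0] at hb0
    · exact hg0 a ha h1
  · intro z hzR h0
    have h1 : z ∈ S := (hmem z).2 ⟨hzR, by rw [hfac, h0, mul_zero]⟩
    exact hg0 z h1 h0
  · intro z
    rw [hfac, Finset.prod_image]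
    · congr 1
      exact Finset.prod_congr rfl fun a ha => by simp only [← him a ha]
    · intro a ha b hb hab
      rw [him a ha, him b hb]
      rw [show a.im = b.im from hab]

lemma logDeriv_factorization {Z : Finset ℝ} {m : ℝ → ℕ} {g Ξ : ℂ → ℂ} (hg : Differentiable ℂ g)
    (hfac : ∀ z, Ξ z = (∏ γ ∈ Z, (z - γ * I) ^ m γ) * g z) {s : ℂ} (hs : s.re ≠ 0)
    (hgs : g s ≠ 0) :
    logDeriv Ξ s = (∑ γ ∈ Z, (m γ : ℂ) / (s - γ * I)) + logDeriv g s := by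
  have hne : ∀ γ : ℝ, s - γ * I ≠ 0 := fun γ h => hs (by
    have := congrArg Complex.re h; simpa using this)
  have h0 : Ξ = fun z => (∏ γ ∈ Z, (z - γ * I) ^ m γ) * g z := funext hfac
  have h1 : ∀ γ ∈ Z, (s - γ * I) ^ m γ ≠ 0 := fun γ _ => pow_ne_zero _ (hne γ)
  rw [h0, logDeriv_mul s (Finset.prod_ne_zero_iff.2 h1) hgs (by fun_prop) (hg s)]
  congr 1
  have h2 := logDeriv_prod (s := Z) (f := fun γ z => (z - (γ : ℂ) * I) ^ m γ) (x := s) h1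
    (fun γ _ => by fun_prop)
  rw [h2]
  refine Finset.sum_congr rfl fun γ _ => ?_
  rw [logDeriv_fun_pow (by fun_prop)]
  rw [logDeriv_apply]
  have : deriv (fun z => z - (γ : ℂ) * I) s = 1 := by simp
  rw [this]
  ring


lemma integrable_mul_of_support {φ : ℝ → ℂ} {g : ℝ → ℝ} {T : ℝ}
    (hφ : ContinuousOn φ (Set.Icc (-T) T)) (hg : Continuous g) (hsupp : ∀ t, T ≤ |t| → g t = 0) :
    Integrable fun t => φ t * (g t : ℂ) := by
  have h1 : IntegrableOn (fun t => φ t * (g t : ℂ)) (Set.Icc (-T) T) :=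
    (hφ.mul (by fun_prop)).integrableOn_Icc
  rw [← integrableOn_univ]
  refine h1.of_forall_sdiff_eq_zero MeasurableSet.univ fun t ht => ?_
  have : T ≤ |t| := by
    by_contra! h
    exact ht.2 (abs_le.1 h.le)
  simp [hsupp t this]

lemma norm_ofReal_add_mul_I_le (σ t : ℝ) : ‖(σ : ℂ) + t * I‖ ≤ |σ| + |t| := by
  refine (norm_add_le _ _).trans ?_
  simp

lemma tendsto_poisson {g : ℝ → ℝ} (hg : Continuous g) {B : ℝ} (hB : ∀ t, |g t| ≤ B) (γ : ℝ) :
    Tendsto (fun σ : ℝ => ∫ t, σ / (σ ^ 2 + (t - γ) ^ 2) * g t) (𝓝[>] 0) (𝓝 (π * g γ)) := by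
  have h1 : Tendsto (fun σ : ℝ => ∫ v, (1 + v ^ 2)⁻¹ * g (γ + σ * v)) (𝓝[>] 0)
      (𝓝 (∫ v : ℝ, (1 + v ^ 2)⁻¹ * g (γ + 0 * v))) := by
    refine tendsto_integral_filter_of_dominated_convergence (fun v : ℝ => (1 + v ^ 2)⁻¹ * B)
      (Eventually.of_forall fun σ => ?_) (Eventually.of_forall fun σ => ae_of_all _ fun v => ?_)
      (integrable_inv_one_add_sq.mul_const B) (ae_of_all _ fun v => ?_)
    · exact (integrable_inv_one_add_sq.aestronglyMeasurable).mul (by fun_prop)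
    · rw [norm_mul, Real.norm_eq_abs, Real.norm_eq_abs, abs_of_pos (by positivity)]
      gcongr
      exact hB _
    · refine Tendsto.const_mul _ ?_
      have : Continuous fun σ : ℝ => g (γ + σ * v) := by fun_prop
      exact (this.tendsto 0).mono_left nhdsWithin_le_nhds
  have h2 : ∫ v : ℝ, (1 + v ^ 2)⁻¹ * g (γ + 0 * v) = π * g γ := by
    simp only [zero_mul, add_zero]
    rw [integral_mul_const, integral_univ_inv_one_add_sq]
  rw [h2] at h1
  refine h1.congr' ?_
  filter_upwards [self_mem_nhdsWithin] with σ hσ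
  have hσ0 : (0 : ℝ) < σ := hσ
  have h3 := Measure.integral_comp_mul_left
    (fun v => σ * (σ ^ 2 + v ^ 2)⁻¹ * g (γ + v)) σ
  have h4 := integral_add_left_eq_self (μ := (volume : Measure ℝ))
    (fun t => σ / (σ ^ 2 + (t - γ) ^ 2) * g t) γ
  rw [← h4]
  have h5 : ∀ v : ℝ, σ / (σ ^ 2 + (γ + v - γ) ^ 2) * g (γ + v) =
      σ * (σ ^ 2 + v ^ 2)⁻¹ * g (γ + v) := fun v => by
    rw [add_sub_cancel_left, div_eq_mul_inv]
  simp_rw [h5]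
  rw [abs_of_pos (by positivity), smul_eq_mul, eq_inv_mul_iff_mul_eq₀ hσ0.ne'] at h3
  rw [← h3, ← integral_const_mul]
  congr 1; ext v
  have : (1 : ℝ) + v ^ 2 ≠ 0 := by positivity
  have : σ ^ 2 + (σ * v) ^ 2 ≠ 0 := by positivity
  field_simp

/-- The boundary values of the odd logarithmic derivative of an entire function with purely
imaginary zeros, tested against an even function, count the zeros. -/
lemma tendsto_integral_logDeriv {Ξ : ℂ → ℂ}
    (hodd : ∀ s, logDeriv Ξ (-s) = -logDeriv Ξ s)
    {Z : Finset ℝ} {m : ℝ → ℕ} {h : ℂ → ℂ} (hh : Differentiable ℂ h)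
    {R T : ℝ} (hTR : T < R)
    (hh0 : ∀ z ∈ Metric.closedBall (0 : ℂ) R, h z ≠ 0)
    (hfac : ∀ z, Ξ z = (∏ γ ∈ Z, (z - γ * I) ^ m γ) * h z)
    {g : ℝ → ℝ} (hg : Continuous g) (heven : ∀ t, g (-t) = g t)
    (hsupp : ∀ t, T ≤ |t| → g t = 0) :
    Tendsto (fun σ : ℝ => ∫ t : ℝ, logDeriv Ξ (σ + t * I) * (g t : ℂ)) (𝓝[>] 0)
      (𝓝 ((π * ∑ γ ∈ Z, m γ * g γ : ℝ) : ℂ)) := by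
  obtain ⟨B, hB⟩ : ∃ B, ∀ t, |g t| ≤ B := by
    obtain ⟨B, hB⟩ := (isCompact_Icc (a := -T) (b := T)).exists_bound_of_continuousOn
      hg.continuousOn
    refine ⟨max B 0, fun t => ?_⟩
    by_cases ht : T ≤ |t|
    · simp [hsupp t ht]
    · exact (hB t (abs_le.1 (not_le.1 ht).le)).trans (le_max_left _ _)
  have hHc : ContinuousOn (logDeriv h) (Metric.closedBall 0 R) := by
    have : ContinuousOn (fun z => deriv h z / h z) (Metric.closedBall 0 R) :=
      hh.deriv.continuous.continuousOn.div hh.continuous.continuousOn hh0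
    exact this
  obtain ⟨C, hC⟩ := (isCompact_closedBall (0 : ℂ) R).exists_bound_of_continuousOn hHc
  have hball : ∀ σ t : ℝ, |σ| ≤ R - T → |t| ≤ T → (σ : ℂ) + t * I ∈ Metric.closedBall (0 : ℂ) R := by
    intro σ t h1 h2
    rw [mem_closedBall_zero_iff]
    linarith [norm_ofReal_add_mul_I_le σ t]
  have hHcont : ∀ σ : ℝ, |σ| ≤ R - T →
      ContinuousOn (fun t : ℝ => logDeriv h (σ + t * I)) (Set.Icc (-T) T) := fun σ hσ =>
    hHc.comp (by fun_prop) fun t ht => hball σ t hσ (abs_le.2 ht)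
  have hHint : ∀ σ : ℝ, |σ| ≤ R - T → Integrable fun t : ℝ => logDeriv h (σ + t * I) * (g t : ℂ) :=
    fun σ hσ => integrable_mul_of_support (hHcont σ hσ) hg hsupp
  have hHlim : ∀ ε : ℝ, Tendsto (fun σ : ℝ => ∫ t : ℝ, logDeriv h (((ε * σ : ℝ) : ℂ) + t * I) * (g t : ℂ))
      (𝓝[>] 0) (𝓝 (∫ t : ℝ, logDeriv h (((0 : ℝ) : ℂ) + t * I) * (g t : ℂ))) := by
    intro ε
    have hsmall : ∀ᶠ σ : ℝ in 𝓝[>] 0, |ε * σ| ≤ R - T := by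
      refine Eventually.filter_mono nhdsWithin_le_nhds ?_
      have : Continuous fun σ : ℝ => |ε * σ| := by fun_prop
      refine (this.tendsto 0).eventually_le_const ?_
      simpa using hTR
    refine tendsto_integral_filter_of_dominated_convergence (fun t => C * |g t|) ?_ ?_ ?_ ?_
    · filter_upwards [hsmall] with σ hσ using (hHint _ hσ).aestronglyMeasurable
    · filter_upwards [hsmall] with σ hσ
      refine ae_of_all _ fun t => ?_
      by_cases ht : T ≤ |t|
      · simp [hsupp t ht]
      · rw [norm_mul, Complex.norm_real, Real.norm_eq_abs]
        gcongr
        exact hC _ (hball _ t hσ (not_le.1 ht).le)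
    · have := (integrable_mul_of_support (φ := fun _ => 1) continuousOn_const hg hsupp).norm.const_mul C
      simpa using this
    · refine ae_of_all _ fun t => ?_
      by_cases ht : T ≤ |t|
      · simp [hsupp t ht]
      · refine Tendsto.mul_const _ ?_
        have h1 : Tendsto (fun σ : ℝ => ((ε * σ : ℝ) : ℂ) + t * I) (𝓝[>] 0)
            (𝓝[Metric.closedBall 0 R] (((0 : ℝ) : ℂ) + t * I)) := by
          refine tendsto_nhdsWithin_iff.2 ⟨?_, ?_⟩
          · have : Continuous fun σ : ℝ => ((ε * σ : ℝ) : ℂ) + t * I := by fun_prop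
            have := (this.tendsto 0).mono_left (nhdsWithin_le_nhds (s := Set.Ioi 0))
            simpa using this
          · filter_upwards [hsmall] with σ hσ using hball _ t hσ (not_le.1 ht).le
        exact (hHc _ (hball 0 t (by simp; linarith) (not_le.1 ht).le)).tendsto.comp h1
  have hP : Tendsto (fun σ : ℝ => ∑ γ ∈ Z, (m γ : ℂ) *
      ((∫ t, σ / (σ ^ 2 + (t - γ) ^ 2) * g t : ℝ) : ℂ)) (𝓝[>] 0)
      (𝓝 (∑ γ ∈ Z, (m γ : ℂ) * ((π * g γ : ℝ) : ℂ))) :=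
    tendsto_finsetSum _ fun γ _ => Tendsto.const_mul _
      ((Complex.continuous_ofReal.tendsto _).comp (tendsto_poisson hg hB γ))
  have htot := hP.add (((hHlim 1).sub (hHlim (-1))).const_mul (1 / 2))
  rw [sub_self, mul_zero, add_zero] at htot
  have e : (∑ γ ∈ Z, (m γ : ℂ) * ((π * g γ : ℝ) : ℂ)) = ((π * ∑ γ ∈ Z, m γ * g γ : ℝ) : ℂ) := by
    push_cast
    rw [Finset.mul_sum]
    exact Finset.sum_congr rfl fun γ _ => by ring
  rw [e] at htot
  refine htot.congr' ?_
  have hsmall : ∀ᶠ σ : ℝ in 𝓝[>] 0, σ ≤ R - T :=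
    Eventually.filter_mono nhdsWithin_le_nhds (eventually_le_nhds (by linarith))
  filter_upwards [hsmall, self_mem_nhdsWithin] with σ hσ1 hσ2
  have hσ0 : (0 : ℝ) < σ := hσ2
  have hσabs : |σ| ≤ R - T := by rwa [abs_of_pos hσ0]
  have hσabs' : |-σ| ≤ R - T := by rwa [abs_neg]
  have hre : ∀ (τ t : ℝ), τ ≠ 0 → ((τ : ℂ) + t * I).re ≠ 0 := fun τ t h => by simpa using h
  have hpole : ∀ (τ γ t : ℝ), τ ≠ 0 → (τ : ℂ) + t * I - γ * I ≠ 0 := fun τ γ t hτ h => by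
    have := congrArg Complex.re h
    simp at this
    exact hτ this
  have hEint : ∀ τ : ℝ, τ ≠ 0 → |τ| ≤ R - T →
      Integrable fun t : ℝ => logDeriv Ξ (τ + t * I) * (g t : ℂ) := by
    intro τ hτ hτR
    refine integrable_mul_of_support (T := T) ?_ hg hsupp
    have h1 : ContinuousOn (fun t : ℝ => (∑ γ ∈ Z, (m γ : ℂ) / ((τ : ℂ) + t * I - γ * I)) +
        logDeriv h (τ + t * I)) (Set.Icc (-T) T) := by
      refine ContinuousOn.add (Continuous.continuousOn ?_) (hHcont τ hτR)
      refine continuous_finsetSum _ fun γ _ => ?_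
      exact continuous_const.div (by fun_prop) fun t => hpole τ γ t hτ
    refine h1.congr fun t ht => ?_
    exact logDeriv_factorization hh hfac (hre τ t hτ) (hh0 _ (hball τ t hτR (abs_le.2 ht)))
  have hrefl : ∫ t : ℝ, logDeriv Ξ (σ + t * I) * (g t : ℂ) =
      -∫ t : ℝ, logDeriv Ξ (((-σ : ℝ) : ℂ) + t * I) * (g t : ℂ) := by
    rw [← integral_neg_eq_self, ← integral_neg]
    congr 1; ext t
    rw [heven, ← neg_mul, ← hodd]
    congr 2
    push_cast
    ring
  have hhalf : ∫ t : ℝ, logDeriv Ξ (σ + t * I) * (g t : ℂ) =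
      1 / 2 * ((∫ t : ℝ, logDeriv Ξ (σ + t * I) * (g t : ℂ)) -
        ∫ t : ℝ, logDeriv Ξ (((-σ : ℝ) : ℂ) + t * I) * (g t : ℂ)) := by
    linear_combination (1 / 2 : ℂ) * hrefl
  rw [hhalf, ← integral_sub (hEint σ hσ0.ne' hσabs) (hEint (-σ) (neg_ne_zero.2 hσ0.ne') hσabs')]
  have hpt : ∀ t : ℝ, logDeriv Ξ (σ + t * I) * (g t : ℂ) -
      logDeriv Ξ (((-σ : ℝ) : ℂ) + t * I) * (g t : ℂ) =
      (∑ γ ∈ Z, 2 * ((m γ : ℂ) * ((σ / (σ ^ 2 + (t - γ) ^ 2) * g t : ℝ) : ℂ))) +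
        (logDeriv h (((1 * σ : ℝ) : ℂ) + t * I) * (g t : ℂ) -
          logDeriv h (((-1 * σ : ℝ) : ℂ) + t * I) * (g t : ℂ)) := by
    intro t
    by_cases ht : T ≤ |t|
    · simp [hsupp t ht]
    have ht' := (not_le.1 ht).le
    rw [logDeriv_factorization hh hfac (hre σ t hσ0.ne') (hh0 _ (hball σ t hσabs ht')),
      logDeriv_factorization hh hfac (hre (-σ) t (neg_ne_zero.2 hσ0.ne'))
        (hh0 _ (hball (-σ) t hσabs' ht'))]
    have hsum : (∑ γ ∈ Z, (m γ : ℂ) / ((σ : ℂ) + t * I - γ * I)) * (g t : ℂ) -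
        (∑ γ ∈ Z, (m γ : ℂ) / (((-σ : ℝ) : ℂ) + t * I - γ * I)) * (g t : ℂ) =
        ∑ γ ∈ Z, 2 * ((m γ : ℂ) * ((σ / (σ ^ 2 + (t - γ) ^ 2) * g t : ℝ) : ℂ)) := by
      rw [Finset.sum_mul, Finset.sum_mul, ← Finset.sum_sub_distrib]
      refine Finset.sum_congr rfl fun γ _ => ?_
      have h1 := hpole σ γ t hσ0.ne'
      have h2 := hpole (-σ) γ t (neg_ne_zero.2 hσ0.ne')
      have h3 : ((σ ^ 2 + (t - γ) ^ 2 : ℝ) : ℂ) ≠ 0 := by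
        exact_mod_cast (by positivity : σ ^ 2 + (t - γ) ^ 2 ≠ 0)
      have h4 : ((σ ^ 2 + (t - γ) ^ 2 : ℝ) : ℂ) =
          -(((σ : ℂ) + t * I - γ * I) * (((-σ : ℝ) : ℂ) + t * I - γ * I)) := by
        push_cast
        linear_combination ((t - γ : ℂ) ^ 2) * I_sq
      have h5 : ((σ : ℂ) + t * I - γ * I) - (((-σ : ℝ) : ℂ) + t * I - γ * I) = 2 * σ := by
        push_cast
        ring
      rw [ofReal_mul, ofReal_div, h4]
      generalize (σ : ℂ) + t * I - γ * I = a at *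
      generalize ((-σ : ℝ) : ℂ) + t * I - γ * I = b at *
      have h6 : (σ : ℂ) = (a - b) / 2 := by rw [h5]; ring
      rw [h6]
      field_simp
      ring
    rw [← hsum, one_mul, neg_one_mul]
    ring
  have hPint : ∀ γ ∈ Z, Integrable fun t : ℝ =>
      2 * ((m γ : ℂ) * ((σ / (σ ^ 2 + (t - γ) ^ 2) * g t : ℝ) : ℂ)) := by
    intro γ _
    have := (integrable_mul_of_support (φ := fun t : ℝ => ((σ / (σ ^ 2 + (t - γ) ^ 2) : ℝ) : ℂ))
      (T := T) ?_ hg hsupp).const_mul (2 * (m γ : ℂ))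
    · refine this.congr (ae_of_all _ fun t => ?_)
      dsimp only
      rw [ofReal_mul]
      ring
    · refine Continuous.continuousOn (Complex.continuous_ofReal.comp ?_)
      exact continuous_const.div (by fun_prop) fun t => by positivity
  simp_rw [hpt]
  have hHd : Integrable fun t : ℝ => logDeriv h (((1 * σ : ℝ) : ℂ) + t * I) * (g t : ℂ) -
      logDeriv h (((-1 * σ : ℝ) : ℂ) + t * I) * (g t : ℂ) :=
    (hHint _ (by simpa using hσabs)).sub (hHint _ (by simpa using hσabs))
  rw [integral_add (integrable_finsetSum _ hPint) hHd,
    integral_sub (hHint _ (by simpa using hσabs)) (hHint _ (by simpa using hσabs)),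
    integral_finsetSum _ hPint, mul_add, Finset.mul_sum]
  congr 1
  refine Finset.sum_congr rfl fun γ _ => ?_
  rw [integral_const_mul, integral_const_mul, integral_complex_ofReal]
  ring

lemma exists_norm_logDeriv_le {Ξ : ℂ → ℂ} (hΞ : Differentiable ℂ Ξ)
    (hz : ∀ s, Ξ s = 0 → s.re = 0) :
    ∃ C, ∀ σ : ℝ, 0 < σ → σ ≤ 1 → ‖logDeriv Ξ σ‖ ≤ C / σ := by
  obtain ⟨Z, m, h, hh, -, hh0, hfac⟩ := exists_factorization hΞ hz 1
  have hHc : ContinuousOn (logDeriv h) (Metric.closedBall 0 1) := by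
    have : ContinuousOn (fun z => deriv h z / h z) (Metric.closedBall 0 1) :=
      hh.deriv.continuous.continuousOn.div hh.continuous.continuousOn hh0
    exact this
  obtain ⟨C, hC⟩ := (isCompact_closedBall (0 : ℂ) 1).exists_bound_of_continuousOn hHc
  refine ⟨(∑ γ ∈ Z, (m γ : ℝ)) + C, fun σ hσ hσ1 => ?_⟩
  have hmem : (σ : ℂ) ∈ Metric.closedBall (0 : ℂ) 1 := by
    rw [mem_closedBall_zero_iff, Complex.norm_real, Real.norm_eq_abs, abs_of_pos hσ]
    exact hσ1
  have hC0 : 0 ≤ C := (norm_nonneg _).trans (hC _ hmem)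
  rw [logDeriv_factorization hh hfac (by simpa using hσ.ne') (hh0 _ hmem), add_div, Finset.sum_div]
  refine (norm_add_le _ _).trans (add_le_add ?_ ?_)
  · refine (norm_sum_le _ _).trans (Finset.sum_le_sum fun γ _ => ?_)
    rw [norm_div, Complex.norm_natCast]
    have : σ ≤ ‖(σ : ℂ) - γ * I‖ := by
      have := Complex.re_le_norm ((σ : ℂ) - γ * I)
      simpa using this
    gcongr
  · refine (hC _ hmem).trans ?_
    rw [le_div_iff₀ hσ]
    nlinarith

end LittlewoodOscillation

namespace LittlewoodOscillation

open MeasureTheory Topology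

lemma integrableOn_exp_neg_mul {σ : ℝ} (hσ : 0 < σ) :
    IntegrableOn (fun u : ℝ => rexp (-(σ * u))) (Set.Ioi 0) := by
  simpa only [neg_mul] using integrableOn_exp_mul_Ioi (neg_lt_zero.2 hσ) 0

lemma integral_exp_neg_mul {σ : ℝ} (hσ : 0 < σ) :
    ∫ u in Set.Ioi (0 : ℝ), rexp (-(σ * u)) = 1 / σ := by
  have := integral_exp_mul_Ioi (neg_lt_zero.2 hσ) 0
  simp only [neg_mul] at this
  rw [this]
  simp

lemma sqrt_mul_exp_le {σ u : ℝ} (hσ : 0 < σ) (hu : 0 ≤ u) :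
    √u * rexp (-(σ * u)) ≤ 2 / √σ * rexp (-(σ / 2 * u)) := by
  have h1 : √u * √σ ≤ 2 * rexp (σ / 2 * u) := by
    rw [← Real.sqrt_mul hu]
    have h2 := Real.add_one_le_exp (σ / 2 * u)
    have h3 : √(u * σ) ≤ 1 + u * σ := by
      rw [Real.sqrt_le_left (by positivity)]
      nlinarith [mul_nonneg hu hσ.le]
    linarith
  have h4 : rexp (-(σ * u)) = rexp (-(σ / 2 * u)) * rexp (-(σ / 2 * u)) := by
    rw [← Real.exp_add]; ring_nf
  have h5 : rexp (σ / 2 * u) * rexp (-(σ / 2 * u)) = 1 := by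
    rw [← Real.exp_add]; simp
  have hs : 0 < √σ := Real.sqrt_pos.2 hσ
  rw [div_mul_eq_mul_div, le_div_iff₀ hs, h4]
  have he := Real.exp_pos (-(σ / 2 * u))
  calc √u * (rexp (-(σ / 2 * u)) * rexp (-(σ / 2 * u))) * √σ
      = (√u * √σ) * rexp (-(σ / 2 * u)) * rexp (-(σ / 2 * u)) := by ring
    _ ≤ 2 * rexp (σ / 2 * u) * rexp (-(σ / 2 * u)) * rexp (-(σ / 2 * u)) := by gcongr
    _ = 2 * rexp (-(σ / 2 * u)) := by rw [mul_assoc 2, h5, mul_one]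

lemma integrableOn_sqrt_mul_exp {σ : ℝ} (hσ : 0 < σ) :
    IntegrableOn (fun u : ℝ => √u * rexp (-(σ * u))) (Set.Ioi 0) := by
  refine ((integrableOn_exp_neg_mul (half_pos hσ)).const_mul (2 / √σ)).mono'
    (by fun_prop) ?_
  refine (ae_restrict_mem measurableSet_Ioi).mono fun u hu => ?_
  rw [Real.norm_eq_abs, abs_of_nonneg (by positivity)]
  exact sqrt_mul_exp_le hσ (le_of_lt hu)

lemma integral_sqrt_mul_exp_le {σ : ℝ} (hσ : 0 < σ) :
    ∫ u in Set.Ioi (0 : ℝ), √u * rexp (-(σ * u)) ≤ 4 / (σ * √σ) := by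
  calc _ ≤ ∫ u in Set.Ioi (0 : ℝ), 2 / √σ * rexp (-(σ / 2 * u)) :=
        setIntegral_mono_on (integrableOn_sqrt_mul_exp hσ)
          ((integrableOn_exp_neg_mul (half_pos hσ)).const_mul _) measurableSet_Ioi
          fun u hu => sqrt_mul_exp_le hσ (le_of_lt hu)
    _ = _ := by
      rw [integral_const_mul, integral_exp_neg_mul (half_pos hσ)]
      have : √σ ≠ 0 := (Real.sqrt_pos.2 hσ).ne'
      field_simp
      norm_num

/-- A Tauberian step: a nonnegative function whose Laplace transform is `O(σ^(-3/2))` at `0` is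
integrable against `(1+u)⁻²`. -/
lemma integrableOn_div_sq_of_laplace_le {p : ℝ → ℝ} (hp : Measurable p)
    (hp0 : ∀ u, 0 < u → 0 ≤ p u)
    (hI : ∀ σ, 0 < σ → IntegrableOn (fun u => p u * rexp (-(σ * u))) (Set.Ioi 0)) {C : ℝ}
    (hC : ∀ σ, 0 < σ → σ ≤ 1 →
      ∫ u in Set.Ioi (0 : ℝ), p u * rexp (-(σ * u)) ≤ C / (σ * √σ)) :
    IntegrableOn (fun u => p u / (1 + u) ^ 2) (Set.Ioi 0) := by
  have hmeas : Measurable fun u => p u / (1 + u) ^ 2 := by fun_prop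
  have key : ∀ u, 0 < u → ENNReal.ofReal (p u / (1 + u) ^ 2) ≤ ENNReal.ofReal (2 * rexp 1) *
      ∫⁻ σ in Set.Ioc (0 : ℝ) 1, ENNReal.ofReal (σ * (p u * rexp (-(σ * u)))) := by
    intro u hu
    have h_intg : ∫ σ in Set.Ioc (0 : ℝ) (1 / (1 + u)), σ * (p u * rexp (-1)) =
        (1 / (1 + u)) ^ 2 / 2 * (p u * rexp (-1)) := by
      rw [← intervalIntegral.integral_of_le (by positivity), intervalIntegral.integral_mul_const,
        integral_id]
      ring
    have h1 : p u / (1 + u) ^ 2 =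
        2 * rexp 1 * ∫ σ in Set.Ioc (0 : ℝ) (1 / (1 + u)), σ * (p u * rexp (-1)) := by
      rw [h_intg, Real.exp_neg]
      have := (Real.exp_pos 1).ne'
      field_simp
    rw [h1, ENNReal.ofReal_mul (by positivity)]
    gcongr
    rw [ofReal_integral_eq_lintegral_ofReal]
    · calc _ ≤ ∫⁻ σ in Set.Ioc (0 : ℝ) (1 / (1 + u)),
            ENNReal.ofReal (σ * (p u * rexp (-(σ * u)))) := by
            refine setLIntegral_mono' measurableSet_Ioc fun σ hσ => ENNReal.ofReal_le_ofReal ?_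
            have h2 : σ * u ≤ 1 := by
              have := mul_le_mul_of_nonneg_right hσ.2 hu.le
              refine this.trans ?_
              rw [div_mul_eq_mul_div, div_le_one (by positivity)]
              linarith
            have := hp0 u hu
            have := hσ.1
            gcongr
        _ ≤ _ := lintegral_mono_set (Set.Ioc_subset_Ioc_right (by
            rw [div_le_one (by positivity)]; linarith))
    · exact (Continuous.integrableOn_Ioc (by fun_prop))
    · refine (ae_restrict_mem measurableSet_Ioc).mono fun σ hσ => ?_
      have := hp0 u hu
      have := hσ.1
      simp only [Pi.zero_apply]
      positivity
  refine ⟨hmeas.aestronglyMeasurable, ?_⟩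
  rw [hasFiniteIntegral_iff_ofReal ((ae_restrict_mem measurableSet_Ioi).mono fun u hu =>
    div_nonneg (hp0 u hu) (sq_nonneg _))]
  have hmeas2 : Measurable (Function.uncurry fun u σ : ℝ =>
      ENNReal.ofReal (σ * (p u * rexp (-(σ * u))))) := by
    refine ENNReal.measurable_ofReal.comp ?_
    have : Measurable fun x : ℝ × ℝ => x.2 * (p x.1 * rexp (-(x.2 * x.1))) := by fun_prop
    exact this
  calc ∫⁻ u in Set.Ioi (0 : ℝ), ENNReal.ofReal (p u / (1 + u) ^ 2)
      ≤ ∫⁻ u in Set.Ioi (0 : ℝ), ENNReal.ofReal (2 * rexp 1) *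
        ∫⁻ σ in Set.Ioc (0 : ℝ) 1, ENNReal.ofReal (σ * (p u * rexp (-(σ * u)))) :=
        setLIntegral_mono' measurableSet_Ioi key
    _ = ENNReal.ofReal (2 * rexp 1) * ∫⁻ σ in Set.Ioc (0 : ℝ) 1, ∫⁻ u in Set.Ioi (0 : ℝ),
          ENNReal.ofReal (σ * (p u * rexp (-(σ * u)))) := by
        rw [lintegral_const_mul' _ _ ENNReal.ofReal_ne_top, lintegral_lintegral_swap]
        exact hmeas2.aemeasurable
    _ ≤ ENNReal.ofReal (2 * rexp 1) * ∫⁻ σ in Set.Ioc (0 : ℝ) 1,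
          ENNReal.ofReal (|C| * σ ^ (-(1 / 2) : ℝ)) := by
        gcongr 1
        refine setLIntegral_mono' measurableSet_Ioc fun σ hσ => ?_
        rw [← ofReal_integral_eq_lintegral_ofReal ((hI σ hσ.1).const_mul σ)
          ((ae_restrict_mem measurableSet_Ioi).mono fun u hu =>
            mul_nonneg hσ.1.le (mul_nonneg (hp0 u hu) (Real.exp_pos _).le)), integral_const_mul]
        refine ENNReal.ofReal_le_ofReal ?_
        have hs : 0 < √σ := Real.sqrt_pos.2 hσ.1
        calc _ ≤ σ * (C / (σ * √σ)) := by
              have := hσ.1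
              gcongr
              exact hC σ hσ.1 hσ.2
          _ = C / √σ := by have := hσ.1; field_simp
          _ ≤ |C| / √σ := by gcongr; exact le_abs_self C
          _ = _ := by rw [Real.rpow_neg hσ.1.le, ← Real.sqrt_eq_rpow]; rfl
    _ < ⊤ := by
        refine ENNReal.mul_lt_top ENNReal.ofReal_lt_top ?_
        have : IntegrableOn (fun σ : ℝ => |C| * σ ^ (-(1 / 2) : ℝ)) (Set.Ioc 0 1) := by
          have := intervalIntegral.intervalIntegrable_rpow' (a := 0) (b := 1)
            (r := -(1 / 2)) (by norm_num)
          rw [intervalIntegrable_iff_integrableOn_Ioc_of_le zero_le_one] at this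
          exact this.const_mul _
        exact this.lintegral_lt_top

end LittlewoodOscillation

namespace LittlewoodOscillation

open MeasureTheory Topology

/-- The archimedean part `α + ψ(β + s/2)` of the logarithmic derivative of a completed
`L`-function, with `ψ` the digamma function. -/
noncomputable def arch (α β : ℝ) (s : ℂ) : ℂ := α + digamma (β + s / 2)

lemma exists_norm_arch_sub_le (α : ℝ) {β : ℝ} (hβ : 0 < β) : ∃ K, 0 < K ∧ ∀ z w : ℂ,
    0 ≤ z.re → 0 ≤ w.re → ‖arch α β z - arch α β w‖ ≤ K * ‖z - w‖ := by
  obtain ⟨K, hK, h⟩ := exists_norm_digamma_sub_le hβ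
  refine ⟨K, hK, fun z w hz hw => ?_⟩
  have hre : ∀ s : ℂ, 0 ≤ s.re → β ≤ ((β : ℂ) + s / 2).re := fun s hs => by
    have : (s / 2).re = s.re / 2 := by simp
    rw [add_re, this, ofReal_re]
    linarith
  have h1 := h (β + z / 2) (β + w / 2) (hre z hz) (hre w hw)
  rw [arch, arch, add_sub_add_left_eq_sub]
  refine h1.trans ?_
  have : (β : ℂ) + z / 2 - (β + w / 2) = (z - w) / 2 := by ring
  rw [this, norm_div]
  have := norm_nonneg (z - w)
  norm_num
  nlinarith

lemma continuous_arch (α : ℝ) {β : ℝ} (hβ : 0 < β) {σ : ℝ} (hσ : 0 ≤ σ) :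
    Continuous fun t : ℝ => arch α β (σ + t * I) := by
  obtain ⟨K, hK, h⟩ := exists_norm_arch_sub_le α hβ
  refine (LipschitzWith.of_dist_le_mul (K := K.toNNReal) fun t t' => ?_).continuous
  rw [dist_eq_norm, Real.coe_toNNReal _ hK.le, Real.dist_eq]
  refine (h _ _ (by simpa using hσ) (by simpa using hσ)).trans (le_of_eq ?_)
  have : (σ : ℂ) + t * I - (σ + t' * I) = ((t - t' : ℝ) : ℂ) * I := by push_cast; ring
  rw [this, norm_mul, Complex.norm_I, mul_one, Complex.norm_real, Real.norm_eq_abs]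

/-- The analytic data attached to a primitive Dirichlet character `χ`: the function
`f(u) = Re ψ(eᵘ,χ) e^(-u/2)`, the product `D(s) = L(1/2+s,χ) L(1/2+s,χ⁻¹)` and its completion `Ξ`. -/
structure LData (f : ℝ → ℝ) (D Ξ : ℂ → ℂ) (α β : ℝ) : Prop where
  measurable : Measurable f
  eq_zero_of_lt : ∀ u, u < Real.log 2 → f u = 0
  differentiable_D : Differentiable ℂ D
  D_ne_zero : ∀ s : ℂ, 1 / 2 < s.re → D s ≠ 0
  integrableOn : ∀ σ, 1 / 2 < σ → IntegrableOn (fun u => f u * rexp (-(σ * u))) (Set.Ioi 0)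
  deriv_D : ∀ s : ℂ, 1 / 2 < s.re → deriv D s = -2 * (s + 1 / 2) * laplace f s * D s
  differentiable_Ξ : Differentiable ℂ Ξ
  logDeriv_neg : ∀ s, logDeriv Ξ (-s) = -logDeriv Ξ s
  eq_zero_neg : ∀ s, Ξ s = 0 → Ξ (-s) = 0
  D_eq_zero : ∀ s : ℂ, 0 < s.re → Ξ s = 0 → D s = 0
  β_pos : 0 < β
  logDeriv_eq : ∀ s : ℂ, 0 < s.re → D s ≠ 0 → logDeriv Ξ s = arch α β s + logDeriv D s

variable {f : ℝ → ℝ} {D Ξ : ℂ → ℂ} {α β M : ℝ}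

lemma LData.consequences (h : LData f D Ξ α β) (hM : 0 ≤ M)
    (hf : ∀ u, 0 < u → -(M * (1 + √u)) ≤ f u) :
    (∀ σ, 0 < σ → IntegrableOn (fun u => f u * rexp (-(σ * u))) (Set.Ioi 0)) ∧
    IntegrableOn (fun u => f u / (1 + u) ^ 2) (Set.Ioi 0) ∧
    (∀ s, Ξ s = 0 → s.re = 0) ∧
    ∀ s : ℂ, 0 < s.re → logDeriv Ξ s = arch α β s - 2 * (s + 1 / 2) * laplace f s := by
  set m : ℝ → ℝ := fun u => M * (1 + √u) with hm
  have hmm : Measurable m := by fun_prop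
  have hmI : ∀ σ, 0 < σ → IntegrableOn (fun u => m u * rexp (-(σ * u))) (Set.Ioi 0) := by
    intro σ hσ
    refine (((integrableOn_exp_neg_mul hσ).add (integrableOn_sqrt_mul_exp hσ)).const_mul M).congr
      (ae_of_all _ fun u => ?_)
    simp only [hm, Pi.add_apply]
    ring
  have hm0 : ∀ u, 0 < u → 0 ≤ m u := fun u _ => by positivity
  have hmint : ∀ σ, 0 < σ → σ ≤ 1 →
      ∫ u in Set.Ioi (0 : ℝ), m u * rexp (-(σ * u)) ≤ 5 * M / (σ * √σ) := by
    intro σ hσ hσ1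
    have e : ∀ u, m u * rexp (-(σ * u)) =
        M * (rexp (-(σ * u)) + √u * rexp (-(σ * u))) := fun u => by
      simp only [hm]; ring
    simp_rw [e]
    rw [integral_const_mul, integral_add (integrableOn_exp_neg_mul hσ)
      (integrableOn_sqrt_mul_exp hσ), integral_exp_neg_mul hσ]
    have h1 := integral_sqrt_mul_exp_le hσ
    have h2 : 1 / σ ≤ 1 / (σ * √σ) := by
      have := Real.sqrt_pos.2 hσ
      have h3 : √σ ≤ 1 := Real.sqrt_le_one.2 hσ1
      gcongr
      nlinarith
    calc _ ≤ M * (1 / (σ * √σ) + 4 / (σ * √σ)) := by gcongr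
      _ = _ := by ring
  obtain ⟨hfI, hD0, hDeq⟩ := landau_logDeriv h.differentiable_D h.measurable hmm hm0
    (fun u hu => by have := hf u hu; simp only [hm]; linarith) hmI h.integrableOn h.D_ne_zero
    h.deriv_D
  have hz : ∀ s, Ξ s = 0 → s.re = 0 := by
    intro s hs
    by_contra hne
    rcases lt_or_gt_of_ne hne with hlt | hgt
    · exact hD0 (-s) (by simpa using hlt) (h.D_eq_zero _ (by simpa using hlt) (h.eq_zero_neg s hs))
    · exact hD0 s hgt (h.D_eq_zero s hgt hs)
  have hE : ∀ s : ℂ, 0 < s.re →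
      logDeriv Ξ s = arch α β s - 2 * (s + 1 / 2) * laplace f s := by
    intro s hs
    rw [h.logDeriv_eq s hs (hD0 s hs), logDeriv_apply, hDeq s hs, mul_div_assoc,
      div_self (hD0 s hs)]
    ring
  refine ⟨hfI, ?_, hz, hE⟩
  obtain ⟨C, hC⟩ := exists_norm_logDeriv_le h.differentiable_Ξ hz
  obtain ⟨K, hK, hKa⟩ := exists_norm_arch_sub_le α h.β_pos
  have hlap : ∀ σ, 0 < σ → σ ≤ 1 → ∫ u in Set.Ioi (0 : ℝ), f u * rexp (-(σ * u)) ≤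
      (K + ‖arch α β 0‖ + |C|) / (σ * √σ) := by
    intro σ hσ hσ1
    have h1 := hE σ (by simpa using hσ)
    have h2 : ‖2 * ((σ : ℂ) + 1 / 2) * laplace f σ‖ ≤ K + ‖arch α β 0‖ + |C| / σ := by
      have e : 2 * ((σ : ℂ) + 1 / 2) * laplace f σ =
          (arch α β σ - arch α β 0) + arch α β 0 - logDeriv Ξ σ := by rw [h1]; ring
      rw [e]
      refine (norm_sub_le _ _).trans (add_le_add ((norm_add_le _ _).trans
        (add_le_add ?_ le_rfl)) ((hC σ hσ hσ1).trans ?_))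
      · refine (hKa _ _ (by simpa using hσ.le) (by simp)).trans ?_
        rw [sub_zero, Complex.norm_real, Real.norm_eq_abs, abs_of_pos hσ]
        nlinarith
      · gcongr; exact le_abs_self C
    rw [norm_mul, laplace_ofReal, Complex.norm_real] at h2
    have h3 : 1 ≤ ‖2 * ((σ : ℂ) + 1 / 2)‖ := by
      have : 2 * ((σ : ℂ) + 1 / 2) = ((2 * σ + 1 : ℝ) : ℂ) := by push_cast; ring
      rw [this, Complex.norm_real, Real.norm_eq_abs, abs_of_pos (by positivity)]
      linarith
    have hs : 0 < √σ := Real.sqrt_pos.2 hσ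
    have hs1 : √σ ≤ 1 := Real.sqrt_le_one.2 hσ1
    have h4 : (1 : ℝ) ≤ 1 / (σ * √σ) := by
      rw [le_div_iff₀ (by positivity)]; nlinarith
    have h5 : 1 / σ ≤ 1 / (σ * √σ) := by
      gcongr
      nlinarith
    calc _ ≤ ‖∫ u in Set.Ioi (0 : ℝ), f u * rexp (-(σ * u))‖ := Real.le_norm_self _
      _ ≤ K + ‖arch α β 0‖ + |C| / σ := by
        refine le_trans ?_ h2
        exact le_mul_of_one_le_left (norm_nonneg _) h3
      _ = (K + ‖arch α β 0‖) * 1 + |C| * (1 / σ) := by ring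
      _ ≤ (K + ‖arch α β 0‖) * (1 / (σ * √σ)) + |C| * (1 / (σ * √σ)) := by gcongr
      _ = _ := by ring
  have hp : IntegrableOn (fun u => (f u + m u) / (1 + u) ^ 2) (Set.Ioi 0) := by
    refine integrableOn_div_sq_of_laplace_le (C := (K + ‖arch α β 0‖ + |C|) + 5 * M)
      (h.measurable.add hmm)
      (fun u hu => by have := hf u hu; simp only [hm]; linarith)
      (fun σ hσ => ((hfI σ hσ).add (hmI σ hσ)).congr (ae_of_all _ fun u => ?_))
      fun σ hσ hσ1 => ?_
    · simp only [Pi.add_apply]; ring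
    · simp_rw [add_mul]
      rw [integral_add (hfI σ hσ) (hmI σ hσ), add_div]
      exact add_le_add (hlap σ hσ hσ1) (hmint σ hσ hσ1)
  refine (hp.sub (integrableOn_div_sq_of_laplace_le hmm hm0 hmI hmint)).congr
    (ae_of_all _ fun u => ?_)
  simp only [Pi.sub_apply]
  ring

/-- The explicit formula: `π ∑ g(γ)` over the zeros equals the archimedean contribution minus
the contribution of the primes. -/
lemma LData.explicit_formula (h : LData f D Ξ α β) (hM : 0 ≤ M)
    (hf : ∀ u, 0 < u → -(M * (1 + √u)) ≤ f u)
    {Z : Finset ℝ} {m : ℝ → ℕ} {h₀ : ℂ → ℂ} (hh : Differentiable ℂ h₀)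
    {R T : ℝ} (hTR : T < R) (hh0 : ∀ z ∈ Metric.closedBall (0 : ℂ) R, h₀ z ≠ 0)
    (hfac : ∀ z, Ξ z = (∏ γ ∈ Z, (z - γ * I) ^ m γ) * h₀ z)
    {g : ℝ → ℝ} (hg : Continuous g) (heven : ∀ t, g (-t) = g t)
    (hsupp : ∀ t, T ≤ |t| → g t = 0) {h₁ h₂ : ℝ → ℝ} (hm₁ : Measurable h₁) (hm₂ : Measurable h₂)
    (he₁ : ∀ u : ℝ, 0 < u → ∫ t : ℝ, (1 / 2 + t * I) * g t * cexp (-(t * u * I)) = h₁ u)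
    (he₂ : ∀ u : ℝ, 0 < u → ∫ t : ℝ, (g t : ℂ) * cexp (-(t * u * I)) = h₂ u)
    {C : ℝ} (hC₁ : ∀ u, 0 < u → |h₁ u| ≤ C / (1 + u) ^ 2)
    (hC₂ : ∀ u, 0 < u → |h₂ u| ≤ C / (1 + u) ^ 2) :
    π * ∑ γ ∈ Z, m γ * g γ =
      (∫ t : ℝ, (arch α β (t * I)).re * g t) - 2 * ∫ u in Set.Ioi 0, f u * h₁ u := by
  obtain ⟨hfI, hfsq, -, hE⟩ := h.consequences hM hf
  have h_intg : ∀ {φ : ℝ → ℂ}, Continuous φ → Integrable fun t : ℝ => φ t * (g t : ℂ) :=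
    fun hφ => integrable_mul_of_support hφ.continuousOn hg hsupp
  have harch : ∀ {σ : ℝ}, 0 ≤ σ → Integrable fun t : ℝ => arch α β (σ + t * I) * (g t : ℂ) :=
    fun hσ => h_intg (continuous_arch α h.β_pos hσ)
  have hfub : ∀ σ : ℝ, 0 < σ → ∫ t : ℝ, logDeriv Ξ (σ + t * I) * (g t : ℂ) =
      (∫ t : ℝ, arch α β (σ + t * I) * (g t : ℂ)) -
        2 * ((∫ u in Set.Ioi 0, f u * rexp (-(σ * u)) * (h₁ u + σ * h₂ u) : ℝ) : ℂ) := by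
    intro σ hσ
    have hprod : Integrable (Function.uncurry fun (t u : ℝ) =>
        ((σ + t * I + 1 / 2) * (g t : ℂ)) * (((f u : ℝ) : ℂ) * cexp (-((σ + t * I) * u))))
        (volume.prod (volume.restrict (Set.Ioi 0))) := by
      have h1 := (h_intg (φ := fun t : ℝ => (σ : ℂ) + t * I + 1 / 2) (by fun_prop)).mul_prod
        (Integrable.ofReal (𝕜 := ℂ) (hfI σ hσ))
      refine h1.congr' ?_ (ae_of_all _ fun x => ?_)
      · have := h.measurable
        have : Measurable fun x : ℝ × ℝ => ((σ + x.1 * I + 1 / 2) * (g x.1 : ℂ)) *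
            (((f x.2 : ℝ) : ℂ) * cexp (-((σ + x.1 * I) * x.2))) := by fun_prop
        exact this.aestronglyMeasurable
      · simp only [Function.uncurry, norm_mul, Complex.norm_exp]
        simp [Complex.norm_exp]
    have hlap : ∀ t : ℝ, (2 * (((σ : ℂ) + t * I) + 1 / 2) * laplace f (σ + t * I)) * (g t : ℂ) =
        2 * ∫ u in Set.Ioi (0 : ℝ),
          ((σ + t * I + 1 / 2) * (g t : ℂ)) * ((f u : ℂ) * cexp (-((σ + t * I) * u))) := by
      intro t
      rw [integral_const_mul, laplace]
      ring
    have hpt : ∀ t : ℝ, logDeriv Ξ (σ + t * I) * (g t : ℂ) =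
        arch α β (σ + t * I) * (g t : ℂ) - 2 * ∫ u in Set.Ioi (0 : ℝ),
          ((σ + t * I + 1 / 2) * (g t : ℂ)) * ((f u : ℂ) * cexp (-((σ + t * I) * u))) := by
      intro t
      rw [hE _ (by simpa using hσ), sub_mul, hlap]
    simp_rw [hpt]
    have hleft : Integrable fun t : ℝ => 2 * ∫ u in Set.Ioi (0 : ℝ),
        ((σ + t * I + 1 / 2) * (g t : ℂ)) * ((f u : ℂ) * cexp (-((σ + t * I) * u))) :=
      hprod.integral_prod_left.const_mul 2
    rw [integral_sub (harch hσ.le) hleft, integral_const_mul,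
      integral_integral_swap hprod, ← integral_complex_ofReal]
    congr 2
    refine setIntegral_congr_fun measurableSet_Ioi fun u hu => ?_
    have e : ∀ t : ℝ, ((σ + t * I + 1 / 2) * (g t : ℂ)) *
        ((f u : ℂ) * cexp (-((σ + t * I) * u))) = ((f u : ℂ) * cexp (-(σ * u))) *
        ((1 / 2 + t * I) * g t * cexp (-(t * u * I)) + σ * ((g t : ℂ) * cexp (-(t * u * I)))) := by
      intro t
      have : cexp (-((σ + t * I) * u)) = cexp (-(σ * u)) * cexp (-(t * u * I)) := by
        rw [← Complex.exp_add]; ring_nf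
      rw [this]; ring
    simp only [e]
    have i1 : Integrable fun t : ℝ => (1 / 2 + t * I) * g t * cexp (-(t * u * I)) :=
      (h_intg (φ := fun t : ℝ => (1 / 2 + t * I) * cexp (-(t * u * I))) (by fun_prop)).congr
        (ae_of_all _ fun t => by ring)
    have i2 : Integrable fun t : ℝ => (g t : ℂ) * cexp (-(t * u * I)) :=
      (h_intg (φ := fun t : ℝ => cexp (-(t * u * I))) (by fun_prop)).congr
        (ae_of_all _ fun t => by ring)
    rw [integral_const_mul, integral_add i1 (i2.const_mul _), integral_const_mul, he₁ u hu,
      he₂ u hu]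
    push_cast
    ring
  obtain ⟨K, hK, hKa⟩ := exists_norm_arch_sub_le α h.β_pos
  have hev : ∀ᶠ σ : ℝ in 𝓝[>] 0, 0 < σ ∧ σ ≤ 1 :=
    Eventually.and self_mem_nhdsWithin (Eventually.filter_mono nhdsWithin_le_nhds
      (eventually_le_nhds (by norm_num)))
  have hlim1 : Tendsto (fun σ : ℝ => ∫ t : ℝ, arch α β (σ + t * I) * (g t : ℂ)) (𝓝[>] 0)
      (𝓝 (∫ t : ℝ, arch α β (((0 : ℝ) : ℂ) + t * I) * (g t : ℂ))) := by
    refine tendsto_integral_filter_of_dominated_convergence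
      (fun t => ‖arch α β (((0 : ℝ) : ℂ) + t * I) * (g t : ℂ)‖ + K * ‖(1 : ℂ) * (g t : ℂ)‖) ?_ ?_ ?_ ?_
    · filter_upwards [hev] with σ hσ using (harch hσ.1.le).aestronglyMeasurable
    · filter_upwards [hev] with σ hσ
      refine ae_of_all _ fun t => ?_
      rw [norm_mul, norm_mul, one_mul, ← add_mul]
      gcongr
      have h1 := hKa (σ + t * I) (((0 : ℝ) : ℂ) + t * I) (by simpa using hσ.1.le) (by simp)
      have h2 : ((σ : ℂ) + t * I) - (((0 : ℝ) : ℂ) + t * I) = σ := by push_cast; ring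
      rw [h2, Complex.norm_real, Real.norm_eq_abs, abs_of_pos hσ.1] at h1
      have h3 := norm_sub_norm_le (arch α β (σ + t * I)) (arch α β (((0 : ℝ) : ℂ) + t * I))
      nlinarith
    · exact (harch le_rfl).norm.add ((h_intg (φ := fun _ => 1) continuous_const).norm.const_mul K)
    · refine ae_of_all _ fun t => Tendsto.mul_const _ ?_
      rw [tendsto_iff_norm_sub_tendsto_zero]
      have h0 : Tendsto (fun σ : ℝ => K * σ) (𝓝[>] 0) (𝓝 0) := by
        have : Continuous fun σ : ℝ => K * σ := by fun_prop
        simpa using (this.tendsto 0).mono_left nhdsWithin_le_nhds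
      refine squeeze_zero' (Eventually.of_forall fun _ => norm_nonneg _) ?_ h0
      filter_upwards [hev] with σ hσ
      have h1 := hKa (σ + t * I) (((0 : ℝ) : ℂ) + t * I) (by simpa using hσ.1.le) (by simp)
      have h2 : ((σ : ℂ) + t * I) - (((0 : ℝ) : ℂ) + t * I) = σ := by push_cast; ring
      rwa [h2, Complex.norm_real, Real.norm_eq_abs, abs_of_pos hσ.1] at h1
  have hfm := h.measurable
  have hlim2 : Tendsto (fun σ : ℝ =>
      ∫ u in Set.Ioi 0, f u * rexp (-(σ * u)) * (h₁ u + σ * h₂ u)) (𝓝[>] 0)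
      (𝓝 (∫ u in Set.Ioi 0, f u * h₁ u)) := by
    refine tendsto_integral_filter_of_dominated_convergence
      (fun u => 2 * C * ‖f u / (1 + u) ^ 2‖) ?_ ?_ (hfsq.norm.const_mul _) ?_
    · refine Eventually.of_forall fun σ => ?_
      exact (by fun_prop : Measurable fun u => f u * rexp (-(σ * u)) * (h₁ u + σ * h₂ u)).aestronglyMeasurable
    · filter_upwards [hev] with σ hσ
      refine (ae_restrict_mem measurableSet_Ioi).mono fun u hu => ?_
      have hu : (0 : ℝ) < u := hu
      have h1 : rexp (-(σ * u)) ≤ 1 := Real.exp_le_one_iff.2 (by nlinarith [hσ.1])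
      have h2 : |h₁ u + σ * h₂ u| ≤ 2 * (C / (1 + u) ^ 2) := by
        refine (abs_add_le _ _).trans ?_
        rw [abs_mul, abs_of_pos hσ.1]
        have := hC₁ u hu
        have := hC₂ u hu
        have := abs_nonneg (h₂ u)
        nlinarith [hσ.2]
      rw [Real.norm_eq_abs, Real.norm_eq_abs, abs_mul, abs_mul, abs_div, abs_of_pos (Real.exp_pos _),
        abs_of_pos (by positivity : (0 : ℝ) < (1 + u) ^ 2)]
      calc _ ≤ |f u| * 1 * (2 * (C / (1 + u) ^ 2)) := by gcongr
        _ = _ := by ring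
    · refine ae_of_all _ fun u => ?_
      have : Continuous fun σ : ℝ => f u * rexp (-(σ * u)) * (h₁ u + σ * h₂ u) := by fun_prop
      simpa using (this.tendsto 0).mono_left (nhdsWithin_le_nhds (s := Set.Ioi 0))
  have hlim := hlim1.sub (((Complex.continuous_ofReal.tendsto _).comp hlim2).const_mul 2)
  have hlim' := hlim.congr' (f₂ := fun σ : ℝ => ∫ t : ℝ, logDeriv Ξ (σ + t * I) * (g t : ℂ))
    (hev.mono fun σ hσ => (hfub σ hσ.1).symm)
  have heq := tendsto_nhds_unique
    (tendsto_integral_logDeriv h.logDeriv_neg hh hTR hh0 hfac hg heven hsupp) hlim'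
  have hre := congrArg Complex.re heq
  rw [ofReal_re, sub_re, ← RCLike.re_eq_complex_re, ← integral_re (harch le_rfl)] at hre
  rw [hre]
  congr 1
  · refine integral_congr_ae (ae_of_all _ fun t => ?_)
    simp
  · simp only [RCLike.re_eq_complex_re]
    rw [← ofReal_ofNat, ← ofReal_mul, ofReal_re]

end LittlewoodOscillation

namespace LittlewoodOscillation

open MeasureTheory Topology

/-- The even test function `2 Re (e^{iwt} / (1/2 + it))`, truncated by `tent T`. -/
noncomputable def waveTest (T w t : ℝ) : ℝ :=
  tent T t * ((Real.cos (w * t) + 2 * t * Real.sin (w * t)) / (1 / 4 + t ^ 2))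

lemma half_add_mul_I_ne_zero (t : ℝ) : (1 / 2 + t * I : ℂ) ≠ 0 := fun h => by
  have := congrArg Complex.re h
  norm_num at this

lemma half_sub_mul_I_ne_zero (t : ℝ) : (1 / 2 - t * I : ℂ) ≠ 0 := fun h => by
  have := congrArg Complex.re h
  norm_num at this

lemma ofReal_waveTest (T w t : ℝ) : (waveTest T w t : ℂ) =
    tent T t * (cexp (w * t * I) / (1 / 2 + t * I) + cexp (-(w * t * I)) / (1 / 2 - t * I)) := by
  have h1 := half_add_mul_I_ne_zero t
  have h2 := half_sub_mul_I_ne_zero t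
  have h3 : ((1 / 4 + t ^ 2 : ℝ) : ℂ) = (1 / 2 + t * I) * (1 / 2 - t * I) := by
    push_cast
    linear_combination ((t : ℂ) ^ 2) * I_sq
  have e1 : cexp (w * t * I) = Complex.cos (w * t) + Complex.sin (w * t) * I := Complex.exp_mul_I _
  have e2 : cexp (-(w * t * I)) = Complex.cos (w * t) - Complex.sin (w * t) * I := by
    rw [← neg_mul, Complex.exp_mul_I, Complex.cos_neg, Complex.sin_neg]; ring
  rw [waveTest, ofReal_mul, ofReal_div, h3, e1, e2, div_add_div _ _ h1 h2]
  congr 2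
  push_cast
  linear_combination (2 * (t : ℂ) * Complex.sin (w * t)) * I_sq

lemma waveTest_eq_re (T w t : ℝ) :
    waveTest T w t = 2 * (tent T t * (cexp (w * t * I) / (1 / 2 + t * I))).re := by
  have h := congrArg Complex.re (ofReal_waveTest T w t)
  rw [ofReal_re] at h
  have hc : cexp (-(w * t * I)) / (1 / 2 - t * I) =
      (starRingEnd ℂ) (cexp (w * t * I) / (1 / 2 + t * I)) := by
    rw [map_div₀, ← Complex.exp_conj]
    simp [sub_eq_add_neg, map_ofNat]
  rw [h, hc, re_ofReal_mul, re_ofReal_mul, add_re, conj_re]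
  ring

lemma waveTest_neg (T w t : ℝ) : waveTest T w (-t) = waveTest T w t := by
  simp [waveTest, tent_neg]

@[fun_prop]
lemma continuous_waveTest (T w : ℝ) : Continuous (waveTest T w) := by
  have h : ∀ t : ℝ, (1 / 4 + t ^ 2 : ℝ) ≠ 0 := fun t => by positivity
  unfold waveTest
  fun_prop (disch := exact h _)

lemma waveTest_eq_zero {T : ℝ} (hT : 0 < T) (w : ℝ) {t : ℝ} (ht : T ≤ |t|) :
    waveTest T w t = 0 := by rw [waveTest, tent_eq_zero hT ht, zero_mul]

lemma integrable_tent_mul' {T : ℝ} (hT : 0 < T) {φ : ℝ → ℂ} (hφ : Continuous φ) :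
    Integrable fun t : ℝ => (tent T t : ℂ) * φ t := by
  simpa only [Complex.real_smul] using integrable_tent_mul hT hφ

lemma continuous_div_half_add {φ : ℝ → ℂ} (hφ : Continuous φ) :
    Continuous fun t : ℝ => φ t / (1 / 2 + t * I) :=
  hφ.div (by fun_prop) half_add_mul_I_ne_zero

lemma continuous_div_half_sub {φ : ℝ → ℂ} (hφ : Continuous φ) :
    Continuous fun t : ℝ => φ t / (1 / 2 - t * I) :=
  hφ.div (by fun_prop) half_sub_mul_I_ne_zero

lemma integral_waveTest_mul_cexp {T : ℝ} (hT : 0 < T) (w u : ℝ) :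
    ∫ t : ℝ, (waveTest T w t : ℂ) * cexp (-(t * u * I)) =
      ((expFejer T (w - u) + expFejer T (u + w) : ℝ) : ℂ) := by
  have h1 := integral_tent_mul_cexp_div' hT (u - w)
  have h2 := integral_tent_mul_cexp_div hT (u + w)
  rw [neg_sub] at h1
  rw [ofReal_add, ← h1, ← h2, ← integral_add]
  · refine integral_congr_ae (ae_of_all _ fun t => ?_)
    simp only [ofReal_waveTest]
    have e1 : cexp (-(t * ((u - w : ℝ) : ℂ) * I)) = cexp (w * t * I) * cexp (-(t * u * I)) := by
      rw [← Complex.exp_add]; push_cast; ring_nf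
    have e2 : cexp (-(t * ((u + w : ℝ) : ℂ) * I)) = cexp (-(w * t * I)) * cexp (-(t * u * I)) := by
      rw [← Complex.exp_add]; push_cast; ring_nf
    rw [e1, e2]
    ring
  · exact integrable_tent_mul' hT (continuous_div_half_add (by fun_prop))
  · exact integrable_tent_mul' hT (continuous_div_half_sub (by fun_prop))

lemma integral_mul_waveTest_mul_cexp {T : ℝ} (hT : 0 < T) (w u : ℝ) :
    ∫ t : ℝ, (1 / 2 + t * I) * (waveTest T w t : ℂ) * cexp (-(t * u * I)) =
      ((fejer T (u - w) - fejer T (u + w) + expFejer T (u + w) : ℝ) : ℂ) := by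
  have h1 := integral_tent_mul_cexp hT (u - w)
  have h2 := integral_tent_mul_cexp hT (u + w)
  have h3 := integral_tent_mul_cexp_div hT (u + w)
  have i1 : Integrable fun t : ℝ => (tent T t : ℂ) * cexp (-(t * ((u - w : ℝ) : ℂ) * I)) :=
    integrable_tent_mul' hT (by fun_prop)
  have i2 : Integrable fun t : ℝ => (tent T t : ℂ) * cexp (-(t * ((u + w : ℝ) : ℂ) * I)) :=
    integrable_tent_mul' hT (by fun_prop)
  have i3 : Integrable fun t : ℝ =>
      (tent T t : ℂ) * (cexp (-(t * ((u + w : ℝ) : ℂ) * I)) / (1 / 2 - t * I)) :=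
    integrable_tent_mul' hT (continuous_div_half_sub (by fun_prop))
  have i12 : Integrable fun t : ℝ => (tent T t : ℂ) * cexp (-(t * ((u - w : ℝ) : ℂ) * I)) -
      (tent T t : ℂ) * cexp (-(t * ((u + w : ℝ) : ℂ) * I)) := i1.sub i2
  rw [ofReal_add, ofReal_sub, ← h1, ← h2, ← h3, ← integral_sub i1 i2, ← integral_add i12 i3]
  refine integral_congr_ae (ae_of_all _ fun t => ?_)
  simp only [ofReal_waveTest]
  have e1 : cexp (-(t * ((u - w : ℝ) : ℂ) * I)) = cexp (w * t * I) * cexp (-(t * u * I)) := by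
    rw [← Complex.exp_add]; push_cast; ring_nf
  have e2 : cexp (-(t * ((u + w : ℝ) : ℂ) * I)) = cexp (-(w * t * I)) * cexp (-(t * u * I)) := by
    rw [← Complex.exp_add]; push_cast; ring_nf
  rw [e1, e2]
  have h4 := half_add_mul_I_ne_zero t
  have h5 := half_sub_mul_I_ne_zero t
  have h6 : (1 / 2 + t * I : ℂ) = 1 - (1 / 2 - t * I) := by ring
  rw [h6] at h4 ⊢
  generalize (1 / 2 - t * I : ℂ) = b at *
  field_simp
  ring

lemma measurable_expFejer {T : ℝ} (hT : 0 < T) : Measurable (expFejer T) := by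
  have hc := continuous_fejer hT
  have : Continuous (Function.uncurry fun v x : ℝ => rexp (-x / 2) * fejer T (v - x)) := by
    unfold Function.uncurry
    fun_prop
  exact (this.stronglyMeasurable.integral_prod_right
    (ν := volume.restrict (Set.Ioi 0))).measurable

lemma one_add_sq_le (w : ℝ) {u : ℝ} (hw : 0 ≤ w) (hu : 0 < u) :
    (1 + u) ^ 2 ≤ 2 * (1 + w) ^ 2 * (1 + (u - w) ^ 2) := by
  have h1 : 1 + u ≤ (1 + w) * (1 + |u - w|) := by
    have := le_abs_self (u - w)
    nlinarith [abs_nonneg (u - w)]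
  have h2 : (1 + |u - w|) ^ 2 ≤ 2 * (1 + (u - w) ^ 2) := by
    rw [← sq_abs (u - w)]; nlinarith [sq_nonneg (1 - |u - w|)]
  calc (1 + u) ^ 2 ≤ ((1 + w) * (1 + |u - w|)) ^ 2 := by gcongr
    _ = (1 + w) ^ 2 * (1 + |u - w|) ^ 2 := by ring
    _ ≤ (1 + w) ^ 2 * (2 * (1 + (u - w) ^ 2)) := by gcongr
    _ = _ := by ring

lemma fejer_le_of_one_le {T : ℝ} (hT : 1 ≤ T) (v : ℝ) : fejer T v ≤ 8 * T / (1 + v ^ 2) := by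
  have hT0 : 0 < T := by linarith
  refine (fejer_le hT0 v).trans ?_
  rw [mul_div_assoc]
  refine mul_le_mul_of_nonneg_left (div_le_div_of_nonneg_left hT0.le (by positivity) ?_) (by norm_num)
  nlinarith [mul_nonneg (sub_nonneg.2 hT) (sq_nonneg v), sq_nonneg v]

lemma fejer_le_div_sq {T : ℝ} (hT : 1 ≤ T) {v : ℝ} (hv : 0 < v) : fejer T v ≤ 8 / v ^ 2 := by
  have hT0 : 0 < T := by linarith
  refine (fejer_le hT0 v).trans ?_
  rw [← mul_div_assoc, div_le_div_iff₀ (by positivity) (by positivity)]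
  nlinarith [mul_nonneg (mul_nonneg (sub_nonneg.2 hT) hT0.le) (sq_nonneg v), sq_nonneg v]

lemma half_lt_log_two : 1 / 2 < Real.log 2 := by have := Real.log_two_gt_d9; linarith

lemma abs_integral_mul_le {f k : ℝ → ℝ} {C : ℝ}
    (hf : IntegrableOn (fun u => f u / (1 + u) ^ 2) (Set.Ioi 0))
    (hf0 : ∀ u, u < Real.log 2 → f u = 0)
    (hk : ∀ u, Real.log 2 ≤ u → |k u| ≤ C / (1 + u) ^ 2) :
    |∫ u in Set.Ioi 0, f u * k u| ≤ C * ∫ u in Set.Ioi 0, |f u / (1 + u) ^ 2| := by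
  rw [← integral_const_mul, ← Real.norm_eq_abs]
  refine norm_integral_le_of_norm_le (hf.abs.const_mul C) ?_
  refine (ae_restrict_mem measurableSet_Ioi).mono fun u hu => ?_
  have hu : (0 : ℝ) < u := hu
  rcases lt_or_ge u (Real.log 2) with h | h
  · simp [hf0 u h]
  · rw [Real.norm_eq_abs, abs_mul, abs_div, abs_of_pos (by positivity : (0 : ℝ) < (1 + u) ^ 2)]
    calc _ ≤ |f u| * (C / (1 + u) ^ 2) := by gcongr; exact hk u h
      _ = _ := by ring

lemma integrableOn_mul_of_le {f k : ℝ → ℝ} {C : ℝ} (hfm : Measurable f) (hkm : Measurable k)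
    (hf : IntegrableOn (fun u => f u / (1 + u) ^ 2) (Set.Ioi 0))
    (hk : ∀ u, 0 < u → |k u| ≤ C / (1 + u) ^ 2) :
    IntegrableOn (fun u => f u * k u) (Set.Ioi 0) := by
  refine (hf.abs.const_mul C).mono' (hfm.mul hkm).aestronglyMeasurable ?_
  refine (ae_restrict_mem measurableSet_Ioi).mono fun u hu => ?_
  have hu : (0 : ℝ) < u := hu
  rw [Real.norm_eq_abs, abs_mul, abs_div, abs_of_pos (by positivity : (0 : ℝ) < (1 + u) ^ 2)]
  calc _ ≤ |f u| * (C / (1 + u) ^ 2) := by gcongr; exact hk u hu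
    _ = _ := by ring

lemma abs_fejer_sub_le {T : ℝ} (hT : 1 ≤ T) {w u : ℝ} (hw : 0 ≤ w) (hu : 0 < u) :
    |fejer T (u - w)| ≤ 8 * T * (2 * (1 + w) ^ 2) / (1 + u) ^ 2 := by
  rw [abs_of_nonneg (fejer_nonneg (by linarith) _)]
  refine (fejer_le_of_one_le hT _).trans ?_
  rw [div_le_div_iff₀ (by positivity) (by positivity)]
  nlinarith [mul_le_mul_of_nonneg_left (one_add_sq_le w hw hu) (by linarith : 0 ≤ 8 * T)]

lemma expFejer_sub_le {T : ℝ} (hT : 1 ≤ T) {w u : ℝ} (hw : 0 ≤ w) (hu : 0 < u) :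
    expFejer T (w - u) ≤ 528 * (π + 4) * (2 * (1 + w) ^ 2) / (1 + u) ^ 2 := by
  refine (expFejer_le hT _).trans ?_
  rw [div_le_div_iff₀ (by positivity) (by positivity)]
  have := mul_le_mul_of_nonneg_left (one_add_sq_le w hw hu) (by positivity : 0 ≤ 528 * (π + 4))
  have e : (w - u) ^ 2 = (u - w) ^ 2 := by ring
  rw [e]
  linarith

lemma expFejer_add_le {T : ℝ} (hT : 1 ≤ T) {w u : ℝ} (hw : 0 ≤ w) (hu : 0 < u) :
    expFejer T (u + w) ≤ 1056 * (π + 4) / (1 + u) ^ 2 := by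
  refine (expFejer_le hT _).trans ?_
  rw [div_le_div_iff₀ (by positivity) (by positivity)]
  have h : (1 + u) ^ 2 ≤ 2 * (1 + (u + w) ^ 2) := by
    nlinarith [sq_nonneg (1 - u), mul_nonneg hu.le hw, sq_nonneg w]
  have := mul_le_mul_of_nonneg_left h (by positivity : 0 ≤ 528 * (π + 4))
  linarith

variable {f : ℝ → ℝ} {D Ξ : ℂ → ℂ} {α β M : ℝ}

/-- The explicit formula for the test functions `waveTest T w`, with a uniformly bounded error. -/
lemma LData.exists_explicit_waveTest (h : LData f D Ξ α β) (hM : 0 ≤ M)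
    (hf : ∀ u, 0 < u → -(M * (1 + √u)) ≤ f u) :
    ∃ C, 0 ≤ C ∧ ∀ R, ∃ (Z : Finset ℝ) (m : ℝ → ℕ), (∀ γ ∈ Z, 1 ≤ m γ) ∧
      ∀ T, 1 ≤ T → T < R → ∀ w, 0 ≤ w →
        IntegrableOn (fun u => f u * fejer T (u - w)) (Set.Ioi 0) ∧
        |π * (∑ γ ∈ Z, m γ * waveTest T w γ) -
          (∫ t : ℝ, (arch α β (t * I)).re * waveTest T w t) +
          2 * ∫ u in Set.Ioi 0, f u * fejer T (u - w)| ≤ C ∧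
        (w ≤ 1 / 4 → |∫ u in Set.Ioi 0, f u * fejer T (u - w)| ≤ C) := by
  obtain ⟨-, hfsq, hz, -⟩ := h.consequences hM hf
  set I₀ := ∫ u in Set.Ioi 0, |f u / (1 + u) ^ 2| with hI₀
  have hI₀0 : 0 ≤ I₀ := integral_nonneg fun _ => abs_nonneg _
  refine ⟨2 * ((288 + 1056 * (π + 4)) * I₀), by positivity, fun R => ?_⟩
  obtain ⟨Z, m, h₀, hh, hm1, hh0, hfac⟩ := exists_factorization h.differentiable_Ξ hz R
  refine ⟨Z, m, hm1, fun T hT hTR w hw => ?_⟩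
  have hT0 : 0 < T := by linarith
  have hmF := (continuous_fejer hT0).measurable
  have hmE := measurable_expFejer hT0
  have hsqF : ∀ u, Real.log 2 ≤ u → fejer T (u + w) ≤ 72 / (1 + u) ^ 2 := fun u hu => by
    have hu2 := half_lt_log_two.trans_le hu
    refine (fejer_le_div_sq hT (by linarith)).trans ?_
    rw [div_le_div_iff₀ (by nlinarith) (by nlinarith)]
    nlinarith [mul_nonneg (by linarith : 0 ≤ u) hw]
  have hi1 : IntegrableOn (fun u => f u * fejer T (u - w)) (Set.Ioi 0) :=
    integrableOn_mul_of_le h.measurable (by fun_prop) hfsq fun u hu => abs_fejer_sub_le hT hw hu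
  have hC₁ : ∀ u, 0 < u → |fejer T (u - w) - fejer T (u + w) + expFejer T (u + w)| ≤
      (16 * T * (1 + w) ^ 2 + 16 * T + 1056 * (π + 4) * (1 + w) ^ 2 + 1056 * (π + 4)) /
        (1 + u) ^ 2 := by
    intro u hu
    have h1 := abs_fejer_sub_le hT hw hu
    have h2 : |fejer T (u + w)| ≤ 16 * T / (1 + u) ^ 2 := by
      rw [abs_of_nonneg (fejer_nonneg hT0 _)]
      refine (fejer_le_of_one_le hT _).trans ?_
      rw [div_le_div_iff₀ (by positivity) (by positivity)]
      have h : (1 + u) ^ 2 ≤ 2 * (1 + (u + w) ^ 2) := by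
        nlinarith [sq_nonneg (1 - u), mul_nonneg hu.le hw, sq_nonneg w]
      have := mul_le_mul_of_nonneg_left h (by positivity : 0 ≤ 8 * T)
      linarith
    have h3 : |expFejer T (u + w)| ≤ 1056 * (π + 4) / (1 + u) ^ 2 := by
      rw [abs_of_nonneg (expFejer_nonneg hT0 _)]
      exact expFejer_add_le hT hw hu
    calc _ ≤ |fejer T (u - w)| + |fejer T (u + w)| + |expFejer T (u + w)| :=
          (abs_add_le _ _).trans (add_le_add (abs_sub _ _) le_rfl)
      _ ≤ 8 * T * (2 * (1 + w) ^ 2) / (1 + u) ^ 2 + 16 * T / (1 + u) ^ 2 +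
          1056 * (π + 4) / (1 + u) ^ 2 := by gcongr
      _ ≤ _ := by
        rw [← add_div, ← add_div]
        refine div_le_div_of_nonneg_right ?_ (by positivity)
        have : 0 ≤ 1056 * (π + 4) * (1 + w) ^ 2 := by positivity
        linarith
  have hC₂ : ∀ u, 0 < u → |expFejer T (w - u) + expFejer T (u + w)| ≤
      (16 * T * (1 + w) ^ 2 + 16 * T + 1056 * (π + 4) * (1 + w) ^ 2 + 1056 * (π + 4)) /
        (1 + u) ^ 2 := by
    intro u hu
    rw [abs_of_nonneg (add_nonneg (expFejer_nonneg hT0 _) (expFejer_nonneg hT0 _))]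
    refine (add_le_add (expFejer_sub_le hT hw hu) (expFejer_add_le hT hw hu)).trans ?_
    rw [← add_div]
    refine div_le_div_of_nonneg_right ?_ (by positivity)
    have : 0 ≤ 16 * T * (1 + w) ^ 2 + 16 * T := by positivity
    linarith
  have hef := h.explicit_formula hM hf hh hTR hh0 hfac (continuous_waveTest T w)
    (waveTest_neg T w) (fun t ht => waveTest_eq_zero hT0 w ht)
    (h₁ := fun u => fejer T (u - w) - fejer T (u + w) + expFejer T (u + w))
    (h₂ := fun u => expFejer T (w - u) + expFejer T (u + w)) (by fun_prop) (by fun_prop)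
    (fun u _ => integral_mul_waveTest_mul_cexp hT0 w u)
    (fun u _ => integral_waveTest_mul_cexp hT0 w u) hC₁ hC₂
  have hi2 : IntegrableOn (fun u => f u * (fejer T (u - w) - fejer T (u + w) +
      expFejer T (u + w))) (Set.Ioi 0) :=
    integrableOn_mul_of_le h.measurable (by fun_prop) hfsq hC₁
  refine ⟨hi1, ?_, fun hw4 => ?_⟩
  · have hb := abs_integral_mul_le (k := fun u => expFejer T (u + w) - fejer T (u + w)) hfsq
      h.eq_zero_of_lt (C := 72 + 1056 * (π + 4)) fun u hu => by
        have hu0 : 0 < u := by have := half_lt_log_two; linarith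
        have h1 := hsqF u hu
        have h2 := expFejer_add_le hT hw hu0
        have h3 := fejer_nonneg hT0 (u + w)
        have h4 := expFejer_nonneg hT0 (u + w)
        rw [add_div, abs_le]
        have : 0 ≤ 72 / (1 + u) ^ 2 := by positivity
        have : 0 ≤ 1056 * (π + 4) / (1 + u) ^ 2 := by positivity
        constructor <;> linarith
    have e : ∫ u in Set.Ioi 0, f u * (expFejer T (u + w) - fejer T (u + w)) =
        (∫ u in Set.Ioi 0, f u * (fejer T (u - w) - fejer T (u + w) + expFejer T (u + w))) -
        ∫ u in Set.Ioi 0, f u * fejer T (u - w) := by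
      rw [← integral_sub hi2 hi1]
      congr 1; ext u; ring
    rw [e] at hb
    rw [hef]
    have e2 : ∀ a b c : ℝ, a - 2 * b - a + 2 * c = -(2 * (b - c)) := fun a b c => by ring
    rw [e2, abs_neg, abs_mul, abs_of_pos (by norm_num : (0 : ℝ) < 2)]
    have : (72 + 1056 * (π + 4)) * I₀ ≤ (288 + 1056 * (π + 4)) * I₀ := by gcongr; norm_num
    linarith
  · have hb := abs_integral_mul_le (k := fun u => fejer T (u - w)) hfsq
      h.eq_zero_of_lt (C := 288) fun u hu => by
        have hu2 := half_lt_log_two.trans_le hu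
        rw [abs_of_nonneg (fejer_nonneg hT0 _)]
        refine (fejer_le_div_sq hT (by linarith)).trans ?_
        rw [div_le_div_iff₀ (by nlinarith) (by nlinarith)]
        nlinarith
    refine hb.trans ?_
    have h1 : 0 ≤ 1056 * (π + 4) * I₀ := by positivity
    have h2 : 0 ≤ 288 * I₀ := by positivity
    rw [← hI₀]
    linarith

end LittlewoodOscillation

namespace LittlewoodOscillation

open MeasureTheory Topology

lemma sq_mul_le_mul_sin {w t : ℝ} (hw : 0 ≤ w) (h : |w * t| ≤ 1) :
    w * t ^ 2 ≤ 2 * t * Real.sin (w * t) := by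
  wlog ht : 0 ≤ t generalizing t
  · have := this (t := -t) (by simpa using h) (by linarith)
    simpa using this
  have h0 : 0 ≤ w * t := mul_nonneg hw ht
  rw [abs_of_nonneg h0] at h
  have h1 := Real.mul_le_sin h0 (h.trans (by have := Real.pi_gt_three; linarith))
  have h2 : 1 / 2 * (w * t) ≤ 2 / π * (w * t) := by
    refine mul_le_mul_of_nonneg_right ?_ h0
    rw [div_le_div_iff₀ two_pos Real.pi_pos]
    linarith [Real.pi_le_four]
  nlinarith [mul_le_mul_of_nonneg_left (h2.trans h1) ht]

lemma half_le_cos {x : ℝ} (h : |x| ≤ 1) : 1 / 2 ≤ Real.cos x := by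
  have := Real.one_sub_sq_div_two_le_cos (x := x)
  have h2 : x ^ 2 ≤ 1 := by rw [← sq_abs]; nlinarith [abs_nonneg x]
  linarith

lemma waveTest_nonneg {T w : ℝ} (hT : 0 < T) (hw : 0 ≤ w) (hwT : w * T ≤ 1) (t : ℝ) :
    0 ≤ waveTest T w t := by
  rcases le_or_gt T |t| with h | h
  · rw [waveTest_eq_zero hT w h]
  · have h1 : |w * t| ≤ 1 := by
      rw [abs_mul, abs_of_nonneg hw]
      exact (mul_le_mul_of_nonneg_left h.le hw).trans hwT
    have h2 := half_le_cos h1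
    have h3 := sq_mul_le_mul_sin hw h1
    have h4 : 0 ≤ w * t ^ 2 := by positivity
    exact mul_nonneg (tent_nonneg _ _) (div_nonneg (by linarith) (by positivity))

lemma le_waveTest_of_abs_le {T w t : ℝ} (hT : 0 < T) (hw : 0 ≤ w) (hw1 : w ≤ 1)
    (hwT : w * T ≤ 1) (h : |t| ≤ T / 2) : w / 2 ≤ waveTest T w t := by
  have h1 : |w * t| ≤ 1 := by
    rw [abs_mul, abs_of_nonneg hw]
    exact (mul_le_mul_of_nonneg_left (h.trans (half_le_self hT.le)) hw).trans hwT
  have h2 := half_le_cos h1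
  have h3 := sq_mul_le_mul_sin hw h1
  have h5 := tent_ge_half hT h
  have h6 : w ≤ (Real.cos (w * t) + 2 * t * Real.sin (w * t)) / (1 / 4 + t ^ 2) := by
    rw [le_div_iff₀ (by positivity)]
    nlinarith
  calc w / 2 = 1 / 2 * w := by ring
    _ ≤ _ := mul_le_mul h5 h6 hw (tent_nonneg _ _)

lemma abs_waveTest_add_sub_le {T : ℝ} (hT : 0 < T) (v w t : ℝ) :
    |waveTest T (v + w) t - waveTest T w t| ≤ 4 * ‖cexp (I * ((t * v : ℝ) : ℂ)) - 1‖ := by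
  have e : waveTest T (v + w) t - waveTest T w t =
      2 * ((tent T t : ℂ) * (cexp (w * t * I) / (1 / 2 + t * I) *
        (cexp (I * ((t * v : ℝ) : ℂ)) - 1))).re := by
    rw [waveTest_eq_re, waveTest_eq_re, ← mul_sub, ← sub_re]
    congr 2
    have : cexp (((v + w : ℝ) : ℂ) * t * I) = cexp (w * t * I) * cexp (I * ((t * v : ℝ) : ℂ)) := by
      rw [← Complex.exp_add]; push_cast; ring_nf
    rw [this]
    ring
  have h1 : ‖cexp (w * t * I) / (1 / 2 + t * I)‖ ≤ 2 := by
    have : ‖cexp (w * t * I)‖ = 1 := by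
      rw [← ofReal_mul, Complex.norm_exp_ofReal_mul_I]
    rw [norm_div, this]
    have h2 : (1 / 2 : ℝ) ≤ ‖(1 / 2 + t * I : ℂ)‖ := by
      have := Complex.re_le_norm (1 / 2 + t * I : ℂ)
      norm_num at this ⊢
      exact this
    rw [div_le_iff₀ (by linarith)]
    linarith
  rw [e, abs_mul, abs_two]
  have h3 := Complex.abs_re_le_norm ((tent T t : ℂ) * (cexp (w * t * I) / (1 / 2 + t * I) *
        (cexp (I * ((t * v : ℝ) : ℂ)) - 1)))
  rw [norm_mul, norm_mul, Complex.norm_real, Real.norm_eq_abs, abs_of_nonneg (tent_nonneg _ _)] at h3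
  have h4 : tent T t * (‖cexp (w * t * I) / (1 / 2 + t * I)‖ * ‖cexp (I * ((t * v : ℝ) : ℂ)) - 1‖) ≤
      1 * (2 * ‖cexp (I * ((t * v : ℝ) : ℂ)) - 1‖) := by
    gcongr
    exact tent_le_one hT t
  linarith

lemma integrable_mul_waveTest {φ : ℝ → ℝ} (hφ : Continuous φ) {T : ℝ} (hT : 0 < T) (w : ℝ) :
    Integrable fun t => φ t * waveTest T w t := by
  refine (hφ.mul (continuous_waveTest T w)).integrable_of_hasCompactSupport ?_
  refine HasCompactSupport.of_support_subset_isCompact (isCompact_Icc (a := -T) (b := T)) ?_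
  intro t ht
  by_contra h
  refine ht ?_
  rw [Pi.mul_apply, waveTest_eq_zero hT, mul_zero]
  by_contra h2
  exact h (abs_le.1 (not_le.1 h2).le)

lemma integral_waveTest_le {T w : ℝ} (hT : 1 ≤ T) :
    ∫ t, waveTest T w t ≤ 1056 * (π + 4) := by
  have hT0 : 0 < T := by linarith
  have h := integral_waveTest_mul_cexp hT0 w 0
  have e : ∀ t : ℝ, (waveTest T w t : ℂ) * cexp (-(t * ((0 : ℝ) : ℂ) * I)) =
      (waveTest T w t : ℂ) := fun t => by simp
  simp_rw [e] at h
  rw [integral_complex_ofReal, ofReal_inj] at h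
  rw [h]
  have h1 : ∀ v, expFejer T v ≤ 528 * (π + 4) := fun v => by
    refine (expFejer_le hT v).trans (div_le_self (by positivity) ?_)
    nlinarith [sq_nonneg v]
  linarith [h1 (w - 0), h1 (0 + w)]

lemma exists_arch_bounds (α : ℝ) {β : ℝ} (hβ : 0 < β) : ∃ C, 0 ≤ C ∧
    (∀ t : ℝ, |(arch α β (t * I)).re| ≤ C * (1 + |t|)) ∧
    (∀ t s : ℝ, |(arch α β (t * I)).re - (arch α β (s * I)).re| ≤ C * |t - s|) ∧
    (∀ t : ℝ, -C ≤ (arch α β (t * I)).re) ∧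
    (∀ t : ℝ, 2 ≤ t → Real.log t - C ≤ (arch α β (t * I)).re) := by
  obtain ⟨K, hK, h⟩ := exists_norm_arch_sub_le α hβ
  have hlip : ∀ t s : ℝ, |(arch α β (t * I)).re - (arch α β (s * I)).re| ≤ K * |t - s| := by
    intro t s
    rw [← sub_re]
    refine (abs_re_le_norm _).trans ((h _ _ (by simp) (by simp)).trans (le_of_eq ?_))
    rw [← sub_mul, norm_mul, Complex.norm_I, mul_one, ← ofReal_sub, Complex.norm_real,
      Real.norm_eq_abs]
  have hlog : ∀ t : ℝ, 2 ≤ |t| → α + Real.log |t| - Real.log 2 - 3 ≤ (arch α β (t * I)).re := by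
    intro t ht
    have h1 := log_sub_le_re_digamma (z := β + t * I / 2) (by simpa using hβ) (by
      have : ((β : ℂ) + t * I / 2).im = t / 2 := by simp
      rw [this, abs_div, abs_two]; linarith)
    have h2 : ((β : ℂ) + t * I / 2).im = t / 2 := by simp
    rw [h2, abs_div, abs_two, Real.log_div (by linarith) two_ne_zero] at h1
    rw [arch, add_re, ofReal_re]
    linarith
  set a := |(arch α β ((0 : ℝ) * I)).re| with ha
  have ha0 : 0 ≤ a := abs_nonneg _
  refine ⟨a + 2 * K + |α| + 4, by positivity, fun t => ?_, fun t s => ?_, fun t => ?_,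
    fun t ht => ?_⟩
  · have h1 := hlip t 0
    rw [sub_zero] at h1
    have h2 := abs_sub_abs_le_abs_sub (arch α β (t * I)).re (arch α β ((0 : ℝ) * I)).re
    nlinarith [abs_nonneg t, abs_nonneg α, mul_nonneg ha0 (abs_nonneg t),
      mul_nonneg (abs_nonneg α) (abs_nonneg t), mul_nonneg hK.le (abs_nonneg t)]
  · refine (hlip t s).trans ?_
    gcongr
    linarith [abs_nonneg α]
  · rcases le_or_gt 2 |t| with ht | ht
    · have h1 := hlog t ht
      have h2 : Real.log 2 ≤ Real.log |t| := Real.log_le_log two_pos ht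
      linarith [neg_abs_le α]
    · have h1 := (abs_le.1 (hlip t 0)).1
      rw [sub_zero] at h1
      have h2 : K * |t| ≤ 2 * K := by nlinarith
      have h3 := neg_abs_le (arch α β ((0 : ℝ) * I)).re
      rw [← ha] at h3
      linarith [abs_nonneg α]
  · have h1 := hlog t (by rwa [abs_of_nonneg (by linarith)])
    rw [abs_of_nonneg (by linarith : 0 ≤ t)] at h1
    have : Real.log 2 < 1 := by have := Real.log_two_lt_d9; linarith
    linarith [neg_abs_le α]

lemma abs_tent_sub_le {T : ℝ} (hT : 1 ≤ T) (t s : ℝ) : |tent T t - tent T s| ≤ |t - s| := by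
  have hT0 : 0 < T := by linarith
  have h := abs_max_sub_max_le_max 0 (1 - |t| / T) 0 (1 - |s| / T)
  rw [sub_self, abs_zero, max_eq_right (abs_nonneg (1 - |t| / T - (1 - |s| / T)))] at h
  refine h.trans ?_
  have e : 1 - |t| / T - (1 - |s| / T) = (|s| - |t|) / T := by ring
  rw [e, abs_div, abs_of_pos hT0, div_le_iff₀ hT0, abs_sub_comm t s]
  have := abs_abs_sub_abs_le s t
  nlinarith [abs_nonneg (s - t)]

/-- A quantitative Riemann--Lebesgue lemma. -/
lemma abs_integral_mul_waveTest_le {A : ℝ → ℝ} {C : ℝ} (hC : 0 ≤ C)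
    (hA : ∀ t, |A t| ≤ C * (1 + |t|)) (hlip : ∀ t s, |A t - A s| ≤ C * |t - s|)
    {T w : ℝ} (hT : 1 ≤ T) (hw : T ≤ w) :
    |∫ t, A t * waveTest T w t| ≤ 11 * C * π * (2 + π) := by
  have hT0 : 0 < T := by linarith
  have hw0 : 0 < w := by linarith
  have hAc : Continuous A := (LipschitzWith.of_dist_le_mul (K := C.toNNReal) fun t t' => by
    rw [Real.dist_eq, Real.dist_eq, Real.coe_toNNReal _ hC]; exact hlip t t').continuous
  set φ : ℝ → ℂ := fun t => (tent T t : ℂ) * ((A t : ℂ) / (1 / 2 + t * I)) with hφ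
  have hnorm : ∀ t : ℝ, 1 / 2 ≤ ‖(1 / 2 + t * I : ℂ)‖ ∧ 1 + |t| ≤ 3 * ‖(1 / 2 + t * I : ℂ)‖ := by
    intro t
    have h1 : 1 / 2 ≤ ‖(1 / 2 + t * I : ℂ)‖ := by
      have := Complex.re_le_norm (1 / 2 + t * I : ℂ)
      norm_num at this ⊢
      exact this
    have h2 : |t| ≤ ‖(1 / 2 + t * I : ℂ)‖ := by
      have := Complex.abs_im_le_norm (1 / 2 + t * I : ℂ)
      simpa using this
    exact ⟨h1, by linarith⟩
  have hφlip : ∀ t s, ‖φ t - φ s‖ ≤ 11 * C * |t - s| := by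
    intro t s
    obtain ⟨ht1, ht2⟩ := hnorm t
    obtain ⟨hs1, hs2⟩ := hnorm s
    have hat := half_add_mul_I_ne_zero t
    have has := half_add_mul_I_ne_zero s
    have e : φ t - φ s = ((A t * (tent T t - tent T s) + (A t - A s) * tent T s : ℝ) : ℂ) /
        (1 / 2 + t * I) + ((A s * tent T s * (s - t) : ℝ) : ℂ) * I /
          ((1 / 2 + t * I) * (1 / 2 + s * I)) := by
      have hd : ((s : ℂ) - t) * I = (1 / 2 + s * I) - (1 / 2 + t * I) := by ring
      simp only [hφ]
      push_cast
      rw [mul_assoc _ _ I, hd]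
      generalize (1 / 2 + t * I : ℂ) = a at *
      generalize (1 / 2 + s * I : ℂ) = b at *
      field_simp
      ring
    have b1 : |A t * (tent T t - tent T s) + (A t - A s) * tent T s| ≤
        5 * C * |t - s| * ‖(1 / 2 + t * I : ℂ)‖ := by
      have h1 : |A t * (tent T t - tent T s)| ≤ C * (1 + |t|) * |t - s| := by
        rw [abs_mul]
        exact mul_le_mul (hA t) (abs_tent_sub_le hT t s) (abs_nonneg _) (by positivity)
      have h2 : |(A t - A s) * tent T s| ≤ C * |t - s| * 1 := by
        rw [abs_mul, abs_of_nonneg (tent_nonneg _ _)]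
        exact mul_le_mul (hlip t s) (tent_le_one hT0 s) (tent_nonneg _ _) (by positivity)
      have h3 : C * |t - s| * 1 ≤ C * |t - s| * (2 * ‖(1 / 2 + t * I : ℂ)‖) := by
        gcongr; linarith
      have h4 : C * |t - s| * (1 + |t|) ≤ C * |t - s| * (3 * ‖(1 / 2 + t * I : ℂ)‖) := by gcongr
      refine (abs_add_le _ _).trans ?_
      linarith
    have b2 : |A s * tent T s * (s - t)| ≤
        6 * C * |t - s| * (‖(1 / 2 + t * I : ℂ)‖ * ‖(1 / 2 + s * I : ℂ)‖) := by
      rw [abs_mul, abs_mul, abs_of_nonneg (tent_nonneg _ _), abs_sub_comm s t]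
      calc |A s| * tent T s * |t - s| ≤ C * (1 + |s|) * 1 * |t - s| := by
            exact mul_le_mul_of_nonneg_right (mul_le_mul (hA s) (tent_le_one hT0 s)
              (tent_nonneg _ _) (by positivity)) (abs_nonneg _)
        _ ≤ C * (3 * ‖(1 / 2 + s * I : ℂ)‖) * (2 * ‖(1 / 2 + t * I : ℂ)‖) * |t - s| := by
            gcongr
            linarith
        _ = _ := by ring
    rw [e]
    refine (norm_add_le _ _).trans ?_
    rw [norm_div, norm_div, norm_mul, norm_mul, Complex.norm_I, mul_one, Complex.norm_real,
      Complex.norm_real, Real.norm_eq_abs, Real.norm_eq_abs]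
    have c1 := (div_le_iff₀ (by linarith)).2 b1
    have c2 := (div_le_iff₀ (by nlinarith)).2 b2
    linarith
  have hφI : ∀ ψ : ℝ → ℂ, Continuous ψ → Integrable fun t => φ t * ψ t := by
    intro ψ hψ
    have := integrable_tent_mul' hT0 (continuous_div_half_add
      (((Complex.continuous_ofReal.comp hAc)).mul hψ))
    refine this.congr (ae_of_all _ fun t => ?_)
    simp only [hφ, Pi.mul_apply, Function.comp_apply]
    ring
  have h_intg := hφI (fun t => cexp (w * t * I)) (by fun_prop)
  set J := ∫ t : ℝ, φ t * cexp (w * t * I) with hJ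
  have heq : ∫ t, A t * waveTest T w t = 2 * J.re := by
    rw [hJ, ← RCLike.re_eq_complex_re, ← integral_re h_intg, ← integral_const_mul]
    refine integral_congr_ae (ae_of_all _ fun t => ?_)
    simp only [RCLike.re_eq_complex_re]
    rw [waveTest_eq_re, mul_left_comm, ← re_ofReal_mul]
    congr 2
    simp only [hφ]
    ring
  set δ := π / w with hδ
  have hδ0 : 0 < δ := div_pos Real.pi_pos hw0
  have hshift : J = -∫ t : ℝ, φ (t + δ) * cexp (w * t * I) := by
    rw [hJ, ← integral_add_right_eq_self _ δ, ← integral_neg]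
    refine integral_congr_ae (ae_of_all _ fun t => ?_)
    dsimp only
    have : (w : ℂ) * ((t + δ : ℝ) : ℂ) * I = w * t * I + π * I := by
      rw [hδ]
      have : (w : ℂ) ≠ 0 := by exact_mod_cast hw0.ne'
      push_cast
      field_simp
    rw [this, Complex.exp_add, Complex.exp_pi_mul_I]
    ring
  have h_intg' : Integrable fun t : ℝ => φ (t + δ) * cexp (w * t * I) := by
    have := (hφI (fun t => cexp (w * (t - δ : ℝ) * I)) (by fun_prop)).comp_add_right δ
    simpa using this
  have h2J : 2 * J = ∫ t : ℝ, (φ t - φ (t + δ)) * cexp (w * t * I) := by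
    simp_rw [sub_mul]
    rw [integral_sub h_intg h_intg', ← hJ]
    linear_combination hshift
  have hφ0 : ∀ t, T ≤ |t| → φ t = 0 := fun t ht => by simp [hφ, tent_eq_zero hT0 ht]
  have hbound : ‖2 * J‖ ≤ ∫ t, (Set.Icc (-T - δ) T).indicator (fun _ => 11 * C * δ) t := by
    rw [h2J]
    refine norm_integral_le_of_norm_le ?_ (ae_of_all _ fun t => ?_)
    · exact (integrable_indicator_iff measurableSet_Icc).2 (integrableOn_const (by simp))
    · rw [norm_mul, ← ofReal_mul, Complex.norm_exp_ofReal_mul_I, mul_one]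
      by_cases ht : t ∈ Set.Icc (-T - δ) T
      · rw [Set.indicator_of_mem ht]
        refine (hφlip _ _).trans (le_of_eq ?_)
        rw [sub_add_cancel_left, abs_neg, abs_of_pos hδ0]
      · rw [Set.indicator_of_notMem ht]
        rw [Set.mem_Icc, not_and_or, not_le, not_le] at ht
        rcases ht with ht | ht
        · rw [hφ0 t (by rw [le_abs]; right; linarith), hφ0 (t + δ) (by rw [le_abs]; right; linarith)]
          simp
        · rw [hφ0 t (by rw [le_abs]; left; linarith), hφ0 (t + δ) (by rw [le_abs]; left; linarith)]
          simp
  rw [integral_indicator measurableSet_Icc, setIntegral_const, smul_eq_mul, Measure.real,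
    Real.volume_Icc, ENNReal.toReal_ofReal (by linarith)] at hbound
  rw [heq]
  have hre : |2 * J.re| ≤ ‖2 * J‖ := by
    have := Complex.abs_re_le_norm (2 * J)
    simpa using this
  refine hre.trans (hbound.trans ?_)
  have h1 : δ * T ≤ π := by
    rw [hδ, div_mul_eq_mul_div, div_le_iff₀ hw0]
    gcongr
  have h2 : δ ≤ π := by nlinarith
  calc (T - (-T - δ)) * (11 * C * δ) = 11 * C * (2 * (δ * T) + δ * δ) := by ring
    _ ≤ 11 * C * (2 * π + π * π) := by gcongr
    _ = _ := by ring

end LittlewoodOscillation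

namespace LittlewoodOscillation

open MeasureTheory Topology

/-- The iterated logarithm `log log (u + 16)`. -/
noncomputable def logLog (u : ℝ) : ℝ := Real.log (Real.log (u + 16))

lemma one_le_log_add_sixteen {u : ℝ} (hu : 0 ≤ u) : 1 ≤ Real.log (u + 16) := by
  rw [Real.le_log_iff_exp_le (by linarith)]
  have := Real.exp_one_lt_d9
  linarith

lemma logLog_nonneg {u : ℝ} (hu : 0 ≤ u) : 0 ≤ logLog u :=
  Real.log_nonneg (one_le_log_add_sixteen hu)

lemma logLog_le_add {u w : ℝ} (hu : 0 ≤ u) (hw : 0 ≤ w) :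
    logLog u ≤ logLog w + 2 * √|u - w| := by
  have hw1 := one_le_log_add_sixteen hw
  have hu1 := one_le_log_add_sixteen hu
  rcases le_total u w with h | h
  · have : logLog u ≤ logLog w :=
      Real.log_le_log (by linarith) (Real.log_le_log (by linarith) (by linarith))
    linarith [Real.sqrt_nonneg |u - w|]
  · obtain ⟨v, hv, rfl⟩ : ∃ v, 0 ≤ v ∧ u = w + v := ⟨u - w, by linarith, by ring⟩
    rw [add_sub_cancel_left, abs_of_nonneg hv]
    have hl : 0 ≤ Real.log (1 + v) := Real.log_nonneg (by linarith)
    have h1 : Real.log (w + v + 16) ≤ Real.log (w + 16) * (1 + Real.log (1 + v)) := by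
      have : Real.log (w + v + 16) ≤ Real.log (w + 16) + Real.log (1 + v) := by
        rw [← Real.log_mul (by linarith) (by linarith)]
        exact Real.log_le_log (by linarith) (by nlinarith)
      nlinarith
    have h2 : logLog (w + v) ≤ logLog w + Real.log (1 + Real.log (1 + v)) := by
      rw [logLog, logLog, ← Real.log_mul (by linarith) (by linarith)]
      exact Real.log_le_log (by linarith) h1
    have h3 : Real.log (1 + Real.log (1 + v)) ≤ Real.log (1 + v) := by
      have := Real.log_le_sub_one_of_pos (show 0 < 1 + Real.log (1 + v) by linarith)
      linarith
    have h4 : Real.log (1 + v) ≤ 2 * √v := by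
      have hs := Real.sqrt_nonneg v
      have h5 : Real.log (1 + v) ≤ Real.log ((1 + √v) ^ 2) :=
        Real.log_le_log (by linarith) (by nlinarith [Real.sq_sqrt hv])
      rw [Real.log_pow] at h5
      have h6 := Real.log_le_sub_one_of_pos (show 0 < 1 + √v by linarith)
      push_cast at h5
      linarith
    linarith

lemma integrable_sqrt_abs_div : Integrable fun x : ℝ => √|x| / (1 + x ^ 2) := by
  have h := integrable_rpow_neg_one_add_norm_sq (E := ℝ) (μ := volume) (r := 3 / 2)
    (by norm_num)
  have hc : Continuous fun x : ℝ => √|x| / (1 + x ^ 2) :=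
    (by fun_prop : Continuous fun x : ℝ => √|x|).div (by fun_prop) fun x => by positivity
  refine h.mono' hc.aestronglyMeasurable (ae_of_all _ fun x => ?_)
  have h1 : 0 < 1 + x ^ 2 := by positivity
  rw [Real.norm_eq_abs, abs_of_nonneg (by positivity), Real.norm_eq_abs, sq_abs,
    div_le_iff₀ h1]
  nth_rw 2 [← Real.rpow_one (1 + x ^ 2)]
  rw [← Real.rpow_add h1, Real.sqrt_eq_rpow]
  have h2 : |x| ≤ (1 + x ^ 2) ^ (1 / 2 : ℝ) := by
    rw [← Real.sqrt_eq_rpow]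
    exact Real.abs_le_sqrt (by linarith)
  calc |x| ^ (1 / 2 : ℝ) ≤ ((1 + x ^ 2) ^ (1 / 2 : ℝ)) ^ (1 / 2 : ℝ) := by gcongr
    _ = _ := by rw [← Real.rpow_mul h1.le]; norm_num

lemma fejer_sub_le {T : ℝ} (hT : 0 < T) (u w : ℝ) :
    fejer T (u - w) ≤ 8 * (T / (1 + (T * (w - u)) ^ 2)) := by
  have := fejer_le hT (u - w)
  rwa [show (T * (u - w)) ^ 2 = (T * (w - u)) ^ 2 by ring] at this

lemma integrable_fejer_sub {T : ℝ} (hT : 0 < T) (w : ℝ) :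
    Integrable fun u => fejer T (u - w) := by
  refine ((integrable_poisson hT w).const_mul 8).mono'
    ((continuous_fejer hT).comp (continuous_id.sub continuous_const)).aestronglyMeasurable
    (ae_of_all _ fun u => ?_)
  rw [Real.norm_eq_abs, abs_of_nonneg (fejer_nonneg hT _)]
  exact fejer_sub_le hT u w

lemma integral_fejer_sub_le {T : ℝ} (hT : 0 < T) (w : ℝ) :
    ∫ u in Set.Ioi 0, fejer T (u - w) ≤ 8 * π := by
  rw [← integral_poisson hT w, ← integral_const_mul]
  refine (setIntegral_le_integral (integrable_fejer_sub hT w)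
    (ae_of_all _ fun u => fejer_nonneg hT _)).trans ?_
  exact integral_mono (integrable_fejer_sub hT w) ((integrable_poisson hT w).const_mul 8)
    fun u => fejer_sub_le hT u w

lemma sqrt_mul_fejer_sub_le {T : ℝ} (hT : 1 ≤ T) (u w : ℝ) :
    √|u - w| * fejer T (u - w) ≤ 8 * (T * (√|T * (u - w)| / (1 + (T * (u - w)) ^ 2))) := by
  have hT0 : 0 < T := by linarith
  have h1 : √|u - w| ≤ √|T * (u - w)| := by
    refine Real.sqrt_le_sqrt ?_
    rw [abs_mul, abs_of_pos hT0]
    nlinarith [abs_nonneg (u - w)]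
  calc √|u - w| * fejer T (u - w) ≤
        √|T * (u - w)| * (8 * (T / (1 + (T * (u - w)) ^ 2))) :=
        mul_le_mul h1 (fejer_le hT0 _) (fejer_nonneg hT0 _) (Real.sqrt_nonneg _)
    _ = _ := by ring

lemma integrable_comp_mul_sub {g : ℝ → ℝ} (hg : Integrable g) {T : ℝ} (hT : 0 < T) (w : ℝ) :
    Integrable fun u => g (T * (u - w)) :=
  (hg.comp_mul_left' hT.ne').comp_sub_right w

lemma integral_comp_mul_sub (g : ℝ → ℝ) {T : ℝ} (hT : 0 < T) (w : ℝ) :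
    ∫ u, T * g (T * (u - w)) = ∫ x, g x := by
  rw [integral_const_mul, integral_sub_right_eq_self (fun u => g (T * u)) w,
    Measure.integral_comp_mul_left, abs_of_pos (inv_pos.2 hT), smul_eq_mul,
    mul_inv_cancel_left₀ hT.ne']

lemma integrable_sqrt_mul_fejer {T : ℝ} (hT : 1 ≤ T) (w : ℝ) :
    Integrable fun u => √|u - w| * fejer T (u - w) := by
  have hT0 : 0 < T := by linarith
  refine (((integrable_comp_mul_sub integrable_sqrt_abs_div hT0 w).const_mul T).const_mul 8).mono'
    ?_ (ae_of_all _ fun u => ?_)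
  · refine Continuous.aestronglyMeasurable ?_
    exact (by fun_prop : Continuous fun u : ℝ => √|u - w|).mul
      ((continuous_fejer hT0).comp (continuous_id.sub continuous_const))
  · rw [Real.norm_eq_abs, abs_of_nonneg (mul_nonneg (Real.sqrt_nonneg _) (fejer_nonneg hT0 _))]
    exact sqrt_mul_fejer_sub_le hT u w

lemma integral_sqrt_mul_fejer_le {T : ℝ} (hT : 1 ≤ T) (w : ℝ) :
    ∫ u in Set.Ioi 0, √|u - w| * fejer T (u - w) ≤ 8 * ∫ x : ℝ, √|x| / (1 + x ^ 2) := by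
  have hT0 : 0 < T := by linarith
  rw [← integral_comp_mul_sub _ hT0 w, ← integral_const_mul]
  refine (setIntegral_le_integral (integrable_sqrt_mul_fejer hT w)
    (ae_of_all _ fun u => mul_nonneg (Real.sqrt_nonneg _) (fejer_nonneg hT0 _))).trans ?_
  exact integral_mono (integrable_sqrt_mul_fejer hT w)
    (((integrable_comp_mul_sub integrable_sqrt_abs_div hT0 w).const_mul T).const_mul 8)
    fun u => sqrt_mul_fejer_sub_le hT u w

lemma neg_le_integral_mul_fejer {f : ℝ → ℝ} {B c : ℝ} (hB : 0 ≤ B) (hc : 0 ≤ c)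
    (hf : ∀ u, 0 < u → -(B + c * logLog u) ≤ f u) {T w : ℝ} (hT : 1 ≤ T) (hw : 0 ≤ w)
    (h_intg : IntegrableOn (fun u => f u * fejer T (u - w)) (Set.Ioi 0)) :
    -(8 * π * (B + c * logLog w) + 16 * c * ∫ x : ℝ, √|x| / (1 + x ^ 2)) ≤
      ∫ u in Set.Ioi 0, f u * fejer T (u - w) := by
  have hT0 : 0 < T := by linarith
  have i1 : IntegrableOn (fun u => (B + c * logLog w) * fejer T (u - w)) (Set.Ioi 0) :=
    ((integrable_fejer_sub hT0 w).const_mul _).integrableOn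
  have i2 : IntegrableOn (fun u => 2 * c * (√|u - w| * fejer T (u - w))) (Set.Ioi 0) :=
    ((integrable_sqrt_mul_fejer hT w).const_mul _).integrableOn
  have i3 : IntegrableOn (fun u => (B + c * logLog w) * fejer T (u - w) +
      2 * c * (√|u - w| * fejer T (u - w))) (Set.Ioi 0) := i1.add i2
  have h1 : -∫ u in Set.Ioi 0, f u * fejer T (u - w) ≤
      ∫ u in Set.Ioi 0, ((B + c * logLog w) * fejer T (u - w) +
        2 * c * (√|u - w| * fejer T (u - w))) := by
    rw [← integral_neg]
    refine setIntegral_mono_on h_intg.neg i3 measurableSet_Ioi fun u hu => ?_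
    have hu : 0 < u := hu
    have h2 := logLog_le_add hu.le hw
    have h3 : -f u ≤ (B + c * logLog w) + 2 * c * √|u - w| := by
      have := mul_le_mul_of_nonneg_left h2 hc
      linarith [hf u hu]
    have h4 := mul_le_mul_of_nonneg_right h3 (fejer_nonneg hT0 (u - w))
    linarith
  rw [integral_add i1 i2, integral_const_mul, integral_const_mul] at h1
  have h2 := mul_le_mul_of_nonneg_left (integral_fejer_sub_le hT0 w)
    (add_nonneg hB (mul_nonneg hc (logLog_nonneg hw)))
  have h3 := mul_le_mul_of_nonneg_left (integral_sqrt_mul_fejer_le hT w)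
    (mul_nonneg zero_le_two hc)
  linarith

lemma log_div_le_integral_mul_waveTest {A : ℝ → ℝ} (hAc : Continuous A) {C : ℝ}
    (hA : ∀ t, -C ≤ A t) (hlog : ∀ t, 2 ≤ t → Real.log t - C ≤ A t) {T : ℝ} (hT : 8 ≤ T)
    (hC : 0 ≤ C) :
    Real.log (T / 4) / 8 - C * (1056 * (π + 4)) ≤ ∫ t, A t * waveTest T (1 / T) t := by
  have hT0 : 0 < T := by linarith
  have hw : 0 ≤ 1 / T := by positivity
  have hwT : 1 / T * T ≤ 1 := by rw [one_div_mul_cancel hT0.ne']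
  have hw1 : 1 / T ≤ 1 := by rw [div_le_one hT0]; linarith
  have hg := waveTest_nonneg hT0 hw hwT
  have i1 := integrable_mul_waveTest hAc hT0 (1 / T)
  have i2 := integrable_mul_waveTest (continuous_const (y := C)) hT0 (1 / T)
  have i3 : Integrable fun t => A t * waveTest T (1 / T) t + C * waveTest T (1 / T) t := i1.add i2
  have h1 : ∫ t in Set.Icc (T / 4) (T / 2), Real.log (T / 4) * (1 / T / 2) ≤
      ∫ t, (A t * waveTest T (1 / T) t + C * waveTest T (1 / T) t) := by
    refine (setIntegral_mono_on (integrableOn_const (by simp)) i3.integrableOn measurableSet_Icc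
      fun t ht => ?_).trans (setIntegral_le_integral i3 (ae_of_all _ fun t => ?_))
    · rw [← add_mul]
      have h2 := hlog t (by linarith [ht.1])
      have h3 : Real.log (T / 4) ≤ Real.log t := Real.log_le_log (by linarith) ht.1
      have h4 : 0 ≤ Real.log (T / 4) := Real.log_nonneg (by linarith)
      refine mul_le_mul (by linarith) (le_waveTest_of_abs_le hT0 hw hw1 hwT ?_) (by positivity)
        (by linarith)
      rw [abs_of_nonneg (by linarith [ht.1])]
      exact ht.2
    · have h2 := mul_nonneg (show 0 ≤ A t + C by linarith [hA t]) (hg t)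
      rw [add_mul] at h2
      exact h2
  rw [integral_add i1 i2, setIntegral_const, smul_eq_mul, Measure.real, Real.volume_Icc,
    ENNReal.toReal_ofReal (by linarith), integral_const_mul] at h1
  have h2 := mul_le_mul_of_nonneg_left (integral_waveTest_le (w := 1 / T) (by linarith : 1 ≤ T)) hC
  have h3 : (T / 2 - T / 4) * (Real.log (T / 4) * (1 / T / 2)) = Real.log (T / 4) / 8 := by
    field_simp; ring
  linarith

lemma integral_mul_waveTest_le {A : ℝ → ℝ} (hAc : Continuous A) {C : ℝ} (hC : 0 ≤ C)
    (hA : ∀ t, |A t| ≤ C * (1 + |t|)) {T w : ℝ} (hT : 1 ≤ T) (hw : 0 ≤ w) (hwT : w * T ≤ 1) :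
    ∫ t, A t * waveTest T w t ≤ C * (1 + T) * (1056 * (π + 4)) := by
  have hT0 : 0 < T := by linarith
  have h2 := mul_le_mul_of_nonneg_left (integral_waveTest_le (w := w) hT)
    (by positivity : 0 ≤ C * (1 + T))
  refine le_trans ?_ h2
  rw [← integral_const_mul]
  refine integral_mono (integrable_mul_waveTest hAc hT0 w)
    (integrable_mul_waveTest continuous_const hT0 w) fun t => ?_
  rcases le_or_gt T |t| with h | h
  · simp [waveTest_eq_zero hT0 w h]
  · refine mul_le_mul_of_nonneg_right ?_ (waveTest_nonneg hT0 hw hwT t)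
    refine (le_abs_self _).trans ((hA t).trans ?_)
    gcongr

/-- If a weighted finite set has at most `K n ^ 3` points in `[-n, n]`, Dirichlet's theorem
produces a large, but controlled, `w` at which the sum of `waveTest` nearly recurs. -/
lemma exists_sum_waveTest_recurrence (Z : Finset ℝ) (m : ℝ → ℕ) (hm : ∀ γ ∈ Z, 1 ≤ m γ)
    {K : ℝ} (hK : 0 ≤ K) {n : ℕ} (hn : 4 ≤ n) (hKn : 3 * K + 6 ≤ n)
    (hN : ∑ γ ∈ Z with |γ| ≤ (n : ℝ), (m γ : ℝ) ≤ K * n ^ 3) :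
    ∃ w : ℝ, n ≤ w ∧ logLog w ≤ 5 * Real.log n ∧
      ∑ γ ∈ Z, m γ * waveTest n (1 / n) γ - 8 * π * K ≤ ∑ γ ∈ Z, m γ * waveTest n w γ := by
  have hn4 : (4 : ℝ) ≤ n := by exact_mod_cast hn
  have hn0 : (0 : ℝ) < n := by linarith
  set Z' := Z.filter fun γ => |γ| ≤ (n : ℝ) with hZ'
  obtain ⟨j, hj1, hjQ, hj⟩ := exists_natCast_mul_exp_near_one Z' n (Q := n ^ 3) (by positivity)
  have hj1' : (1 : ℝ) ≤ j := by exact_mod_cast hj1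
  have hcard : (Z'.card : ℝ) ≤ K * n ^ 3 := by
    refine le_trans ?_ hN
    rw [Finset.card_eq_sum_ones]
    push_cast
    refine Finset.sum_le_sum fun γ hγ => ?_
    exact_mod_cast hm γ (Finset.mem_filter.1 hγ).1
  have hwn : (n : ℝ) ≤ j * n + 1 / n := by
    have : 0 ≤ 1 / (n : ℝ) := by positivity
    nlinarith
  refine ⟨j * n + 1 / n, hwn, ?_, ?_⟩
  · have hjle : (j : ℝ) ≤ (n : ℝ) ^ (3 * Z'.card) := by
      rw [pow_mul]
      exact_mod_cast hjQ
    have hp : 1 ≤ (n : ℝ) ^ (3 * Z'.card) := one_le_pow₀ (by linarith)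
    have h1 : (j * n + 1 / n + 16 : ℝ) ≤ (n : ℝ) ^ (3 * Z'.card + 6) := by
      have h2 : 1 / (n : ℝ) ≤ 1 := by rw [div_le_one hn0]; linarith
      have h3 : (n : ℝ) + 17 ≤ n ^ 6 := by
        have : (4 : ℝ) ^ 5 ≤ n ^ 5 := by gcongr
        calc (n : ℝ) + 17 ≤ 4 ^ 5 * n := by linarith
          _ ≤ n ^ 5 * n := by gcongr
          _ = n ^ 6 := by ring
      rw [pow_add]
      calc (j * n + 1 / n + 16 : ℝ) ≤ (n : ℝ) ^ (3 * Z'.card) * (n + 17) := by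
            nlinarith
        _ ≤ _ := by gcongr
    have hlogn : 0 < Real.log n := Real.log_pos (by linarith)
    have h2 : Real.log (j * n + 1 / n + 16) ≤ (3 * Z'.card + 6) * Real.log n := by
      have := Real.log_le_log (by linarith) h1
      rw [Real.log_pow] at this
      push_cast at this
      exact this
    have h3 : Real.log (j * n + 1 / n + 16) ≤ (n : ℝ) ^ 5 := by
      have hl : Real.log n ≤ n := (Real.log_le_sub_one_of_pos hn0).trans (by linarith)
      have hn3 : (1 : ℝ) ≤ n ^ 3 := one_le_pow₀ (by linarith)
      calc Real.log (j * n + 1 / n + 16) ≤ (3 * (K * n ^ 3) + 6) * n := by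
            refine h2.trans ?_
            gcongr
        _ ≤ ((3 * K + 6) * n ^ 3) * n := by gcongr; nlinarith
        _ ≤ (n * n ^ 3) * n := by gcongr
        _ = n ^ 5 := by ring
    have hw1 := one_le_log_add_sixteen (u := j * n + 1 / n) (by positivity)
    have h4 := Real.log_le_log (by linarith) h3
    rw [Real.log_pow] at h4
    exact_mod_cast h4
  · rw [sub_le_comm, ← Finset.sum_sub_distrib]
    have hle : ∀ γ ∈ Z', m γ * waveTest n (1 / n) γ - m γ * waveTest n (j * n + 1 / n) γ ≤
        m γ * (4 * (2 * π / n ^ 3)) := by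
      intro γ hγ
      rw [← mul_sub]
      refine mul_le_mul_of_nonneg_left ?_ (Nat.cast_nonneg _)
      have h1 := abs_waveTest_add_sub_le hn0 (j * n) (1 / n) γ
      have h2 := hj γ hγ
      push_cast at h1 h2
      rw [abs_le] at h1
      linarith
    have hzero : ∀ γ ∈ Z, γ ∉ Z' →
        m γ * waveTest n (1 / n) γ - m γ * waveTest n (j * n + 1 / n) γ = 0 := by
      intro γ hγ hγ'
      have : (n : ℝ) < |γ| := by
        by_contra h
        exact hγ' (Finset.mem_filter.2 ⟨hγ, not_lt.1 h⟩)
      rw [waveTest_eq_zero hn0 _ this.le, waveTest_eq_zero hn0 _ this.le, sub_self]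
    rw [← Finset.sum_subset (Finset.filter_subset _ Z) hzero]
    calc _ ≤ ∑ γ ∈ Z', m γ * (4 * (2 * π / (n : ℝ) ^ 3)) := Finset.sum_le_sum hle
      _ = (∑ γ ∈ Z', (m γ : ℝ)) * (4 * (2 * π / (n : ℝ) ^ 3)) := by rw [Finset.sum_mul]
      _ ≤ K * n ^ 3 * (4 * (2 * π / (n : ℝ) ^ 3)) := by gcongr
      _ = 8 * π * K := by field_simp; ring

/-- A function attached to `LData` cannot satisfy a one-sided bound of size a small multiple
of `log log u`. -/
theorem LData.false_of_lower_bound {f : ℝ → ℝ} {D Ξ : ℂ → ℂ} {α β : ℝ} (h : LData f D Ξ α β)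
    {B : ℝ} (hB : 0 ≤ B) (hf : ∀ u, 0 < u → -(B + 1 / 20000 * logLog u) ≤ f u) : False := by
  have hl0 := logLog_nonneg le_rfl
  obtain ⟨C, hC, hexp⟩ := h.exists_explicit_waveTest (M := B + logLog 0 + 2) (by linarith)
    fun u hu => by
      have h1 := logLog_le_add hu.le le_rfl
      rw [sub_zero, abs_of_pos hu] at h1
      refine le_trans ?_ (hf u hu)
      have := Real.sqrt_nonneg u
      nlinarith [mul_nonneg hB this, mul_nonneg hl0 this]
  obtain ⟨C', hC', hA1, hAlip, hAlow, hAlog⟩ := exists_arch_bounds α h.β_pos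
  set A : ℝ → ℝ := fun t => (arch α β (t * I)).re with hA
  have hAc : Continuous A := (LipschitzWith.of_dist_le_mul (K := C'.toNNReal) fun t t' => by
    rw [Real.dist_eq, Real.dist_eq, Real.coe_toNNReal _ hC']; exact hAlip t t').continuous
  set S := ∫ x : ℝ, √|x| / (1 + x ^ 2) with hS
  have hS0 : 0 ≤ S := integral_nonneg fun x => by positivity
  set K := 4 * (C' * 3 * (1056 * (π + 4)) + 3 * C) with hK
  have hK0 : 0 ≤ K := by positivity
  set E := 2 * (8 * π * B + S) + 4 * C + 11 * C' * π * (2 + π) + 8 * π ^ 2 * K +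
    C' * (1056 * (π + 4)) + Real.log 4 / 8 with hE
  obtain ⟨n, hn⟩ := exists_nat_gt (max (max 8 (3 * K + 6)) (rexp (20 * E)))
  have hn8 : (8 : ℝ) < n := ((le_max_left _ _).trans (le_max_left _ _)).trans_lt hn
  have hnK : 3 * K + 6 < n := ((le_max_right _ _).trans (le_max_left _ _)).trans_lt hn
  have hnE : rexp (20 * E) < n := (le_max_right _ _).trans_lt hn
  have hn0 : (0 : ℝ) < n := by linarith
  have hlogE : 20 * E < Real.log n := (Real.lt_log_iff_exp_lt hn0).2 hnE
  obtain ⟨Z, m, hm, hR⟩ := hexp (2 * n + 1)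
  have hn2 : 1 / (n : ℝ) ≤ 1 / 4 := by gcongr; linarith
  have hcount : ∑ γ ∈ Z with |γ| ≤ (n : ℝ), (m γ : ℝ) ≤ K * n ^ 3 := by
    have hw : (0 : ℝ) ≤ 1 / (2 * n) := by positivity
    have hw4 : (1 : ℝ) / (2 * n) ≤ 1 / 4 := by gcongr; linarith
    have hT0 : (0 : ℝ) < 2 * n := by linarith
    have hwT : (1 : ℝ) / (2 * n) * (2 * n) ≤ 1 := by rw [one_div_mul_cancel hT0.ne']
    obtain ⟨-, h1, h2⟩ := hR (2 * n) (by linarith) (by linarith) _ hw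
    have h2 := abs_le.1 (h2 hw4)
    have h1 := (abs_le.1 h1).2
    have h3 := integral_mul_waveTest_le hAc hC' hA1 (T := 2 * n) (by linarith) hw hwT
    have h4 : (∑ γ ∈ Z with |γ| ≤ (n : ℝ), (m γ : ℝ)) * (1 / (2 * n) / 2) ≤
        ∑ γ ∈ Z, m γ * waveTest (2 * n) (1 / (2 * n)) γ := by
      rw [Finset.sum_mul]
      refine (Finset.sum_le_sum fun γ hγ => ?_).trans (Finset.sum_le_sum_of_subset_of_nonneg
        (Finset.filter_subset _ Z) fun γ _ _ =>
          mul_nonneg (Nat.cast_nonneg _) (waveTest_nonneg hT0 hw hwT γ))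
      refine mul_le_mul_of_nonneg_left (le_waveTest_of_abs_le hT0 hw (by linarith) hwT ?_)
        (Nat.cast_nonneg _)
      have := (Finset.mem_filter.1 hγ).2
      linarith
    set N := ∑ γ ∈ Z with |γ| ≤ (n : ℝ), (m γ : ℝ) with hN
    have hN0 : 0 ≤ N := Finset.sum_nonneg fun γ _ => Nat.cast_nonneg _
    have h5 : N * (1 / (2 * n) / 2) ≤ π * (N * (1 / (2 * n) / 2)) :=
      le_mul_of_one_le_left (by positivity) (by linarith [Real.pi_gt_three])
    have h6 := mul_le_mul_of_nonneg_left h4 Real.pi_pos.le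
    have h7 : N * (1 / (2 * n) / 2) ≤ C' * (1 + 2 * n) * (1056 * (π + 4)) + 3 * C := by
      linarith
    have h8 : C' * (1 + 2 * n) * (1056 * (π + 4)) + 3 * C ≤ K / 4 * n := by
      have : C' * (1 + 2 * n) * (1056 * (π + 4)) ≤ C' * (3 * n) * (1056 * (π + 4)) := by
        gcongr; linarith
      have : 3 * C ≤ 3 * C * n := le_mul_of_one_le_right (by positivity) (by linarith)
      rw [hK]
      linarith
    have h9 : N ≤ K * n ^ 2 := by
      have := mul_le_mul_of_nonneg_left (h7.trans h8) (by positivity : (0 : ℝ) ≤ 4 * n)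
      calc N = 4 * n * (N * (1 / (2 * n) / 2)) := by field_simp; ring
        _ ≤ 4 * n * (K / 4 * n) := this
        _ = K * n ^ 2 := by ring
    refine h9.trans ?_
    gcongr
    · linarith
    · norm_num
  obtain ⟨w, hw, hwlog, hsum⟩ := exists_sum_waveTest_recurrence Z m hm hK0
    (by exact_mod_cast (by linarith : (4 : ℝ) ≤ n)) hnK.le hcount
  have hw0 : 0 ≤ w := by linarith
  obtain ⟨-, e1, e2⟩ := hR n (by linarith) (by linarith) (1 / n) (by positivity)
  obtain ⟨h_intg, e3, -⟩ := hR n (by linarith) (by linarith) w hw0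
  have e2 := abs_le.1 (e2 hn2)
  have e1 := abs_le.1 e1
  have e3 := abs_le.1 e3
  have a1 := log_div_le_integral_mul_waveTest hAc hAlow hAlog hn8.le hC'
  have a2 := (abs_le.1 (abs_integral_mul_waveTest_le hC' hA1 hAlip (by linarith) hw)).2
  have l1 := neg_le_integral_mul_fejer hB (by norm_num) hf (by linarith) hw0 h_intg
  rw [Real.log_div hn0.ne' (by norm_num)] at a1
  have s1 := mul_le_mul_of_nonneg_left hsum Real.pi_pos.le
  have hlogn : 0 < Real.log n := Real.log_pos (by linarith)
  have l2 : 8 * π * (B + 1 / 20000 * logLog w) ≤ 8 * π * B + 1 / 100 * Real.log n := by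
    have hpi : π ≤ 4 := Real.pi_le_four
    have : π * logLog w ≤ 4 * (5 * Real.log n) :=
      mul_le_mul hpi hwlog (logLog_nonneg hw0) (by norm_num)
    linarith
  rw [← hS] at l1
  simp only [hA] at a1 a2
  linarith

end LittlewoodOscillation

namespace LittlewoodOscillation

open MeasureTheory Topology

open ArithmeticFunction (vonMangoldt vonMangoldt_nonneg)

section CharacterSums

variable {N : ℕ} (χ : DirichletCharacter ℂ N)

lemma psiChi_eq_sum_Icc (x : ℝ) :
    psiChi χ x = ∑ n ∈ Finset.Icc 1 ⌊x⌋₊, χ n * (vonMangoldt n : ℂ) := by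
  rw [psiChi, Finset.range_eq_Ico, Finset.sum_eq_sum_Ico_succ_bot (by omega)]
  simp
  rfl

lemma chebyshev_psi_eq_sum_Icc (x : ℝ) :
    Chebyshev.psi x = ∑ n ∈ Finset.Icc 1 ⌊x⌋₊, vonMangoldt n := rfl

lemma norm_psiChi_le (x : ℝ) : ‖psiChi χ x‖ ≤ Chebyshev.psi x := by
  rw [psiChi_eq_sum_Icc, chebyshev_psi_eq_sum_Icc]
  refine (norm_sum_le _ _).trans (Finset.sum_le_sum fun n _ => ?_)
  rw [norm_mul, Complex.norm_real, Real.norm_eq_abs, abs_of_nonneg vonMangoldt_nonneg]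
  exact mul_le_of_le_one_left vonMangoldt_nonneg (DirichletCharacter.norm_le_one χ _)

lemma measurable_psiChi : Measurable (psiChi χ) :=
  (measurable_from_nat (f := fun k : ℕ => ∑ n ∈ Finset.range (k + 1),
    χ n * (vonMangoldt n : ℂ))).comp Nat.measurable_floor

lemma psiChi_add_psiChi_inv (x : ℝ) :
    psiChi χ x + psiChi χ⁻¹ x = ((2 * (psiChi χ x).re : ℝ) : ℂ) := by
  have h : psiChi χ⁻¹ x = (starRingEnd ℂ) (psiChi χ x) := by
    simp only [psiChi, map_sum, map_mul, conj_ofReal]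
    refine Finset.sum_congr rfl fun n _ => ?_
    rw [← MulChar.star_apply']
    rfl
  rw [h, Complex.add_conj]

/-- The function `ψ(x, χ) / √x` in the variable `u = log x`. -/
noncomputable def expPsi (u : ℝ) : ℝ := (psiChi χ (rexp u)).re * rexp (-(u / 2))

lemma measurable_expPsi : Measurable (expPsi χ) := by
  have h1 : Measurable fun u => (psiChi χ (rexp u)).re :=
    Complex.measurable_re.comp ((measurable_psiChi χ).comp Real.measurable_exp)
  exact h1.mul (by fun_prop)

lemma expPsi_eq_zero_of_lt {u : ℝ} (hu : u < Real.log 2) : expPsi χ u = 0 := by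
  have h : ‖psiChi χ (rexp u)‖ ≤ 0 := (norm_psiChi_le χ _).trans_eq
    (Chebyshev.psi_eq_zero_of_lt_two ((Real.lt_log_iff_exp_lt two_pos).1 hu))
  rw [expPsi, norm_le_zero_iff.1 h, zero_re, zero_mul]

lemma integrableOn_expPsi {σ : ℝ} (hσ : 1 / 2 < σ) :
    IntegrableOn (fun u => expPsi χ u * rexp (-(σ * u))) (Set.Ioi 0) := by
  refine ((integrableOn_exp_neg_mul (σ := σ - 1 / 2) (by linarith)).const_mul
    (Real.log 4 + 4)).mono' ((measurable_expPsi χ).mul (by fun_prop)).aestronglyMeasurable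
    (ae_of_all _ fun u => ?_)
  rw [norm_mul, Real.norm_eq_abs, Real.norm_eq_abs, Real.abs_exp, expPsi, abs_mul, Real.abs_exp,
    mul_assoc, ← Real.exp_add]
  have h1 : |(psiChi χ (rexp u)).re| ≤ (Real.log 4 + 4) * rexp u :=
    (abs_re_le_norm _).trans ((norm_psiChi_le χ _).trans
      (Chebyshev.psi_le_const_mul_self (Real.exp_pos u).le))
  refine (mul_le_mul_of_nonneg_right h1 (Real.exp_pos _).le).trans (le_of_eq ?_)
  rw [mul_assoc, ← Real.exp_add]
  ring_nf

/-- The product `L(1/2 + s, χ) L(1/2 + s, χ⁻¹)`. -/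
noncomputable def lProd [NeZero N] (s : ℂ) : ℂ := χ.LFunction (1 / 2 + s) * χ⁻¹.LFunction (1 / 2 + s)

lemma LSeries_twist_add_twist_inv {s : ℂ} (hs : 1 / 2 < s.re) :
    LSeries (fun n => (χ n : ℂ) * (vonMangoldt n : ℂ)) (1 / 2 + s) +
      LSeries (fun n => (χ⁻¹ n : ℂ) * (vonMangoldt n : ℂ)) (1 / 2 + s) =
      2 * (s + 1 / 2) * laplace (expPsi χ) s := by
  have hs' : 1 < (1 / 2 + s).re := by
    have : (1 / 2 + s).re = 1 / 2 + s.re := by simp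
    linarith
  have hO : ∀ ψ : DirichletCharacter ℂ N, (fun n : ℕ => ∑ k ∈ Finset.Icc 1 n,
      ψ k * (vonMangoldt k : ℂ)) =O[atTop] fun n => (n : ℝ) ^ (1 : ℝ) := by
    intro ψ
    refine Asymptotics.IsBigO.of_bound (Real.log 4 + 4) (Eventually.of_forall fun n => ?_)
    have h1 := norm_psiChi_le ψ n
    rw [psiChi_eq_sum_Icc, Nat.floor_natCast] at h1
    rw [Real.rpow_one, Real.norm_natCast]
    exact h1.trans (Chebyshev.psi_le_const_mul_self (Nat.cast_nonneg n))
  have hS : ∀ ψ : DirichletCharacter ℂ N,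
      LSeriesSummable (fun n : ℕ => ψ n * (vonMangoldt n : ℂ)) (1 / 2 + s) := fun ψ =>
    DirichletCharacter.LSeriesSummable_twist_vonMangoldt ψ hs'
  have key : LSeries (fun n => (χ n : ℂ) * (vonMangoldt n : ℂ)) (1 / 2 + s) +
      LSeries (fun n => (χ⁻¹ n : ℂ) * (vonMangoldt n : ℂ)) (1 / 2 + s) =
      LSeries ((fun n : ℕ => χ n * (vonMangoldt n : ℂ)) +
        fun n : ℕ => χ⁻¹ n * (vonMangoldt n : ℂ))
        (1 / 2 + s) := (LSeries_add (hS χ) (hS χ⁻¹)).symm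
  have hO' : (fun n : ℕ => ∑ k ∈ Finset.Icc 1 n, ((fun n : ℕ => χ n * (vonMangoldt n : ℂ)) +
      fun n : ℕ => χ⁻¹ n * (vonMangoldt n : ℂ)) k) =O[atTop] fun n => (n : ℝ) ^ (1 : ℝ) := by
    simp only [Pi.add_apply, Finset.sum_add_distrib]
    exact (hO χ).add (hO χ⁻¹)
  rw [key, LSeries_eq_mul_integral _ zero_le_one hs' ((hS χ).add (hS χ⁻¹)) hO', ← Real.exp_zero,
    ← integral_comp_exp_Ioi]
  have e : ∀ u : ℝ, rexp u • ((∑ k ∈ Finset.Icc 1 ⌊rexp u⌋₊, ((fun n : ℕ => χ n *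
      (vonMangoldt n : ℂ)) + fun n : ℕ => χ⁻¹ n * (vonMangoldt n : ℂ)) k) *
        (rexp u : ℂ) ^ (-(1 / 2 + s + 1))) = 2 * ((expPsi χ u : ℂ) * cexp (-(s * u))) := by
    intro u
    simp only [Pi.add_apply, Finset.sum_add_distrib]
    rw [← psiChi_eq_sum_Icc, ← psiChi_eq_sum_Icc, psiChi_add_psiChi_inv, expPsi,
      cpow_def_of_ne_zero (by exact_mod_cast (Real.exp_pos u).ne'), ← ofReal_log (Real.exp_pos u).le,
      Real.log_exp, real_smul]
    push_cast
    rw [show (u : ℂ) * (-(1 / 2 + s + 1)) = -(u : ℂ) + (-(u / 2) + -(s * u)) by ring,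
      Complex.exp_add, Complex.exp_add, Complex.exp_neg (u : ℂ)]
    have := Complex.exp_ne_zero (u : ℂ)
    field_simp
  simp_rw [e]
  rw [integral_const_mul, laplace]
  ring

variable [NeZero N]

lemma deriv_lProd (hχ : χ ≠ 1) {s : ℂ} (hs : 1 / 2 < s.re) :
    deriv (lProd χ) s = -2 * (s + 1 / 2) * laplace (expPsi χ) s * lProd χ s := by
  have hs' : 1 < (1 / 2 + s).re := by
    have : (1 / 2 + s).re = 1 / 2 + s.re := by simp
    linarith
  have hχ' : χ⁻¹ ≠ 1 := inv_ne_one.2 hχ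
  have hd : ∀ ψ : DirichletCharacter ℂ N, ψ ≠ 1 →
      HasDerivAt (fun z => ψ.LFunction (1 / 2 + z)) (deriv ψ.LFunction (1 / 2 + s)) s :=
    fun ψ hψ => (DirichletCharacter.differentiable_LFunction hψ _).hasDerivAt.comp_const_add _ _
  have ht : ∀ ψ : DirichletCharacter ℂ N, ψ ≠ 1 → deriv ψ.LFunction (1 / 2 + s) =
      -LSeries (fun n => (ψ n : ℂ) * (vonMangoldt n : ℂ)) (1 / 2 + s) *
        ψ.LFunction (1 / 2 + s) := by
    intro ψ hψ
    have h0 := DirichletCharacter.LFunction_ne_zero_of_one_le_re ψ (.inl hψ) hs'.le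
    have h1 : LSeries (fun n => (ψ n : ℂ) * (vonMangoldt n : ℂ)) (1 / 2 + s) = _ :=
      DirichletCharacter.LSeries_twist_vonMangoldt_eq ψ hs'
    rw [h1, DirichletCharacter.deriv_LFunction_eq_deriv_LSeries _ hs',
      DirichletCharacter.LFunction_eq_LSeries _ hs']
    rw [DirichletCharacter.LFunction_eq_LSeries _ hs'] at h0
    rw [neg_div, neg_neg, div_mul_cancel₀ _ h0]
  have h := ((hd χ hχ).mul (hd χ⁻¹ hχ')).deriv
  have h2 := LSeries_twist_add_twist_inv χ hs
  rw [ht χ hχ, ht χ⁻¹ hχ'] at h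
  have h3 : deriv (lProd χ) s = _ := h
  rw [h3, lProd]
  linear_combination (-(χ.LFunction (1 / 2 + s) * χ⁻¹.LFunction (1 / 2 + s))) * h2

end CharacterSums

end LittlewoodOscillation

namespace LittlewoodOscillation

open MeasureTheory Topology

lemma isPrimitive_inv {N : ℕ} {χ : DirichletCharacter ℂ N} (hχ : χ.IsPrimitive) : χ⁻¹.IsPrimitive := by
  rwa [DirichletCharacter.isPrimitive_def, DirichletCharacter.conductor_inv]

lemma exists_gammaFactor_eq {N : ℕ} (χ : DirichletCharacter ℂ N) : ∃ a : ℝ, 0 ≤ a ∧ ∀ s,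
    χ.gammaFactor s = Gammaℝ (s + a) ∧ χ⁻¹.gammaFactor s = Gammaℝ (s + a) := by
  rcases χ.even_or_odd with h | h
  · have h' : χ⁻¹.Even := by
      rw [DirichletCharacter.Even, ← MulChar.star_apply', show χ (-1) = 1 from h, star_one]
    exact ⟨0, le_rfl, fun s => by simp [h.gammaFactor_def, h'.gammaFactor_def]⟩
  · have h' : χ⁻¹.Odd := by
      rw [DirichletCharacter.Odd, ← MulChar.star_apply', show χ (-1) = -1 from h, star_neg, star_one]
    exact ⟨1, zero_le_one, fun s => by simp [h.gammaFactor_def, h'.gammaFactor_def]⟩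

section CompletedProduct

variable {N : ℕ} [NeZero N] (χ : DirichletCharacter ℂ N)

/-- The symmetrised completed product `N ^ s Λ(1/2 + s, χ) Λ(1/2 + s, χ⁻¹)`. -/
noncomputable def xiProd (s : ℂ) : ℂ :=
  (N : ℂ) ^ s * (χ.completedLFunction (1 / 2 + s) * χ⁻¹.completedLFunction (1 / 2 + s))

variable {χ}

lemma differentiable_lProd (hχ : χ ≠ 1) : Differentiable ℂ (lProd χ) := by
  have h : ∀ ψ : DirichletCharacter ℂ N, ψ ≠ 1 →
      Differentiable ℂ fun z => ψ.LFunction (1 / 2 + z) := fun ψ hψ =>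
    (DirichletCharacter.differentiable_LFunction hψ).comp (by fun_prop)
  exact (h χ hχ).mul (h χ⁻¹ (inv_ne_one.2 hχ))

lemma differentiable_xiProd (hχ : χ ≠ 1) : Differentiable ℂ (xiProd χ) := by
  have h : ∀ ψ : DirichletCharacter ℂ N, ψ ≠ 1 →
      Differentiable ℂ fun z => ψ.completedLFunction (1 / 2 + z) := fun ψ hψ =>
    (DirichletCharacter.differentiable_completedLFunction hψ).comp (by fun_prop)
  have hN : Differentiable ℂ fun s : ℂ => (N : ℂ) ^ s := fun s =>
    (differentiableAt_id).const_cpow (Or.inl (NeZero.ne _))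
  exact hN.mul ((h χ hχ).mul (h χ⁻¹ (inv_ne_one.2 hχ)))

lemma xiProd_neg (hχ : χ.IsPrimitive) (s : ℂ) :
    xiProd χ (-s) = χ.rootNumber * χ⁻¹.rootNumber * xiProd χ s := by
  have h : ∀ ψ : DirichletCharacter ℂ N, ψ.IsPrimitive → ψ.completedLFunction (1 / 2 + -s) =
      (N : ℂ) ^ s * ψ.rootNumber * ψ⁻¹.completedLFunction (1 / 2 + s) := by
    intro ψ hψ
    rw [show (1 / 2 + -s : ℂ) = 1 - (1 / 2 + s) by ring, hψ.completedLFunction_one_sub,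
      add_sub_cancel_left]
  rw [xiProd, xiProd, h χ hχ, h χ⁻¹ (isPrimitive_inv hχ), inv_inv, cpow_neg]
  have hN : (N : ℂ) ^ s ≠ 0 := by
    rw [Ne, cpow_eq_zero_iff]
    exact fun h => NeZero.ne (N : ℂ) h.1
  field_simp

lemma logDeriv_xiProd_neg (hχ1 : χ ≠ 1) (hχ : χ.IsPrimitive) (s : ℂ) :
    logDeriv (xiProd χ) (-s) = -logDeriv (xiProd χ) s := by
  set κ := χ.rootNumber * χ⁻¹.rootNumber with hκ
  have h : (xiProd χ) ∘ Neg.neg = fun s => κ * xiProd χ s := funext fun s => xiProd_neg hχ s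
  rcases eq_or_ne κ 0 with h0 | h0
  · have : xiProd χ = fun _ => 0 := funext fun s => by
      rw [← neg_neg s, xiProd_neg hχ, ← hκ, h0, zero_mul]
    simp [this]
  · have h1 := logDeriv_comp (f := xiProd χ) (g := Neg.neg) (x := s)
      (differentiable_xiProd hχ1 _) differentiableAt_id.neg
    rw [h, logDeriv_const_mul _ _ h0, deriv_neg'] at h1
    rw [h1]
    ring

lemma logDeriv_Gammaℝ {s : ℂ} (hs : 0 < s.re) :
    DifferentiableAt ℂ Gammaℝ s ∧ logDeriv Gammaℝ s = -Real.log π / 2 + digamma (s / 2) / 2 := by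
  have hs2 : 0 < (s / 2).re := by simpa using hs
  have hΓ : DifferentiableAt ℂ Complex.Gamma (s / 2) := differentiableAt_Gamma _ fun m h => by
    rw [h] at hs2
    simp at hs2
    linarith [Nat.cast_nonneg (α := ℝ) m]
  have hg : HasDerivAt (fun s : ℂ => s / 2) (1 / 2) s := (hasDerivAt_id s).div_const 2
  have h1 : HasDerivAt (fun s : ℂ => (π : ℂ) ^ (-s / 2)) ((π : ℂ) ^ (-s / 2) * Complex.log π * (-1 / 2)) s :=
    ((hasDerivAt_id s).neg.div_const 2).const_cpow (Or.inl (by exact_mod_cast Real.pi_ne_zero))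
  have h2 : HasDerivAt (fun s : ℂ => Complex.Gamma (s / 2)) (deriv Complex.Gamma (s / 2) * (1 / 2)) s :=
    hΓ.hasDerivAt.comp s hg
  have e : Gammaℝ = fun s : ℂ => (π : ℂ) ^ (-s / 2) * Complex.Gamma (s / 2) :=
    funext fun s => Gammaℝ_def s
  have h3 := h1.mul h2
  have e' : Gammaℝ = (fun s : ℂ => (π : ℂ) ^ (-s / 2)) * fun s : ℂ => Complex.Gamma (s / 2) := e
  refine ⟨e' ▸ h3.differentiableAt, ?_⟩
  have hp : (π : ℂ) ^ (-s / 2) ≠ 0 := by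
    rw [Ne, cpow_eq_zero_iff]
    exact fun h => Real.pi_ne_zero (by exact_mod_cast h.1)
  have hG : Complex.Gamma (s / 2) ≠ 0 := Gamma_ne_zero_of_re_pos hs2
  rw [← e'] at h3
  rw [logDeriv_apply, h3.deriv, Gammaℝ_def, digamma_def, logDeriv_apply, ofReal_log Real.pi_pos.le]
  field_simp

lemma logDeriv_xiProd (hχ1 : χ ≠ 1) {a : ℝ} (ha : 0 ≤ a)
    (hγ : ∀ s, χ.gammaFactor s = Gammaℝ (s + a) ∧ χ⁻¹.gammaFactor s = Gammaℝ (s + a)) {s : ℂ}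
    (hs : 0 < s.re) (hD : lProd χ s ≠ 0) :
    logDeriv (xiProd χ) s =
      arch (Real.log N - Real.log π) ((1 / 2 + a) / 2) s + logDeriv (lProd χ) s := by
  have hN1 : N ≠ 1 := by
    rintro rfl
    exact hχ1 (χ.level_one)
  have hre : ∀ z : ℂ, 0 < z.re → 0 < (1 / 2 + z + a).re := fun z hz => by
    simp only [add_re, ofReal_re, div_ofNat_re, one_re]
    linarith
  set γ : ℂ → ℂ := fun z => Gammaℝ (1 / 2 + z + a) with hγdef
  have hev : xiProd χ =ᶠ[𝓝 s] fun z => (N : ℂ) ^ z * (γ z * γ z * lProd χ z) := by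
    filter_upwards [(isOpen_lt continuous_const continuous_re).mem_nhds hs] with z hz
    have h0 : Gammaℝ (1 / 2 + z + a) ≠ 0 := Gammaℝ_ne_zero_of_re_pos (hre z hz)
    rw [lProd, DirichletCharacter.LFunction_eq_completed_div_gammaFactor _ _ (.inr hN1),
      DirichletCharacter.LFunction_eq_completed_div_gammaFactor _ _ (.inr hN1), (hγ _).1, (hγ _).2,
      xiProd]
    simp only [hγdef]
    generalize Gammaℝ (1 / 2 + z + a) = g at h0 ⊢
    field_simp
  have hN0 : (N : ℂ) ≠ 0 := NeZero.ne _
  have hNs : (N : ℂ) ^ s ≠ 0 := by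
    rw [Ne, cpow_eq_zero_iff]
    exact fun h => hN0 h.1
  have hγ0 : γ s ≠ 0 := Gammaℝ_ne_zero_of_re_pos (hre s hs)
  obtain ⟨hd, hl⟩ := logDeriv_Gammaℝ (hre s hs)
  have hin : HasDerivAt (fun z : ℂ => 1 / 2 + z + a) 1 s :=
    ((hasDerivAt_id s).const_add _).add_const _
  have hγd : HasDerivAt γ (deriv Gammaℝ (1 / 2 + s + a) * 1) s := HasDerivAt.comp (h₂ := Gammaℝ) s hd.hasDerivAt hin
  have hγl : logDeriv γ s = -Real.log π / 2 + digamma ((1 / 2 + s + a) / 2) / 2 := by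
    rw [← hl, logDeriv_apply, hγd.deriv, mul_one, logDeriv_apply]
  have hNd : HasDerivAt (fun z : ℂ => (N : ℂ) ^ z) ((N : ℂ) ^ s * Complex.log N * 1) s :=
    (hasDerivAt_id s).const_cpow (Or.inl hN0)
  have hNl : logDeriv (fun z : ℂ => (N : ℂ) ^ z) s = Real.log N := by
    rw [logDeriv_apply, hNd.deriv, mul_one, mul_div_cancel_left₀ _ hNs, natCast_log]
  have hL : DifferentiableAt ℂ (lProd χ) s := differentiable_lProd hχ1 s
  have e1 := logDeriv_mul (f := fun z : ℂ => (N : ℂ) ^ z) (g := fun z => γ z * γ z * lProd χ z) s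
    hNs (mul_ne_zero (mul_ne_zero hγ0 hγ0) hD) hNd.differentiableAt
    ((hγd.differentiableAt.mul hγd.differentiableAt).mul hL)
  have e2 := logDeriv_mul (f := fun z => γ z * γ z) (g := lProd χ) s (mul_ne_zero hγ0 hγ0) hD
    (hγd.differentiableAt.mul hγd.differentiableAt) hL
  have e3 := logDeriv_mul (f := γ) (g := γ) s hγ0 hγ0 hγd.differentiableAt hγd.differentiableAt
  rw [(logDeriv_congr_nhds hev).eq_of_nhds, e1, e2, e3, hγl, hNl, arch]
  push_cast
  rw [show ((1 / 2 + a) / 2 + s / 2 : ℂ) = (1 / 2 + s + a) / 2 by ring]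
  ring

theorem ldata_of_isPrimitive (hχ1 : χ ≠ 1) (hχ : χ.IsPrimitive) :
    ∃ α β : ℝ, LData (expPsi χ) (lProd χ) (xiProd χ) α β := by
  obtain ⟨a, ha, hγ⟩ := exists_gammaFactor_eq χ
  have hN1 : N ≠ 1 := by
    rintro rfl
    exact hχ1 (χ.level_one)
  refine ⟨Real.log N - Real.log π, (1 / 2 + a) / 2, measurable_expPsi χ,
    fun u => expPsi_eq_zero_of_lt χ, differentiable_lProd hχ1, fun s hs => ?_,
    fun σ => integrableOn_expPsi χ, fun s => deriv_lProd χ hχ1, differentiable_xiProd hχ1,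
    logDeriv_xiProd_neg hχ1 hχ, fun s hs => ?_, fun s hs h => ?_, by positivity,
    fun s hs => logDeriv_xiProd hχ1 ha hγ hs⟩
  · have hs' : 1 ≤ (1 / 2 + s).re := by
      have : (1 / 2 + s).re = 1 / 2 + s.re := by simp
      linarith
    exact mul_ne_zero (DirichletCharacter.LFunction_ne_zero_of_one_le_re _ (.inl hχ1) hs')
      (DirichletCharacter.LFunction_ne_zero_of_one_le_re _ (.inl (inv_ne_one.2 hχ1)) hs')
  · rw [xiProd_neg hχ, hs, mul_zero]
  · rw [xiProd, mul_eq_zero, cpow_eq_zero_iff] at h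
    rcases h with h | h
    · exact absurd h.1 (NeZero.ne _)
    · rw [lProd, DirichletCharacter.LFunction_eq_completed_div_gammaFactor _ _ (.inr hN1),
        DirichletCharacter.LFunction_eq_completed_div_gammaFactor _ _ (.inr hN1), div_mul_div_comm,
        h, zero_div]

end CompletedProduct

end LittlewoodOscillation

namespace LittlewoodOscillation

open MeasureTheory Topology

open ArithmeticFunction (vonMangoldt vonMangoldt_nonneg)

lemma norm_psiChi_sub_thetaChi_le {N : ℕ} (χ : DirichletCharacter ℂ N) (x : ℝ) :
    ‖psiChi χ x - thetaChi χ x‖ ≤ Chebyshev.psi x - Chebyshev.theta x := by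
  have h1 : thetaChi χ x =
      ∑ n ∈ Finset.Ioc 0 ⌊x⌋₊ with n.Prime, χ n * (vonMangoldt n : ℂ) := by
    rw [thetaChi]
    refine Finset.sum_congr ?_ fun n hn => ?_
    · ext n
      simp only [Finset.mem_filter, Finset.mem_range, Finset.mem_Ioc, Nat.lt_succ_iff]
      exact ⟨fun h => ⟨⟨h.2.pos, h.1⟩, h.2⟩, fun h => ⟨h.1.2, h.2⟩⟩
    · rw [ArithmeticFunction.vonMangoldt_apply_prime (Finset.mem_filter.1 hn).2]
  rw [Chebyshev.psi_sub_theta_eq_sum_not_prime, h1, psiChi_eq_sum_Icc,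
    ← Finset.sum_filter_add_sum_filter_not (Finset.Icc 1 ⌊x⌋₊) Nat.Prime,
    show Finset.Icc 1 ⌊x⌋₊ = Finset.Ioc 0 ⌊x⌋₊ from rfl, add_sub_cancel_left]
  refine (norm_sum_le _ _).trans ((Finset.sum_le_sum (g := fun n => vonMangoldt n)
    fun n _ => ?_).trans_eq (by congr!))
  rw [norm_mul, Complex.norm_real, Real.norm_eq_abs, abs_of_nonneg vonMangoldt_nonneg]
  exact mul_le_of_le_one_left vonMangoldt_nonneg (DirichletCharacter.norm_le_one χ _)

lemma exists_norm_thetaChi_sub_primitiveCharacter_le {N : ℕ} [NeZero N]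
    (χ : DirichletCharacter ℂ N) :
    ∃ C, ∀ x, ‖thetaChi χ x - thetaChi χ.primitiveCharacter x‖ ≤ C := by
  refine ⟨∑ p ∈ N.divisors,
    ‖χ p * (Real.log p : ℂ) - χ.primitiveCharacter p * (Real.log p : ℂ)‖, fun x => ?_⟩
  rw [thetaChi, thetaChi, ← Finset.sum_sub_distrib]
  refine (norm_sum_le _ _).trans ?_
  rw [← Finset.sum_filter_of_ne (p := fun p => p ∣ N)]
  · refine Finset.sum_le_sum_of_subset_of_nonneg (fun p hp => ?_) fun _ _ _ => norm_nonneg _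
    exact Nat.mem_divisors.2 ⟨(Finset.mem_filter.1 hp).2, NeZero.ne N⟩
  · intro p hp h
    by_contra hpN
    refine h ?_
    have hp' : p.Prime := (Finset.mem_filter.1 hp).2
    have hco : IsCoprime (p : ℤ) N :=
      Nat.isCoprime_iff_coprime.2 ((Nat.Prime.coprime_iff_not_dvd hp').2 hpN)
    have := χ.primitiveCharacter_apply_of_isCoprime hco
    push_cast at this
    rw [this, sub_self, norm_zero]

lemma exists_seq_le_of_sub_le {N : ℕ} [NeZero N] {χ : DirichletCharacter ℂ N} (hχ1 : χ ≠ 1)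
    (hχ : χ.IsPrimitive) {F : ℝ → ℝ} {C : ℝ}
    (hF : ∀ x, 1 ≤ x → F x - (psiChi χ x).re ≤ C * √x) :
    ∃ x : ℕ → ℝ, Tendsto x atTop atTop ∧ ∀ i,
      F (x i) ≤ -(1 / 20000 * √(x i) * Real.log (Real.log (Real.log (x i)))) := by
  by_cases hfr : ∃ᶠ x in atTop, F x ≤ -(1 / 20000 * √x * Real.log (Real.log (Real.log x)))
  · choose x hx hFx using fun i : ℕ => frequently_atTop.1 hfr i
    exact ⟨x, tendsto_atTop_mono hx tendsto_natCast_atTop_atTop, hFx⟩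
  exfalso
  obtain ⟨X, hX⟩ := eventually_atTop.1 (not_frequently.1 hfr)
  obtain ⟨α, β, h⟩ := ldata_of_isPrimitive hχ1 hχ
  set U : ℝ := max 2 X with hU
  have h4 : 0 ≤ Real.log 4 + 4 := by
    have := Real.log_nonneg (show (1 : ℝ) ≤ 4 by norm_num)
    linarith
  have hK : 0 ≤ (Real.log 4 + 4) * rexp (U / 2) := mul_nonneg h4 (Real.exp_pos _).le
  refine h.false_of_lower_bound (B := |C| + (Real.log 4 + 4) * rexp (U / 2)) (by positivity)
    fun u hu => ?_
  have hll := logLog_nonneg hu.le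
  have hC := le_abs_self C
  rcases le_total U u with hUu | huU
  · have hu2 : 2 ≤ u := (le_max_left _ _).trans hUu
    have hXu : X ≤ rexp u :=
      (le_max_right _ _).trans (hUu.trans ((by linarith : u ≤ u + 1).trans (Real.add_one_le_exp u)))
    have h1 := hX _ hXu
    have h2 := hF _ (Real.one_le_exp hu.le)
    have hs : √(rexp u) = rexp (u / 2) := by rw [Real.exp_half]
    rw [hs, Real.log_exp] at h1
    rw [hs] at h2
    have h3 : Real.log (Real.log u) ≤ logLog u := by
      refine Real.log_le_log (Real.log_pos (by linarith)) (Real.log_le_log hu (by linarith))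
    have he : rexp (u / 2) * rexp (-(u / 2)) = 1 := by rw [← Real.exp_add]; simp
    have hep := Real.exp_pos (-(u / 2))
    push Not at h1
    have h5 : -(1 / 20000 * Real.log (Real.log u) + C) * rexp (u / 2) ≤
        (psiChi χ (rexp u)).re := by linarith
    have h6 := mul_le_mul_of_nonneg_right h5 hep.le
    rw [mul_assoc, he, mul_one] at h6
    rw [expPsi]
    linarith
  · have h1 : |(psiChi χ (rexp u)).re| ≤ (Real.log 4 + 4) * rexp u :=
      (abs_re_le_norm _).trans ((norm_psiChi_le χ _).trans
        (Chebyshev.psi_le_const_mul_self (Real.exp_pos u).le))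
    have h2 := mul_le_mul_of_nonneg_right (abs_le.1 h1).1 (Real.exp_pos (-(u / 2))).le
    have h3 : rexp u * rexp (-(u / 2)) = rexp (u / 2) := by
      rw [← Real.exp_add]
      ring_nf
    rw [← neg_mul, mul_assoc, h3] at h2
    have h5 : (Real.log 4 + 4) * rexp (u / 2) ≤ (Real.log 4 + 4) * rexp (U / 2) :=
      mul_le_mul_of_nonneg_left (Real.exp_le_exp.2 (by linarith)) h4
    have h6 := abs_nonneg C
    rw [expPsi]
    linarith

end LittlewoodOscillation

theorem fixed_q_oscillation_chi :
    ∃ c : ℝ, 0 < c ∧ ∀ (q : ℕ), 3 ≤ q → ∀ χ : DirichletCharacter ℂ q, χ ≠ 1 →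
      (∃ x : ℕ → ℝ, Tendsto x atTop atTop ∧ ∀ i,
        (thetaChi χ (x i)).re ≤
          -(c * Real.sqrt (x i) * Real.log (Real.log (Real.log (x i))))) ∧
      (∃ x : ℕ → ℝ, Tendsto x atTop atTop ∧ ∀ i,
        (psiChi χ (x i)).re ≤
          -(c * Real.sqrt (x i) * Real.log (Real.log (Real.log (x i))))) := by
  refine ⟨1 / 20000, by norm_num, fun q hq χ hχ => ?_⟩
  have : NeZero q := ⟨by omega⟩
  have : NeZero χ.conductor := ⟨χ.conductor_ne_zero⟩
  have h1 : χ.primitiveCharacter ≠ 1 := fun h => hχ <| by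
    rw [← χ.changeLevel_primitiveCharacter, h, map_one]
  obtain ⟨A, hA⟩ := Chebyshev.psi_sub_theta_le_mul_sqrt
  obtain ⟨D, hD⟩ := LittlewoodOscillation.exists_norm_thetaChi_sub_primitiveCharacter_le χ
  have key : ∀ x, 1 ≤ x →
      (thetaChi χ x).re - (psiChi χ.primitiveCharacter x).re ≤ (A + |D|) * √x := by
    intro x hx
    have e1 := (re_le_norm _).trans (hD x)
    have e2 := ((neg_le_abs _).trans (abs_re_le_norm _)).trans
      ((LittlewoodOscillation.norm_psiChi_sub_thetaChi_le χ.primitiveCharacter x).trans (hA x))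
    rw [sub_re] at e1 e2
    have e3 : |D| * 1 ≤ |D| * √x :=
      mul_le_mul_of_nonneg_left (Real.one_le_sqrt.2 hx) (abs_nonneg D)
    have e4 := le_abs_self D
    linarith
  refine ⟨LittlewoodOscillation.exists_seq_le_of_sub_le h1
    χ.primitiveCharacter_isPrimitive key,
    LittlewoodOscillation.exists_seq_le_of_sub_le (F := fun x => (psiChi χ x).re)
      (C := A + (A + |D|)) h1 χ.primitiveCharacter_isPrimitive
      fun x hx => ?_⟩
  have e1 := (re_le_norm _).trans
    ((LittlewoodOscillation.norm_psiChi_sub_thetaChi_le χ x).trans (hA x))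
  rw [sub_re] at e1
  linarith [key x hx]
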